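/- Let G be a finite non-solvable group. Then δ(G) ≤ 16 if and only if G is isomorphic to the alternating group A₅. -/

import Mathlib

/-- A maximal chain of `H` in the ambient group of length `r`: a chain
`H = c 0 < c 1 < ... < c r = ⊤` where each `c i` is a maximal subgroup of `c (i+1)`,
i.e. each step is a covering relation in the subgroup lattice. -/
def IsMaxChainOf {G : Type*} [Group G] (H : Subgroup G) (r : ℕ) (c : ℕ → Subgroup G) : Prop :=
  c 0 = H ∧ c r = ⊤ ∧ ∀ i < r, c i ⋖ c (i + 1)

/-- All maximal chains of `H` in the ambient group have the same length. -/
def AllMaxChainsSameLength {G : Type*} [Group G] (H : Subgroup G) : Prop :=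
  ∀ (r s : ℕ) (c d : ℕ → Subgroup G),
    IsMaxChainOf H r c → IsMaxChainOf H s d → r = s


/-- `delta G` is the number of subgroups of `G` not all of whose maximal chains
in `G` have the same length. -/
noncomputable def delta (G : Type*) [Group G] : ℕ :=
  Nat.card {H : Subgroup G // ¬ AllMaxChainsSameLength H}

namespace ChainLength

/-- `CovChain n a b`: there is a chain of `n` covering relations from `a` up to `b`. -/
inductive CovChain {α : Type*} [Preorder α] : ℕ → α → α → Prop
  | refl (a : α) : CovChain 0 a a
  | cons {n : ℕ} {a b c : α} (h : a ⋖ b) (t : CovChain n b c) : CovChain (n + 1) a c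

section Order

variable {α : Type*} [PartialOrder α]

theorem CovChain.trans {m n : ℕ} {a b c : α} (h : CovChain m a b) (k : CovChain n b c) :
    CovChain (m + n) a c := by
  induction h with
  | refl a => simpa using k
  | cons h _ ih =>
    have := CovChain.cons h (ih k)
    rwa [add_right_comm] at this

theorem CovChain.le {n : ℕ} {a b : α} (h : CovChain n a b) : a ≤ b := by
  induction h with
  | refl a => exact le_rfl
  | cons h _ ih => exact h.le.trans ih

theorem exists_covChain [Finite α] {a b : α} (h : a ≤ b) : ∃ n, CovChain n a b := by
  induction a using WellFoundedGT.induction with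
  | ind a ih =>
    rcases h.eq_or_lt with rfl | h
    · exact ⟨0, .refl _⟩
    · obtain ⟨x, hx, hxb⟩ := exists_covBy_le_of_lt h
      obtain ⟨n, hn⟩ := ih x hx.lt hxb
      exact ⟨n + 1, .cons hx hn⟩

theorem CovChain.map {β : Type*} [PartialOrder β] (f : α ↪o β) (hf : (Set.range f).OrdConnected)
    {n : ℕ} {a b : α} (h : CovChain n a b) : CovChain n (f a) (f b) := by
  induction h with
  | refl a => exact .refl _
  | cons h _ ih => exact .cons ((hf.apply_covBy_apply_iff f).2 h) ih

end Order

variable {G : Type*} [Group G]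

theorem exists_isMaxChainOf_iff {H : Subgroup G} {r : ℕ} :
    (∃ c, IsMaxChainOf H r c) ↔ CovChain r H ⊤ := by
  constructor
  · rintro ⟨c, h0, hr, hc⟩
    induction r generalizing H c with
    | zero => rw [← h0, ← hr]; exact .refl _
    | succ r ih =>
      refine .cons (b := c 1) (h0 ▸ hc 0 (by omega)) (ih (fun i => c (i + 1)) rfl hr ?_)
      exact fun i hi => hc (i + 1) (by omega)
  · intro h
    generalize hK : (⊤ : Subgroup G) = K at h
    induction h with
    | refl a => exact ⟨fun _ => a, rfl, hK.symm, by simp⟩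
    | @cons n a b c h _ ih =>
      obtain ⟨d, h0, hr, hd⟩ := ih hK
      refine ⟨fun i => if i = 0 then a else d (i - 1), by simp, by simpa using hr, ?_⟩
      rintro (_ | i) hi
      · simpa [h0] using h
      · simpa using hd i (by omega)

/-- All chains of covering relations from `H` to the whole group have the same length. -/
def Good (H : Subgroup G) : Prop :=
  ∀ ⦃r s : ℕ⦄, CovChain r H ⊤ → CovChain s H ⊤ → r = s

theorem good_iff {H : Subgroup G} : AllMaxChainsSameLength H ↔ Good H := by
  constructor
  · intro h r s hr hs
    obtain ⟨c, hc⟩ := exists_isMaxChainOf_iff.2 hr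
    obtain ⟨d, hd⟩ := exists_isMaxChainOf_iff.2 hs
    exact h r s c d hc hd
  · intro h r s c d hc hd
    exact h (exists_isMaxChainOf_iff.1 ⟨c, hc⟩) (exists_isMaxChainOf_iff.1 ⟨d, hd⟩)

theorem delta_eq : delta G = Nat.card {H : Subgroup G // ¬ Good H} := by
  simp only [delta, good_iff]

theorem Good.mono [Finite G] {H K : Subgroup G} (h : Good H) (hK : H ≤ K) : Good K := by
  intro r s hr hs
  obtain ⟨n, hn⟩ := exists_covChain hK
  have := h (hn.trans hr) (hn.trans hs)
  omega

section Hom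

variable {G' : Type*} [Group G']

theorem Good.of_map_injective [Finite G] {f : G' →* G} (hf : Function.Injective f)
    {H : Subgroup G'} (h : Good (H.map f)) : Good H := by
  let e : Subgroup G' ↪o Subgroup G :=
    OrderEmbedding.ofMapLEIff (Subgroup.map f) fun _ _ => Subgroup.map_le_map_iff_of_injective hf
  have he : (Set.range e).OrdConnected := by
    refine ⟨?_⟩
    rintro _ ⟨A, rfl⟩ _ ⟨B, rfl⟩ X ⟨-, hX⟩
    refine ⟨X.comap f, ?_⟩
    change (X.comap f).map f = X
    rw [Subgroup.map_comap_eq, inf_eq_right]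
    exact hX.trans (Subgroup.map_le_range f B)
  intro r s hr hs
  obtain ⟨n, hn⟩ := exists_covChain (le_top : e ⊤ ≤ ⊤)
  have := h ((hr.map e he).trans hn) ((hs.map e he).trans hn)
  omega

theorem Good.of_comap_surjective {f : G →* G'} (hf : Function.Surjective f)
    {H : Subgroup G'} (h : Good (H.comap f)) : Good H := by
  let e : Subgroup G' ↪o Subgroup G :=
    OrderEmbedding.ofMapLEIff (Subgroup.comap f) fun _ _ => Subgroup.comap_le_comap_of_surjective hf
  have he : (Set.range e).OrdConnected := by
    refine ⟨?_⟩
    rintro _ ⟨A, rfl⟩ _ ⟨B, rfl⟩ X ⟨hX, -⟩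
    refine ⟨X.map f, ?_⟩
    change (X.map f).comap f = X
    rw [Subgroup.comap_map_eq, sup_eq_left]
    exact le_trans (by rw [← MonoidHom.comap_bot]; exact Subgroup.comap_mono bot_le) hX
  intro r s hr hs
  have ht : e ⊤ = ⊤ := Subgroup.comap_top f
  exact h (ht ▸ hr.map e he) (ht ▸ hs.map e he)

theorem delta_le_of_injective [Finite G] {f : G' →* G} (hf : Function.Injective f) :
    delta G' ≤ delta G := by
  rw [delta_eq, delta_eq]
  refine Nat.card_le_card_of_injective
    (fun H => ⟨H.1.map f, fun h => H.2 (h.of_map_injective hf)⟩) ?_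
  rintro ⟨A, _⟩ ⟨B, _⟩ h
  simpa [Subgroup.map_injective hf |>.eq_iff] using h

theorem delta_eq_of_equiv [Finite G] (e : G' ≃* G) : delta G' = delta G := by
  have : Finite G' := Finite.of_equiv G e.symm.toEquiv
  exact le_antisymm (delta_le_of_injective (f := e.toMonoidHom) e.injective)
    (delta_le_of_injective (f := e.symm.toMonoidHom) e.symm.injective)

theorem good_map_equiv [Finite G] (e : G' ≃* G) {H : Subgroup G'} :
    Good (H.map e.toMonoidHom) ↔ Good H := by
  have : Finite G' := Finite.of_equiv G e.symm.toEquiv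
  refine ⟨fun h => h.of_map_injective e.injective, fun h => ?_⟩
  refine Good.of_comap_surjective (f := e.toMonoidHom) e.surjective ?_
  rwa [Subgroup.comap_map_eq_self_of_injective e.injective]

/-- If there is a bad subgroup outside the image of `comap f`, then `delta` strictly drops. -/
theorem delta_lt_of_surjective [Finite G] {f : G →* G'} (hf : Function.Surjective f)
    {X : Subgroup G} (hX : ¬ Good X) (hker : ¬ f.ker ≤ X) : delta G' < delta G := by
  rw [delta_eq, delta_eq]
  have : Finite G' := Finite.of_surjective f hf
  let φ : {H : Subgroup G' // ¬ Good H} → {H : Subgroup G // ¬ Good H} :=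
    fun H => ⟨H.1.comap f, fun h => H.2 (h.of_comap_surjective hf)⟩
  have hφ : Function.Injective φ := by
    rintro ⟨A, _⟩ ⟨B, _⟩ h
    simpa [φ, Subgroup.comap_injective hf |>.eq_iff] using h
  refine lt_of_le_of_ne (Nat.card_le_card_of_injective φ hφ) fun h => ?_
  obtain ⟨A, hA⟩ := (Nat.bijective_iff_injective_and_card φ |>.2 ⟨hφ, h⟩).2 ⟨X, hX⟩
  have : A.1.comap f = X := congrArg Subtype.val hA
  apply hker
  rw [← this, ← MonoidHom.comap_bot]
  exact Subgroup.comap_mono bot_le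

end Hom

/-- The length of a shortest maximal chain from `H` to the whole group. -/
noncomputable def rk (H : Subgroup G) : ℕ := sInf {n | CovChain n H ⊤}

theorem Good.rk_eq {H : Subgroup G} (h : Good H) {n : ℕ} (hn : CovChain n H ⊤) : rk H = n :=
  h (Nat.sInf_mem (s := {n | CovChain n H ⊤}) ⟨n, hn⟩) hn

/-- The rank of `H` plus the number of prime factors of its order. -/
noncomputable def rho (H : Subgroup G) : ℕ :=
  rk H + ArithmeticFunction.cardFactors (Nat.card H)

theorem card_mul_relIndex {H K : Subgroup G} (h : H ≤ K) :
    Nat.card H * H.relIndex K = Nat.card K := by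
  rw [← Subgroup.relIndex_bot_left, ← Subgroup.relIndex_bot_left K,
    Subgroup.relIndex_mul_relIndex ⊥ H K bot_le h]

theorem relIndex_ne_zero [Finite G] {H K : Subgroup G} : H.relIndex K ≠ 0 :=
  ne_zero_of_dvd_ne_zero Nat.card_pos.ne' (Subgroup.relIndex_dvd_card H K)

theorem covBy_of_prime_relIndex {H K : Subgroup G} (h : H ≤ K) (hp : (H.relIndex K).Prime) :
    H ⋖ K := by
  refine ⟨lt_of_le_of_ne h ?_, fun X hX hXK => ?_⟩
  · rintro rfl
    simp [Nat.not_prime_one] at hp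
  · have := Subgroup.relIndex_mul_relIndex H X K hX.le hXK.le
    rw [← this, Nat.prime_mul_iff] at hp
    simp only [Subgroup.relIndex_eq_one] at hp
    rcases hp with ⟨-, h⟩ | ⟨-, h⟩
    · exact hXK.not_ge h
    · exact hX.not_ge h

section Rho

variable [Finite G] {H K : Subgroup G}

theorem cardFactors_card (h : H ≤ K) :
    ArithmeticFunction.cardFactors (Nat.card K) =
      ArithmeticFunction.cardFactors (Nat.card H) +
        ArithmeticFunction.cardFactors (H.relIndex K) := by
  rw [← card_mul_relIndex h, ArithmeticFunction.cardFactors_mul Nat.card_pos.ne']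
  exact relIndex_ne_zero

theorem Good.rk_covBy (h : Good H) (hK : H ⋖ K) : rk H = rk K + 1 := by
  obtain ⟨n, hn⟩ := exists_covChain (le_top : K ≤ ⊤)
  rw [h.rk_eq (.cons hK hn), (h.mono hK.le).rk_eq hn]

theorem Good.rho_mono (h : Good H) (hK : H ≤ K) : rho H ≤ rho K := by
  obtain ⟨n, hn⟩ := exists_covChain hK
  induction hn with
  | refl a => exact le_rfl
  | @cons n a b c hab t ih =>
    refine le_trans ?_ (ih (h.mono hab.le) t.le)
    have : ArithmeticFunction.cardFactors (a.relIndex b) ≠ 0 := by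
      rw [ne_eq, ArithmeticFunction.cardFactors_eq_zero_iff_eq_zero_or_one]
      simp [relIndex_ne_zero, hab.lt.not_ge]
    rw [rho, rho, h.rk_covBy hab, cardFactors_card hab.le]
    omega

theorem Good.rho_eq_of_prime (h : Good H) (hK : H ≤ K) (hp : (H.relIndex K).Prime) :
    rho H = rho K := by
  rw [rho, rho, h.rk_covBy (covBy_of_prime_relIndex hK hp), cardFactors_card hK,
    ArithmeticFunction.cardFactors_apply_prime hp]
  omega

/-- If `rho` does not increase from a good subgroup `H` to `K`, then all covering relations
between `H` and `K` have prime index. -/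
theorem Good.prime_relIndex (h : Good H) (hle : rho K ≤ rho H) {A B : Subgroup G}
    (hA : H ≤ A) (hAB : A ⋖ B) (hB : B ≤ K) : (A.relIndex B).Prime := by
  have hgA := h.mono hA
  have h1 := h.rho_mono hA
  have h2 := (hgA.mono hAB.le).rho_mono hB
  have h3 : rho B ≤ rho A := by omega
  have : ArithmeticFunction.cardFactors (A.relIndex B) ≠ 0 := by
    rw [ne_eq, ArithmeticFunction.cardFactors_eq_zero_iff_eq_zero_or_one]
    simp [relIndex_ne_zero, hAB.lt.not_ge]
  rw [rho, rho, hgA.rk_covBy hAB, cardFactors_card hAB.le] at h3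
  rw [← ArithmeticFunction.cardFactors_eq_one_iff_prime]
  omega

end Rho

end ChainLength

namespace ChainLength

open scoped Pointwise

variable {G : Type*} [Group G]

section Conj

/-- Conjugation as an action of a group on its subgroups. -/
abbrev conjAction : MulAction G (Subgroup G) := MulAction.compHom _ (MulAut.conj : G →* MulAut G)

attribute [local instance] conjAction

theorem conj_smul_def (g : G) (H : Subgroup G) : g • H = MulAut.conj g • H := rfl

theorem mem_conj_smul {g x : G} {H : Subgroup G} : x ∈ g • H ↔ g⁻¹ * x * g ∈ H := by
  rw [conj_smul_def, Subgroup.mem_pointwise_smul_iff_inv_smul_mem]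
  simp [MulAut.smul_def]

theorem conj_smul_eq_map (g : G) (H : Subgroup G) :
    g • H = H.map (MulAut.conj g).toMonoidHom := rfl

theorem conj_smul_le_iff {g : G} {H K : Subgroup G} : g • H ≤ g • K ↔ H ≤ K :=
  Subgroup.pointwise_smul_le_pointwise_smul_iff

theorem card_conj_smul (g : G) (H : Subgroup G) : Nat.card ↥(g • H) = Nat.card H :=
  (Nat.card_congr (Subgroup.equivSMul (MulAut.conj g) H).toEquiv).symm

theorem conj_smul_eq_iff {g : G} {H : Subgroup G} :
    g • H = H ↔ g ∈ Subgroup.normalizer (H : Set G) := by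
  rw [← Subgroup.inv_mem_iff, Subgroup.mem_normalizer_iff, SetLike.ext_iff]
  simp only [mem_conj_smul, inv_inv]
  exact forall_congr' fun _ => Iff.comm

theorem conj_smul_zpowers (g x : G) :
    g • Subgroup.zpowers x = Subgroup.zpowers (g * x * g⁻¹) := by
  rw [conj_smul_eq_map, MonoidHom.map_zpowers]; rfl

theorem good_conj_smul [Finite G] {g : G} {H : Subgroup G} : Good (g • H) ↔ Good H :=
  good_map_equiv (MulAut.conj g)

theorem CovChain.conj_smul {n : ℕ} {H K : Subgroup G} (h : CovChain n H K) (g : G) :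
    CovChain n (g • H) (g • K) := by
  let e : Subgroup G ↪o Subgroup G := OrderEmbedding.ofMapLEIff (g • ·) fun _ _ => conj_smul_le_iff
  refine h.map e ⟨?_⟩
  rintro _ - _ - X -
  exact ⟨g⁻¹ • X, smul_inv_smul g X⟩

theorem conj_smul_top (g : G) : g • (⊤ : Subgroup G) = ⊤ := by
  ext; simp [mem_conj_smul]

theorem Good.rho_conj_smul [Finite G] {H : Subgroup G} (h : Good H) (g : G) :
    rho (g • H) = rho H := by
  obtain ⟨n, hn⟩ := exists_covChain (le_top : H ≤ ⊤)
  have := hn.conj_smul g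
  rw [conj_smul_top] at this
  rw [rho, rho, h.rk_eq hn, (good_conj_smul.2 h).rk_eq this, card_conj_smul]

end Conj

theorem exists_le_relIndex_eq_prime [Finite G] {p : ℕ} [hp : Fact p.Prime] {H P : Subgroup G}
    (hP : IsPGroup p P) (h : H < P) : ∃ K, H ≤ K ∧ K ≤ P ∧ H.relIndex K = p := by
  obtain ⟨m, hm⟩ := IsPGroup.iff_card.1 hP
  have hH : IsPGroup p (H.subgroupOf P) := hP.to_subgroup _
  obtain ⟨n, hn⟩ := IsPGroup.iff_card.1 hH
  have hHn : Nat.card H = p ^ n := by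
    rw [← hn]
    exact (Nat.card_congr (Subgroup.subgroupOfEquivOfLe h.le).toEquiv).symm
  have hlt : n < m := by
    by_contra! hle
    refine h.ne (Subgroup.eq_of_le_of_card_ge h.le ?_)
    rw [hHn, hm]
    exact Nat.pow_le_pow_right hp.out.pos hle
  obtain ⟨K, hK, hle⟩ := Sylow.exists_subgroup_card_pow_succ
    (hm ▸ Nat.pow_dvd_pow p hlt : p ^ (n + 1) ∣ Nat.card P) hn
  have hHK : H ≤ K.map P.subtype := by
    intro x hx
    exact ⟨⟨x, h.le hx⟩, hle hx, rfl⟩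
  refine ⟨K.map P.subtype, hHK, Subgroup.map_subtype_le K, ?_⟩
  have := card_mul_relIndex hHK
  rw [hHn, Subgroup.card_map_of_injective P.subtype_injective, hK, pow_succ] at this
  exact Nat.eq_of_mul_eq_mul_left (pow_pos hp.out.pos n) this

theorem Good.rho_eq_of_isPGroup [Finite G] {p : ℕ} [hp : Fact p.Prime] {H P : Subgroup G}
    (hH : Good H) (hP : IsPGroup p P) (h : H ≤ P) : rho H = rho P := by
  induction H using WellFoundedGT.induction with
  | ind H ih =>
    rcases h.eq_or_lt with rfl | h
    · rfl
    · obtain ⟨K, hHK, hKP, hK⟩ := exists_le_relIndex_eq_prime hP h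
      have hcov := covBy_of_prime_relIndex hHK (hK ▸ hp.out)
      rw [hH.rho_eq_of_prime hHK (hK ▸ hp.out), ih K hcov.lt (hH.mono hHK) hKP]

theorem Good.rho_eq_of_isPGroup_of_isPGroup [Finite G] {p : ℕ} [hp : Fact p.Prime]
    {H K : Subgroup G} (hH : Good H) (hK : Good K) (pH : IsPGroup p H) (pK : IsPGroup p K) :
    rho H = rho K := by
  obtain ⟨P, hP⟩ := pH.exists_le_sylow
  obtain ⟨R, hR⟩ := pK.exists_le_sylow
  obtain ⟨g, rfl⟩ := MulAction.exists_smul_eq G P R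
  rw [hH.rho_eq_of_isPGroup P.2 hP, hK.rho_eq_of_isPGroup (g • P).2 hR]
  exact ((hH.mono hP).rho_conj_smul g).symm

theorem exists_normal_prime_index [Finite G] [Group.IsSolvable G] {H : Subgroup G} [H.Normal]
    (h : H ≠ ⊤) : ∃ L : Subgroup G, H ≤ L ∧ L.index.Prime := by
  have : Nontrivial (G ⧸ H) := QuotientGroup.nontrivial_iff.2 h
  have hc := Group.IsSolvable.commutator_lt_top_of_nontrivial (G ⧸ H)
  obtain ⟨M, hM, hle⟩ := (eq_top_or_exists_le_coatom (commutator (G ⧸ H))).resolve_left hc.ne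
  have hMn : M.Normal := .of_commutator_le (G ⧸ H) hle
  refine ⟨M.comap (QuotientGroup.mk' H), ?_, ?_⟩
  · conv_lhs => rw [← QuotientGroup.ker_mk' H]
    exact Subgroup.ker_le_comap _ _
  rw [Subgroup.index_comap_of_surjective _ (QuotientGroup.mk'_surjective H)]
  rw [Subgroup.index_eq_card]
  have : Nontrivial ((G ⧸ H) ⧸ M) := QuotientGroup.nontrivial_iff.2 hM.1
  obtain ⟨p, hp, hdvd⟩ := Nat.exists_prime_and_dvd (Finite.one_lt_card (α := (G ⧸ H) ⧸ M)).ne'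
  have := Fact.mk hp
  obtain ⟨x, hx⟩ := exists_prime_orderOf_dvd_card' p hdvd
  have hne : Subgroup.zpowers x ≠ ⊥ := by
    rw [Ne, Subgroup.zpowers_eq_bot]
    rintro rfl
    rw [orderOf_one] at hx
    exact hp.one_lt.ne hx
  have htop : (Subgroup.zpowers x).comap (QuotientGroup.mk' M) = ⊤ := by
    refine hM.2 _ (lt_of_le_of_ne ?_ ?_)
    · conv_lhs => rw [← QuotientGroup.ker_mk' M]
      exact Subgroup.ker_le_comap _ _
    · intro h
      apply hne
      rw [← Subgroup.map_comap_eq_self_of_surjective (QuotientGroup.mk'_surjective M)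
        (Subgroup.zpowers x), ← h, QuotientGroup.map_mk'_self]
  have : Subgroup.zpowers x = ⊤ := by
    rw [← Subgroup.map_comap_eq_self_of_surjective (QuotientGroup.mk'_surjective M)
        (Subgroup.zpowers x), htop,
        Subgroup.map_top_of_surjective _ (QuotientGroup.mk'_surjective M)]
  rw [← Subgroup.card_top, ← this, Nat.card_zpowers, hx]
  exact hp

theorem Good.rho_eq_of_le_normalizer [Finite G] {H K : Subgroup G} (hH : Good H) (h : H ≤ K)
    (hn : K ≤ Subgroup.normalizer (H : Set G)) (hs : Group.IsSolvable K) : rho H = rho K := by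
  induction K using WellFoundedLT.induction with
  | ind K ih =>
    rcases h.eq_or_lt with rfl | hlt
    · rfl
    · have : (H.subgroupOf K).Normal := Subgroup.normal_subgroupOf_of_le_normalizer hn
      have hne : H.subgroupOf K ≠ ⊤ := by
        rw [Ne, Subgroup.subgroupOf_eq_top]; exact hlt.not_ge
      obtain ⟨L, hL, hLp⟩ := exists_normal_prime_index hne
      have hHL : H ≤ L.map K.subtype := fun x hx => ⟨⟨x, h hx⟩, hL hx, rfl⟩
      have hLK : L.map K.subtype ≤ K := Subgroup.map_subtype_le L
      have hrel : ((L.map K.subtype).relIndex K).Prime := by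
        have : (L.map K.subtype).subgroupOf K = L :=
          Subgroup.comap_map_eq_self_of_injective K.subtype_injective L
        rwa [Subgroup.relIndex, this]
      rw [ih _ (covBy_of_prime_relIndex hLK hrel).lt hHL (hLK.trans hn)
        (Group.isSolvable_of_isSolvable_injective (Subgroup.inclusion_injective hLK)),
        (hH.mono hHL).rho_eq_of_prime hLK hrel]

end ChainLength

namespace ChainLength

open scoped Pointwise

variable {G : Type*} [Group G]

section Simple

variable [Finite G] [IsSimpleGroup G] (hns : ¬ Group.IsSolvable G)
include hns

theorem not_isPGroup {p : ℕ} [Fact p.Prime] : ¬ IsPGroup p G := fun h =>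
  have := h.isNilpotent
  hns inferInstance

omit [Finite G] in
theorem not_comm : ¬ ∀ a b : G, a * b = b * a := fun h =>
  hns (IsSimpleGroup.comm_iff_isSolvable.1 h)

omit [Finite G] in
theorem hom_eq_one {A : Type*} [CommGroup A] (f : G →* A) (x : G) : f x = 1 := by
  rcases (inferInstance : f.ker.Normal).eq_bot_or_eq_top with h | h
  · refine absurd (fun a b => ?_) (not_comm hns)
    apply (MonoidHom.ker_eq_bot_iff f).1 h
    rw [map_mul, map_mul, mul_comm]
  · rw [← MonoidHom.mem_ker, h]; trivial

section Sylow

variable {p : ℕ} [hp : Fact p.Prime] (P : Sylow p G)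

theorem sylow_ne_top : (P : Subgroup G) ≠ ⊤ := by
  intro h
  apply not_isPGroup hns (p := p)
  have := P.2
  rw [h] at this
  exact this.of_equiv Subgroup.topEquiv

theorem normalizer_ne_top_of_isPGroup {D : Subgroup G} (hD : IsPGroup p D) (h : D ≠ ⊥) :
    Subgroup.normalizer (D : Set G) ≠ ⊤ := by
  intro ht
  rw [Subgroup.normalizer_eq_top_iff] at ht
  apply not_isPGroup hns (p := p)
  have := ht.eq_bot_or_eq_top.resolve_left h
  subst this
  exact hD.of_equiv Subgroup.topEquiv

variable (hdvd : p ∣ Nat.card G)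
include hdvd

omit [IsSimpleGroup G] hns in
theorem sylow_ne_bot : (P : Subgroup G) ≠ ⊥ := P.ne_bot_of_dvd_card hdvd

omit [IsSimpleGroup G] hns hdvd in
theorem index_normalizer_mod : (Subgroup.normalizer (P : Set G)).index % p = 1 := by
  rw [← P.card_eq_index_normalizer]
  have := card_sylow_modEq_one p G
  rwa [Nat.ModEq, Nat.mod_eq_of_lt hp.out.one_lt] at this

theorem index_normalizer_ne_one : (Subgroup.normalizer (P : Set G)).index ≠ 1 := by
  rw [Ne, Subgroup.index_eq_one]
  exact normalizer_ne_top_of_isPGroup hns P.2 (sylow_ne_bot P hdvd)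

/-- **Burnside's transfer theorem** for a simple group. -/
theorem not_normalizer_le_centralizer :
    ¬ Subgroup.normalizer (P : Set G) ≤ Subgroup.centralizer (P : Set G) := by
  intro h
  have hc := MonoidHom.ker_transferSylow_isComplement' P h
  rcases (inferInstance : (MonoidHom.transferSylow P h).ker.Normal).eq_bot_or_eq_top with h' | h'
  · rw [h', Subgroup.isComplement'_bot_left] at hc
    exact sylow_ne_top hns P hc
  · rw [h', Subgroup.isComplement'_top_left] at hc
    exact sylow_ne_bot P hdvd hc

theorem card_normalizer_ne_card [IsMulCommutative P] :
    Nat.card (Subgroup.normalizer (P : Set G)) ≠ Nat.card P := by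
  intro h
  refine not_normalizer_le_centralizer hns P hdvd ?_
  have : Subgroup.normalizer (P : Set G) = P :=
    (Subgroup.eq_of_le_of_card_ge Subgroup.le_normalizer h.le).symm
  rw [this]
  exact Subgroup.le_centralizer (P : Subgroup G)

end Sylow

section Action

variable {X : Type*} [MulAction G X]

omit [Finite G] hns in
theorem toPermHom_injective [Nontrivial X] [MulAction.IsPretransitive G X] :
    Function.Injective (MulAction.toPermHom G X) := by
  rw [← MonoidHom.ker_eq_bot_iff]
  refine (inferInstance : (MulAction.toPermHom G X).ker.Normal).eq_bot_or_eq_top.resolve_right ?_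
  intro h
  obtain ⟨x, y, hxy⟩ := exists_pair_ne X
  obtain ⟨g, rfl⟩ := MulAction.exists_smul_eq G x y
  have : g ∈ (MulAction.toPermHom G X).ker := h ▸ Subgroup.mem_top g
  rw [MonoidHom.mem_ker] at this
  exact hxy (congrArg (· x) this).symm

omit [Finite G] in
theorem exists_hom_alternating [Finite X] [Nontrivial X] [MulAction.IsPretransitive G X]
    [Fintype X] [DecidableEq X] : ∃ f : G →* alternatingGroup X, Function.Injective f := by
  refine ⟨(MulAction.toPermHom G X).codRestrict (alternatingGroup X) fun g => ?_, ?_⟩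
  · rw [Equiv.Perm.mem_alternatingGroup]
    exact hom_eq_one hns (Equiv.Perm.sign.comp (MulAction.toPermHom G X)) g
  · rw [MonoidHom.injective_codRestrict]
    exact toPermHom_injective

omit [Finite G] in
/-- A simple group acts on a set by even permutations. -/
theorem two_mul_card_dvd_factorial [Finite X] [Nontrivial X] [MulAction.IsPretransitive G X] :
    2 * Nat.card G ∣ (Nat.card X).factorial := by
  classical
  have := Fintype.ofFinite X
  obtain ⟨f, hf⟩ := exists_hom_alternating hns (X := X)
  rw [← Nat.card_perm, ← two_mul_nat_card_alternatingGroup]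
  exact Nat.mul_dvd_mul_left 2 (Subgroup.card_dvd_of_injective f hf)

end Action

theorem two_mul_card_dvd_factorial_index {H : Subgroup G} (h : H ≠ ⊤) :
    2 * Nat.card G ∣ H.index.factorial := by
  have : Nontrivial (G ⧸ H) := QuotientGroup.nontrivial_iff.2 h
  rw [H.index_eq_card]
  exact two_mul_card_dvd_factorial hns

omit [IsSimpleGroup G] [Finite G] hns in
theorem isMulCommutative_of_card_eq_prime {p : ℕ} [hp : Fact p.Prime] {P : Subgroup G}
    (h : Nat.card P = p) : IsMulCommutative P :=
  have := isCyclic_of_prime_card h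
  IsCyclic.isMulCommutative

theorem five_le_index {H : Subgroup G} (h : H ≠ ⊤) : 5 ≤ H.index := by
  by_contra! hlt
  have h12 : 2 * Nat.card G ∣ 24 :=
    (two_mul_card_dvd_factorial_index hns h).trans
      ((Nat.factorial_dvd_factorial (by omega : H.index ≤ 4)).trans (by decide))
  replace h12 : Nat.card G ∣ 12 := Nat.dvd_of_mul_dvd_mul_left two_pos (by simpa using h12)
  have key : ∀ n ∈ Nat.divisors 12, n ∣ 4 ∨ 3 ∣ n ∧ ∀ k ∈ Nat.divisors n, k % 3 = 1 →
      k ≠ 1 → n = 12 ∧ k = 4 := by decide +kernel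
  rcases key _ (Nat.mem_divisors.2 ⟨h12, by norm_num⟩) with h4 | ⟨h3, hk⟩
  · obtain ⟨k, -, hk⟩ := (Nat.dvd_prime_pow Nat.prime_two (i := Nat.card G) (m := 2)).1 h4
    exact not_isPGroup hns (p := 2) (IsPGroup.of_card hk)
  · have := Fact.mk Nat.prime_three
    obtain ⟨P⟩ := (inferInstance : Nonempty (Sylow 3 G))
    have := hk _ (Nat.mem_divisors.2 ⟨Subgroup.index_dvd_card _, Nat.card_pos.ne'⟩)
      (index_normalizer_mod P) (index_normalizer_ne_one hns P h3)
    have hN := (Subgroup.normalizer (P : Set G)).card_mul_index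
    have hP : Nat.card P = 3 := by
      rw [P.card_eq_multiplicity, this.1,
        (by decide +kernel : (12 : ℕ).factorization 3 = 1), pow_one]
    have hc := isMulCommutative_of_card_eq_prime hP
    refine card_normalizer_ne_card hns P h3 ?_
    rw [this.1, this.2] at hN
    omega

end Simple

end ChainLength

namespace ChainLength

open scoped Pointwise

theorem not_isSolvable_of_card {A : Type*} [Group A] [Finite A] [IsSimpleGroup A]
    (h : ¬ (Nat.card A).Prime) : ¬ Group.IsSolvable A := fun hs =>
  let : CommGroup A := { (inferInstance : Group A) with
    mul_comm := IsSimpleGroup.comm_iff_isSolvable.2 hs }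
  h IsSimpleGroup.prime_card

section Alternating

variable {α : Type*} [Fintype α] [DecidableEq α]

theorem card_alternating_five (h : Nat.card α = 5) : Nat.card (alternatingGroup α) = 60 := by
  have : Nontrivial α := Finite.one_lt_card_iff_nontrivial.1 (by omega)
  rw [nat_card_alternatingGroup, h]; rfl

theorem card_alternating_six (h : Nat.card α = 6) : Nat.card (alternatingGroup α) = 360 := by
  have : Nontrivial α := Finite.one_lt_card_iff_nontrivial.1 (by omega)
  rw [nat_card_alternatingGroup, h]; rfl

theorem not_isSolvable_alternating_five (h : Nat.card α = 5) :
    ¬ Group.IsSolvable (alternatingGroup α) :=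
  have := alternatingGroup.isSimpleGroup h.ge
  not_isSolvable_of_card (by rw [card_alternating_five h]; norm_num)

theorem not_isSolvable_alternating_six (h : Nat.card α = 6) :
    ¬ Group.IsSolvable (alternatingGroup α) :=
  have := alternatingGroup.isSimpleGroup (α := α) (by omega)
  not_isSolvable_of_card (by rw [card_alternating_six h]; norm_num)

end Alternating

variable {G : Type*} [Group G] [Finite G] [IsSimpleGroup G] (hns : ¬ Group.IsSolvable G)
include hns

theorem sylow_numbers {p : ℕ} [hp : Fact p.Prime] (P : Sylow p G) (hdvd : p ∣ Nat.card G) :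
    ∃ n m, n = (Subgroup.normalizer (P : Set G)).index ∧
      m = Nat.card (Subgroup.normalizer (P : Set G)) ∧
      n * m = Nat.card G ∧ n % p = 1 ∧ 5 ≤ n ∧ Nat.card P ∣ m ∧ n ∣ P.index := by
  refine ⟨_, _, rfl, rfl, (Subgroup.normalizer (P : Set G)).index_mul_card,
    index_normalizer_mod P, ?_, Subgroup.card_dvd_of_le Subgroup.le_normalizer,
    Subgroup.index_dvd_of_le Subgroup.le_normalizer⟩
  apply five_le_index hns
  exact normalizer_ne_top_of_isPGroup hns P.2 (sylow_ne_bot P hdvd)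

theorem index_normalizer_sylow_two [Fact (Nat.Prime 2)] (h60 : Nat.card G = 60) (P : Sylow 2 G) :
    (Subgroup.normalizer (P : Set G)).index = 5 := by
  have hP : Nat.card P = 2 ^ 2 := by
    rw [P.card_eq_multiplicity, h60, (by decide +kernel : (60 : ℕ).factorization 2 = 2)]
  have hc := IsPGroup.isMulCommutative_of_card_eq_prime_sq hP
  have hd : 2 ∣ Nat.card G := by omega
  have hb := card_normalizer_ne_card hns P hd
  obtain ⟨n, m, hn, hm, hnm, -, h5n, hPm, -⟩ := sylow_numbers hns P hd
  rw [← hm, hP] at hb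
  rw [hP] at hPm
  rw [← hn]
  have key : ∀ n ∈ Nat.divisors 60, ∀ m ∈ Nat.divisors 60, n * m = 60 → 5 ≤ n → 4 ∣ m →
    m ≠ 4 → n = 5 := by decide +kernel
  rw [h60] at hnm
  exact key n (Nat.mem_divisors.2 ⟨Dvd.intro _ hnm, by norm_num⟩) m
    (Nat.mem_divisors.2 ⟨Dvd.intro_left _ hnm, by norm_num⟩) hnm h5n hPm hb

theorem two_mul_card_dvd_of_index {H : Subgroup G} {n : ℕ} (h : H.index = n) (hn : n ≠ 1) :
    2 * Nat.card G ∣ n.factorial := by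
  subst h
  exact two_mul_card_dvd_factorial_index hns (by rwa [Ne, ← Subgroup.index_eq_one])

theorem nonempty_equiv_of_index_five {H : Subgroup G} (h : H.index = 5) :
    Nonempty (G ≃* alternatingGroup (Fin 5)) := by
  classical
  have hne : H ≠ ⊤ := by rintro rfl; simp at h
  have : Nontrivial (G ⧸ H) := QuotientGroup.nontrivial_iff.2 hne
  have : Fintype (G ⧸ H) := Fintype.ofFinite _
  have hcard : Nat.card (G ⧸ H) = 5 := by rw [← H.index_eq_card, h]
  obtain ⟨f, hf⟩ := exists_hom_alternating hns (X := G ⧸ H)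
  have hA := card_alternating_five hcard
  have := alternatingGroup.isSimpleGroup hcard.ge
  have h5 : 5 ∣ Nat.card G := h ▸ H.index_dvd_card
  have hr : f.range = ⊤ := by
    by_contra hr
    have hi := five_le_index (not_isSolvable_alternating_five hcard) hr
    have hm := f.range.card_mul_index
    rw [hA, Nat.card_congr (MonoidHom.ofInjective hf).toEquiv.symm] at hm
    have := Fact.mk Nat.prime_five
    obtain ⟨P⟩ := (inferInstance : Nonempty (Sylow 5 G))
    obtain ⟨n, m, -, -, hnm, hn, h5n, hP, -⟩ := sylow_numbers hns P h5
    have h5P : 5 ≤ m := by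
      refine (Nat.le_of_dvd Nat.card_pos (P.dvd_card_of_dvd_card h5)).trans
        (Nat.le_of_dvd (Nat.pos_of_ne_zero ?_) hP)
      rintro rfl
      simp [Nat.card_pos.ne] at hnm
    have : 6 ≤ n := by
      by_contra
      have : n = 5 := by omega
      omega
    nlinarith
  exact ⟨((MonoidHom.ofInjective hf).trans (hr ▸ Subgroup.topEquiv)).trans
    (Equiv.altCongrHom (Finite.equivFinOfCardEq hcard))⟩

/-- In a minimal simple group a subgroup of index six gives one of index five. -/
theorem exists_index_five_of_index_six
    (hmin : ∀ M : Subgroup G, M ≠ ⊤ → Group.IsSolvable M) {H : Subgroup G} (h : H.index = 6) :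
    ∃ K : Subgroup G, K.index = 5 := by
  classical
  have hne : H ≠ ⊤ := by rintro rfl; simp at h
  have : Nontrivial (G ⧸ H) := QuotientGroup.nontrivial_iff.2 hne
  have : Fintype (G ⧸ H) := Fintype.ofFinite _
  have hcard : Nat.card (G ⧸ H) = 6 := by rw [← H.index_eq_card, h]
  obtain ⟨f, hf⟩ := exists_hom_alternating hns (X := G ⧸ H)
  have hA := card_alternating_six hcard
  have := alternatingGroup.isSimpleGroup (α := G ⧸ H) (by omega)
  have h6 : 6 ∣ Nat.card G := h ▸ H.index_dvd_card
  have hm := f.range.card_mul_index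
  rw [hA, Nat.card_congr (MonoidHom.ofInjective hf).toEquiv.symm] at hm
  by_cases hr : f.range = ⊤
  · exfalso
    obtain ⟨s, hs⟩ := Finset.exists_subset_card_eq (n := 5) (s := (Finset.univ : Finset (G ⧸ H)))
      (by rw [Finset.card_univ, ← Nat.card_eq_fintype_card]; omega)
    have hs5 : Nat.card s = 5 := by rw [Nat.card_eq_fintype_card, Fintype.card_coe, hs.2]
    let e : G ≃* alternatingGroup (G ⧸ H) :=
      (MonoidHom.ofInjective hf).trans (hr ▸ Subgroup.topEquiv)
    let φ : alternatingGroup s →* G := e.symm.toMonoidHom.comp (alternatingGroup.ofSubtype s)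
    have hφ : Function.Injective φ := e.symm.injective.comp alternatingGroup.ofSubtype_injective
    have hcφ : Nat.card φ.range = 60 := by
      rw [← Nat.card_congr (MonoidHom.ofInjective hφ).toEquiv, card_alternating_five hs5]
    refine not_isSolvable_alternating_five hs5 ?_
    have := hmin φ.range fun ht => by
      rw [ht, Subgroup.card_top] at hcφ
      rw [hr, Subgroup.index_top] at hm
      omega
    exact Group.isSolvable_of_isSolvable_injective (MonoidHom.ofInjective hφ).injective
  have hi := five_le_index (not_isSolvable_alternating_six hcard) hr
  have hcG : Nat.card G ∣ 360 := Dvd.intro _ hm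
  have hle : Nat.card G ≤ 72 := by nlinarith
  have key : ∀ n ∈ Nat.divisors 360, n ≤ 72 → 6 ∣ n →
      (n = 60 ∨ n = 30) ∨ 3 ∣ n ∧ ∀ k ∈ Nat.divisors n, k % 3 = 1 → k < 5 := by decide +kernel
  rcases key _ (Nat.mem_divisors.2 ⟨hcG, by norm_num⟩) hle h6 with (h60 | h30) | ⟨h3, hk⟩
  · have := Fact.mk Nat.prime_two
    exact ⟨_, index_normalizer_sylow_two hns h60 default⟩
  · exfalso
    have := Fact.mk Nat.prime_five
    obtain ⟨P⟩ := (inferInstance : Nonempty (Sylow 5 G))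
    have hP : Nat.card P = 5 := by
      rw [P.card_eq_multiplicity, h30, (by decide +kernel : (30 : ℕ).factorization 5 = 1), pow_one]
    have hc := isMulCommutative_of_card_eq_prime hP
    have hd : 5 ∣ Nat.card G := by omega
    have hb := card_normalizer_ne_card hns P hd
    obtain ⟨n, m, hn, hm, hnm, hn5, h5n, hPm, -⟩ := sylow_numbers hns P hd
    rw [← hm, hP] at hb
    rw [hP] at hPm
    rw [h30] at hnm
    have key : ∀ n ∈ Nat.divisors 30, ∀ m ∈ Nat.divisors 30, n * m = 30 → 5 ≤ n → n % 5 = 1 →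
      5 ∣ m → m = 5 := by decide +kernel
    exact hb (key n (Nat.mem_divisors.2 ⟨Dvd.intro _ hnm, by norm_num⟩) m
      (Nat.mem_divisors.2 ⟨Dvd.intro_left _ hnm, by norm_num⟩) hnm h5n hn5 hPm)
  · exfalso
    have := Fact.mk Nat.prime_three
    obtain ⟨P⟩ := (inferInstance : Nonempty (Sylow 3 G))
    obtain ⟨n, m, hn, hm, hnm, hn5, h5n, hPm, -⟩ := sylow_numbers hns P h3
    have := hk n (Nat.mem_divisors.2 ⟨Dvd.intro _ hnm, Nat.card_pos.ne'⟩) hn5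
    omega

end ChainLength

namespace ChainLength

open scoped Pointwise
open MulAction

section FixedPoints

variable {G X : Type*} [Group G] [MulAction G X] [Finite X]

/-- A `p`-group fixes modulo `p` as many points of an invariant set as there are points. -/
theorem ncard_inter_fixed_modEq {p : ℕ} [hp : Fact p.Prime] {P : Subgroup G} (hP : IsPGroup p P)
    {S : Set X} (hS : ∀ g ∈ P, ∀ s ∈ S, g • s ∈ S) :
    (S ∩ {s | ∀ g ∈ P, g • s = s}).ncard ≡ S.ncard [MOD p] := by
  let T : SubMulAction P X := { carrier := S, smul_mem' := fun g s hs => hS g g.2 s hs }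
  have h := hP.card_modEq_card_fixedPoints T
  refine Nat.ModEq.trans ?_ h.symm
  rw [← Nat.card_coe_set_eq]
  refine congrArg (· % p) (Nat.card_congr ?_)
  exact {
    toFun := fun s => ⟨⟨s.1, s.2.1⟩, fun g => Subtype.ext (s.2.2 g g.2)⟩
    invFun := fun s => ⟨s.1.1, s.1.2, fun g hg => congrArg Subtype.val (s.2 ⟨g, hg⟩)⟩
    left_inv := fun _ => rfl
    right_inv := fun _ => rfl }

theorem ncard_inter_fixedBy_modEq {p k : ℕ} [hp : Fact p.Prime] {x : G} (hx : orderOf x = p ^ k)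
    {S : Set X} (hS : ∀ s ∈ S, x • s ∈ S) : (S ∩ fixedBy X x).ncard ≡ S.ncard [MOD p] := by
  have hP : IsPGroup p (Subgroup.zpowers x) := .of_card (n := k) (by rw [Nat.card_zpowers, hx])
  have hS' : ∀ g ∈ Subgroup.zpowers x, ∀ s ∈ S, g • s ∈ S := by
    have hfin : IsOfFinOrder x := by
      rw [← orderOf_pos_iff, hx]; exact pow_pos hp.out.pos k
    rintro g hg s hs
    rw [← hfin.mem_powers_iff_mem_zpowers] at hg
    obtain ⟨n, rfl⟩ := hg
    simp only
    induction n with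
    | zero => simpa using hs
    | succ n ih => rw [pow_succ', mul_smul]; exact hS _ ih
  have h := ncard_inter_fixed_modEq hP hS'
  have he : S ∩ fixedBy X x = S ∩ {s | ∀ g ∈ Subgroup.zpowers x, g • s = s} := by
    ext s
    refine and_congr_right fun _ => ⟨fun h g hg => ?_, fun h => h x (Subgroup.mem_zpowers x)⟩
    have : x ∈ stabilizer G s := h
    exact (Subgroup.zpowers_le.2 this) hg
  rwa [he]

theorem ncard_fixedBy_modEq {p k : ℕ} [hp : Fact p.Prime] {x : G} (hx : orderOf x = p ^ k) :
    (fixedBy X x).ncard ≡ Nat.card X [MOD p] := by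
  have := ncard_inter_fixedBy_modEq hx (S := (Set.univ : Set X)) fun _ _ => trivial
  rwa [Set.univ_inter, Set.ncard_univ] at this

omit [Finite X] in
theorem smul_mem_fixedBy_of_commute {x y : G} (h : Commute x y) {s : X} (hs : s ∈ fixedBy X x) :
    y • s ∈ fixedBy X x := by
  rw [mem_fixedBy] at hs ⊢
  rw [smul_smul, h.eq, mul_smul, hs]

/-- Commuting elements `x` of prime order `r` and `y` such that all fixed points of `x` are fixed
by `y`: the number of points moved by `y` is divisible by `r`. -/
theorem exists_ncard_compl_fixedBy {r k : ℕ} [hr : Fact r.Prime] {x y : G}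
    (hx : orderOf x = r ^ k) (h : Commute x y) (hxy : fixedBy X x ⊆ fixedBy X y) :
    r ∣ ((fixedBy X y)ᶜ : Set X).ncard := by
  have h1 := ncard_inter_fixedBy_modEq hx (S := ((fixedBy X y)ᶜ : Set X)) fun s hs hs' => hs <| by
    have : Commute y x⁻¹ := h.symm.inv_right
    simpa using smul_mem_fixedBy_of_commute this hs'
  have h2 : ((fixedBy X y)ᶜ ∩ fixedBy X x : Set X) = ∅ := by
    ext s
    simp only [Set.mem_inter_iff, Set.mem_compl_iff, Set.mem_empty_iff_false, iff_false, not_and]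
    tauto
  rw [h2, Set.ncard_empty] at h1
  exact (Nat.modEq_zero_iff_dvd.1 h1.symm)

theorem false_of_commute_aux [FaithfulSMul G X] {r k m : ℕ} [hr : Fact r.Prime] {x y : G}
    (hx : orderOf x = r ^ k) (hy : y ≠ 1) (h : Commute x y)
    (hxy : fixedBy X x ⊆ fixedBy X y) (hm : m ∣ ((fixedBy X y)ᶜ : Set X).ncard)
    (hmr : Nat.Coprime m r) (hlt : Nat.card X < (fixedBy X x).ncard + m * r) : False := by
  have h1 := hmr.mul_dvd_of_dvd_of_dvd hm (exists_ncard_compl_fixedBy hx h hxy)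
  have h2 := Set.ncard_add_ncard_compl (fixedBy X y)
  have h3 := Set.ncard_le_ncard hxy
  have h4 : ((fixedBy X y)ᶜ : Set X).ncard = 0 := Nat.eq_zero_of_dvd_of_lt h1 (by omega)
  rw [Set.ncard_eq_zero, Set.compl_empty_iff] at h4
  apply hy
  apply FaithfulSMul.eq_of_smul_eq_smul (α := X)
  intro s
  rw [one_smul]
  exact (h4 ▸ Set.mem_univ s : s ∈ fixedBy X y)

/-- An element of prime order `p` cannot commute with an element of another prime order `r`
with fewer than `p` fixed points if it moves fewer than `p * r` points. -/
theorem false_of_commute [FaithfulSMul G X] {r p : ℕ} [hr : Fact r.Prime] [hp : Fact p.Prime]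
    {x y : G} (hx : orderOf x = r) (hy : orderOf y = p) (hrp : r ≠ p) (h : Commute x y)
    (hf : (fixedBy X x).ncard < p) (hlt : Nat.card X < (fixedBy X x).ncard + p * r) : False := by
  have hx' : orderOf x = r ^ 1 := by rw [hx, pow_one]
  have hy' : orderOf y = p ^ 1 := by rw [hy, pow_one]
  refine false_of_commute_aux (m := p) hx' (y := y) ?_ h ?_ ?_
    ((Nat.coprime_primes hp.out hr.out).2 hrp.symm) hlt
  · rintro rfl
    rw [orderOf_one] at hy
    exact hp.out.one_lt.ne hy
  · have h1 := ncard_inter_fixedBy_modEq hy' (S := fixedBy X x) fun s hs =>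
      smul_mem_fixedBy_of_commute h hs
    have h2 : (fixedBy X x ∩ fixedBy X y).ncard ≤ (fixedBy X x).ncard :=
      Set.ncard_le_ncard Set.inter_subset_left
    have h3 := Nat.ModEq.eq_of_lt_of_lt h1 (h2.trans_lt hf) hf
    exact Set.inter_eq_left.1 (Set.eq_of_subset_of_ncard_le Set.inter_subset_left h3.ge)
  · have h1 := ncard_fixedBy_modEq (X := X) hy'
    have h2 := Set.ncard_add_ncard_compl (fixedBy X y)
    rw [← h2] at h1
    exact Nat.modEq_zero_iff_dvd.1 (Nat.ModEq.add_left_cancel' (fixedBy X y).ncard h1.symm)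

/-- A subgroup `W` normalized but not centralized at any point by `x`, and acting freely on the
fixed points of `x`. -/
theorem ncard_fixedBy_mul_card_le {x : G} {W : Subgroup G} (hW : ∀ w ∈ W, x * w * x⁻¹ ∈ W)
    (hx : ∀ w ∈ W, Commute x w → w = 1)
    (hfree : ∀ w ∈ W, ∀ s ∈ fixedBy X x, w • s = s → w = 1) :
    (fixedBy X x).ncard * Nat.card W ≤ Nat.card X := by
  rw [← Nat.card_coe_set_eq, ← Nat.card_prod]
  refine Nat.card_le_card_of_injective (fun q => q.2.1 • q.1.1) ?_
  rintro ⟨⟨c, hc⟩, ⟨w, hw⟩⟩ ⟨⟨c', hc'⟩, ⟨w', hw'⟩⟩ h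
  simp only at h
  obtain ⟨u, rfl⟩ : ∃ u, w = w' * u := ⟨w'⁻¹ * w, by group⟩
  have hu : u ∈ W := (Subgroup.mul_mem_cancel_left _ hw').1 hw
  rw [mul_smul, smul_left_cancel_iff] at h
  have h1 : u⁻¹ * (x * u * x⁻¹) = 1 := by
    refine hfree _ (mul_mem (inv_mem hu) (hW u hu)) c hc ?_
    have hc2 : x⁻¹ • c = c := inv_smul_eq_iff.2 (mem_fixedBy.1 hc).symm
    rw [mul_smul, mul_smul, mul_smul, hc2, h, mem_fixedBy.1 hc', ← h, inv_smul_smul]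
  have h2 : u = 1 := by
    apply hx u hu
    rw [inv_mul_eq_one] at h1
    rw [Commute, SemiconjBy]
    nth_rw 2 [h1]
    group
  subst h2
  rw [one_smul] at h
  subst h
  simp

section Parity

variable [Finite G] [IsSimpleGroup G] (hns : ¬ Group.IsSolvable G)
include hns

omit [Finite G] in
theorem four_dvd_ncard_compl_fixedBy {t : G} (ht : orderOf t = 2) :
    4 ∣ ((fixedBy X t)ᶜ : Set X).ncard := by
  classical
  have := Fintype.ofFinite X
  have hs := hom_eq_one hns (Equiv.Perm.sign.comp (toPermHom G X)) t
  have hσ : (toPermHom G X t) ^ 2 = 1 := by rw [← map_pow, ← ht, pow_orderOf_eq_one, map_one]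
  rw [MonoidHom.comp_apply, Equiv.Perm.sign_of_pow_two_eq_one hσ] at hs
  have h0 : Fintype.card (Function.fixedPoints (toPermHom G X t)) = (fixedBy X t).ncard := by
    rw [← Nat.card_eq_fintype_card, ← Nat.card_coe_set_eq]
    rfl
  have h1 := Set.ncard_add_ncard_compl (fixedBy X t)
  have h2 := ncard_fixedBy_modEq (X := X) (x := t) (p := 2) (k := 1) ht
  rw [h0, ← Nat.card_eq_fintype_card, ← h1, Nat.add_sub_cancel_left] at hs
  have h3 : Even (((fixedBy X t)ᶜ : Set X).ncard / 2) := by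
    by_contra hodd
    rw [Nat.not_even_iff_odd] at hodd
    rw [hodd.neg_one_pow] at hs
    exact absurd hs (by decide)
  rw [Nat.ModEq] at h2
  obtain ⟨m, hm⟩ := h3
  omega

omit [Finite G] in
theorem false_of_commute_involution [Nontrivial X] [IsPretransitive G X] {r : ℕ}
    [hr : Fact r.Prime] {x t : G} (hx : orderOf x = r) (ht : orderOf t = 2) (hr2 : r ≠ 2)
    (h : Commute x t) (hf : (fixedBy X x).ncard < 2)
    (hlt : Nat.card X < (fixedBy X x).ncard + 4 * r) : False := by
  have : FaithfulSMul G X := ⟨fun {a b} h => toPermHom_injective (X := X) (Equiv.ext h)⟩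
  refine false_of_commute_aux (m := 4) (r := r) (k := 1) (by rw [hx, pow_one]) (y := t) ?_ h ?_
    (four_dvd_ncard_compl_fixedBy hns ht) ?_ hlt
  · rintro rfl
    rw [orderOf_one] at ht
    omega
  · have h1 := ncard_inter_fixedBy_modEq (p := 2) (k := 1) ht (S := fixedBy X x) fun s hs =>
      smul_mem_fixedBy_of_commute h hs
    have h2 : (fixedBy X x ∩ fixedBy X t).ncard ≤ (fixedBy X x).ncard :=
      Set.ncard_le_ncard Set.inter_subset_left
    have h3 := Nat.ModEq.eq_of_lt_of_lt h1 (h2.trans_lt hf) hf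
    exact Set.inter_eq_left.1 (Set.eq_of_subset_of_ncard_le Set.inter_subset_left h3.ge)
  · exact Nat.Coprime.pow_left 2 ((Nat.coprime_primes Nat.prime_two hr.out).2 hr2.symm)

end Parity

end FixedPoints

/-- An element of prime power order `p ^ k` normalizing a group of order `p` centralizes it. -/
theorem commute_of_normalizes {G : Type*} [Group G] [Finite G] {p k : ℕ} [hp : Fact p.Prime]
    {x : G} (hx : orderOf x = p ^ k) {D : Subgroup G} (hD : Nat.card D = p)
    (hn : x ∈ Subgroup.normalizer (D : Set G)) : ∀ d ∈ D, Commute x d := by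
  have hx' : orderOf (ConjAct.toConjAct x) = p ^ k := by
    rw [← hx]; exact orderOf_injective ConjAct.toConjAct.toMonoidHom ConjAct.toConjAct.injective x
  have h := ncard_inter_fixedBy_modEq (X := G) hx' (S := (D : Set G)) fun d hd => by
    rw [ConjAct.toConjAct_smul]
    exact (Subgroup.mem_normalizer_iff.1 hn d).1 hd
  have h0 : (D : Set G).ncard = p := by rw [← hD]; exact Nat.card_coe_set_eq (D : Set G)
  have hpos : 0 < ((D : Set G) ∩ fixedBy G (ConjAct.toConjAct x)).ncard := by
    rw [Set.ncard_pos]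
    exact ⟨1, D.one_mem, smul_one _⟩
  have hle : ((D : Set G) ∩ fixedBy G (ConjAct.toConjAct x)).ncard ≤ (D : Set G).ncard :=
    Set.ncard_le_ncard Set.inter_subset_left
  rw [h0] at h hle
  rw [Nat.ModEq, Nat.mod_self] at h
  have heq := Nat.le_of_dvd hpos (Nat.dvd_of_mod_eq_zero h)
  have := Set.eq_of_subset_of_ncard_le (Set.inter_subset_left) (h0.trans_le heq)
  intro d hd
  have hd' := (Set.inter_eq_left.1 this) hd
  rw [mem_fixedBy, ConjAct.toConjAct_smul] at hd'
  rw [Commute, SemiconjBy]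
  exact mul_inv_eq_iff_eq_mul.1 hd'

end ChainLength

namespace ChainLength

open scoped Pointwise commutatorElement

section Fusion

attribute [local instance] conjAction

variable {G : Type*} [Group G] [Finite G] {q : ℕ} [hq : Fact q.Prime]

/-- If every `q'`-element of the normalizer of `D` centralizes `D`, the normalizer is the product
of the centralizer and any of its Sylow `q`-subgroups. -/
theorem sup_centralizer_eq_top {D : Subgroup G}
    (h : ∀ s k : ℕ, s.Prime → s ≠ q → ∀ x ∈ Subgroup.normalizer (D : Set G), orderOf x = s ^ k →
      x ∈ Subgroup.centralizer (D : Set G))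
    (S : Sylow q (Subgroup.normalizer (D : Set G))) :
    (S : Subgroup (Subgroup.normalizer (D : Set G))) ⊔
      (Subgroup.centralizer (D : Set G)).subgroupOf (Subgroup.normalizer (D : Set G)) = ⊤ := by
  set C := (Subgroup.centralizer (D : Set G)).subgroupOf (Subgroup.normalizer (D : Set G))
  rw [← Subgroup.index_eq_one, Nat.eq_one_iff_not_exists_prime_dvd]
  intro s hs hdvd
  rcases eq_or_ne s q with rfl | hsq
  · exact S.not_dvd_index (hdvd.trans (Subgroup.index_dvd_of_le le_sup_left))
  · have := Fact.mk hs
    obtain ⟨R⟩ := (inferInstance : Nonempty (Sylow s (Subgroup.normalizer (D : Set G))))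
    refine R.not_dvd_index ((hdvd.trans (Subgroup.index_dvd_of_le le_sup_right)).trans
      (Subgroup.index_dvd_of_le fun x hx => ?_))
    obtain ⟨k, hk⟩ := IsPGroup.iff_orderOf.1 R.2 ⟨x, hx⟩
    refine h s k hs hsq x x.2 ?_
    rw [Subgroup.orderOf_coe, ← hk, ← Subgroup.orderOf_coe (⟨x, hx⟩ : R)]

omit [Finite G] hq in
theorem exists_sylow_of_le {A N : Subgroup G} (hA : IsPGroup q A) (_h : A ≤ N) :
    ∃ S : Sylow q N, A.subgroupOf N ≤ S :=
  (hA.comap_of_injective N.subtype N.subtype_injective).exists_le_sylow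

omit [Finite G] hq in
theorem exists_smul_le_of_sylow {A B N : Subgroup G} (hA : A ≤ N) (hB : B ≤ N) {S : Sylow q N}
    {n : N} (hS : A.subgroupOf N ≤ S) (hT : B.subgroupOf N ≤ (n • S : Sylow q N)) :
    ∃ E : Subgroup G, IsPGroup q E ∧ (n : G) • A ≤ E ∧ B ≤ E := by
  refine ⟨((n • S : Sylow q N) : Subgroup N).map N.subtype, (n • S).2.map _, fun x hx => ?_,
    fun x hx => ⟨⟨x, hB hx⟩, hT hx, rfl⟩⟩
  rw [mem_conj_smul] at hx
  have hmem : (⟨_, hA hx⟩ : N) ∈ S := hS hx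
  refine ⟨n * ⟨_, hA hx⟩ * n⁻¹, ?_, by simp [mul_assoc]⟩
  rw [Sylow.coe_subgroup_smul]
  exact Subgroup.smul_mem_pointwise_smul _ (MulAut.conj n) _ hmem

/-- Two `q`-subgroups of the normalizer of `D` can be moved into a common `q`-subgroup by an element
centralizing `D`. -/
def FusesIn (q : ℕ) (D : Subgroup G) : Prop :=
  ∀ A B : Subgroup G, IsPGroup q A → IsPGroup q B → A ≤ Subgroup.normalizer (D : Set G) →
    B ≤ Subgroup.normalizer (D : Set G) →
    ∃ u ∈ Subgroup.centralizer (D : Set G), ∃ E : Subgroup G, IsPGroup q E ∧ u • A ≤ E ∧ B ≤ E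

theorem fusesIn_of_forall {D : Subgroup G}
    (h : ∀ s k : ℕ, s.Prime → s ≠ q → ∀ x ∈ Subgroup.normalizer (D : Set G), orderOf x = s ^ k →
      x ∈ Subgroup.centralizer (D : Set G)) : FusesIn q D := by
  intro A B hA hB hAN hBN
  obtain ⟨S, hS⟩ := exists_sylow_of_le hA hAN
  obtain ⟨T, hT⟩ := exists_sylow_of_le hB hBN
  obtain ⟨n, rfl⟩ := MulAction.exists_smul_eq (Subgroup.normalizer (D : Set G)) S T
  have hn : n ∈ (Subgroup.centralizer (D : Set G)).subgroupOf
      (Subgroup.normalizer (D : Set G)) ⊔ (S : Subgroup _) := by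
    rw [sup_comm, sup_centralizer_eq_top h S]; trivial
  rw [← SetLike.mem_coe, Subgroup.normal_mul] at hn
  obtain ⟨c, hc, s, hs, rfl⟩ := hn
  have hcs : (c * s) • S = c • S := by
    rw [mul_smul, Sylow.smul_eq_iff_mem_normalizer.2 (Subgroup.le_normalizer hs)]
  simp only [hcs] at hT
  exact ⟨c, hc, exists_smul_le_of_sylow hAN hBN hS hT⟩

theorem fusesIn_of_card_eq {D : Subgroup G} (h : Nat.card D = q) : FusesIn q D := by
  intro A B hA hB hAN hBN
  have key : ∀ A : Subgroup G, IsPGroup q A → A ≤ Subgroup.normalizer (D : Set G) →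
      A ≤ Subgroup.centralizer (D : Set G) := by
    intro A hA hAN a ha
    obtain ⟨k, hk⟩ := IsPGroup.iff_orderOf.1 hA ⟨a, ha⟩
    rw [Subgroup.orderOf_mk] at hk
    exact fun d hd => (commute_of_normalizes hk h (hAN ha) d hd).symm
  obtain ⟨S, hS⟩ := exists_sylow_of_le hA (key A hA hAN)
  obtain ⟨T, hT⟩ := exists_sylow_of_le hB (key B hB hBN)
  obtain ⟨n, rfl⟩ := MulAction.exists_smul_eq (Subgroup.centralizer (D : Set G)) S T
  exact ⟨n, n.2, exists_smul_le_of_sylow (key A hA hAN) (key B hB hBN) hS hT⟩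

theorem lt_inf_normalizer {D P : Subgroup G} (hP : IsPGroup q P) (h : D < P) :
    D < P ⊓ Subgroup.normalizer (D : Set G) := by
  have := hP.isNilpotent
  have hc := Group.normalizerCondition_of_isNilpotent (D.subgroupOf P)
    (lt_top_iff_ne_top.2 fun ht =>
      h.not_ge (Subgroup.subgroupOf_eq_top.1 ht))
  rw [← Subgroup.subgroupOf_normalizer_eq h.le] at hc
  obtain ⟨x, hx, hxD⟩ := SetLike.exists_of_lt hc
  exact (le_inf h.le Subgroup.le_normalizer).lt_of_not_ge fun hle => hxD (hle ⟨x.2, hx⟩)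

/-- **Alperin's fusion argument**: Sylow subgroups containing `D` are conjugate under the
centralizer of `D`. -/
theorem exists_smul_eq_of_fusesIn
    (h : ∀ D : Subgroup G, D ≠ ⊥ → IsPGroup q D → FusesIn q D)
    (D : Subgroup G) (hD : D ≠ ⊥) (P R : Sylow q G) (hP : D ≤ P) (hR : D ≤ R) :
    ∃ u ∈ Subgroup.centralizer (D : Set G), u • P = R := by
  induction D using WellFoundedGT.induction generalizing P R with
  | ind D ih =>
  rcases hP.eq_or_lt with rfl | hPlt
  · exact ⟨1, one_mem _, by rw [one_smul]; exact Sylow.ext (P.3 R.2 hR).symm⟩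
  rcases hR.eq_or_lt with rfl | hRlt
  · exact ⟨1, one_mem _, by rw [one_smul]; exact Sylow.ext (R.3 P.2 hP)⟩
  have hA := lt_inf_normalizer P.2 hPlt
  have hB := lt_inf_normalizer R.2 hRlt
  obtain ⟨u, hu, E, hE, huE, hBE⟩ := h D hD (P.2.to_le hP) _ _ (P.2.to_le inf_le_left)
    (R.2.to_le inf_le_left) inf_le_right inf_le_right
  obtain ⟨S, hES⟩ := hE.exists_le_sylow
  have huD : u • D = D := conj_smul_eq_iff.2 (Subgroup.centralizer_le_normalizer _ hu)
  have hA' : D < u • (P ⊓ Subgroup.normalizer (D : Set G) : Subgroup G) := by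
    refine lt_of_le_not_ge ?_ ?_
    · conv_lhs => rw [← huD]
      exact conj_smul_le_iff.2 hA.le
    · intro hle
      rw [← huD, conj_smul_le_iff, huD] at hle
      exact hA.not_ge hle
  obtain ⟨v, hv, hvS⟩ := ih _ hA' (ne_bot_of_gt hA') (u • P) S
    (conj_smul_le_iff.2 inf_le_left) (huE.trans hES)
  obtain ⟨w, hw, rfl⟩ := ih _ hB (ne_bot_of_gt hB) S R (hBE.trans hES) inf_le_left
  refine ⟨w * (v * u), mul_mem (Subgroup.centralizer_le hB.le hw)
    (mul_mem (Subgroup.centralizer_le hA'.le hv) hu), ?_⟩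
  rw [mul_smul, mul_smul, hvS]

theorem exists_mul_of_mem_normalizer {P : Sylow q G}
    (h : ∀ s k : ℕ, s.Prime → s ≠ q → ∀ x ∈ Subgroup.normalizer (P : Set G), orderOf x = s ^ k →
      x ∈ Subgroup.centralizer (P : Set G)) {n : G} (hn : n ∈ Subgroup.normalizer (P : Set G)) :
    ∃ a ∈ P, ∃ c ∈ Subgroup.centralizer (P : Set G), a * c = n := by
  have hsup := sup_centralizer_eq_top (D := (P : Subgroup G)) h
    (P.subtype (Subgroup.le_normalizer (H := (P : Subgroup G))))
  have hmem := hsup.ge (Subgroup.mem_top ⟨n, hn⟩)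
  rw [← SetLike.mem_coe, Subgroup.mul_normal] at hmem
  obtain ⟨a, ha, c, hc, hac⟩ := hmem
  exact ⟨a, ha, c, hc, congrArg Subtype.val hac⟩

theorem exists_not_mem_centralizer [IsSimpleGroup G] (hns : ¬ Group.IsSolvable G)
    (hdvd : q ∣ Nat.card G) :
    ∃ D : Subgroup G, IsPGroup q D ∧ D ≠ ⊥ ∧ (Nat.card D ≠ q ∨ ∃ P : Sylow q G, D = P) ∧
      ∃ s k : ℕ, s.Prime ∧ s ≠ q ∧ ∃ x ∈ Subgroup.normalizer (D : Set G), orderOf x = s ^ k ∧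
        x ∉ Subgroup.centralizer (D : Set G) := by
  by_contra! hcon
  have hf : ∀ D : Subgroup G, D ≠ ⊥ → IsPGroup q D → FusesIn q D := by
    intro D hD hDq
    by_cases hc : Nat.card D = q
    · exact fusesIn_of_card_eq hc
    · exact fusesIn_of_forall (hcon D hDq hD (.inl hc))
  obtain ⟨P⟩ := (inferInstance : Nonempty (Sylow q G))
  have hPb := sylow_ne_bot P hdvd
  have hN := hcon P P.2 hPb (.inr ⟨P, rfl⟩)
  have hfocal : Subgroup.focalSubgroup (P : Subgroup G) ≤ ⁅(P : Subgroup G), (P : Subgroup G)⁆ := by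
    rw [Subgroup.focalSubgroup_def, Subgroup.closure_le]
    rintro _ ⟨hg, x, hx, u, rfl⟩
    rcases eq_or_ne x 1 with rfl | hx1
    · simp
    change x * u * x⁻¹ * u⁻¹ ∈ P at hg
    replace hx : x ∈ P := hx
    have hy : u * x⁻¹ * u⁻¹ ∈ P := by
      simpa [mul_assoc] using mul_mem (inv_mem hx) hg
    obtain ⟨v, hv, hvP⟩ := exists_smul_eq_of_fusesIn hf (Subgroup.zpowers (u * x⁻¹ * u⁻¹))
      (by simpa using hx1) (u • P) P
      (Subgroup.zpowers_le.2 (mem_conj_smul.2 (by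
        have := inv_mem hx
        rwa [show x⁻¹ = u⁻¹ * (u * x⁻¹ * u⁻¹) * u by group] at this)))
      (Subgroup.zpowers_le.2 hy)
    rw [smul_smul, Sylow.smul_eq_iff_mem_normalizer] at hvP
    obtain ⟨a, ha, c, hc, hac⟩ := exists_mul_of_mem_normalizer hN hvP
    have hcx : c * x⁻¹ * c⁻¹ = x⁻¹ := by rw [← hc _ (inv_mem hx)]; simp
    have hvy : v * (u * x⁻¹ * u⁻¹) * v⁻¹ = u * x⁻¹ * u⁻¹ := by
      rw [← hv _ (Subgroup.mem_zpowers _)]; simp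
    have hu : u * x⁻¹ * u⁻¹ = a * x⁻¹ * a⁻¹ := by
      rw [← hvy, ← hcx]
      have : v * (u * x⁻¹ * u⁻¹) * v⁻¹ = (v * u) * x⁻¹ * (v * u)⁻¹ := by group
      rw [hcx, this, ← hac]
      conv_rhs => rw [← hcx]
      group
    have : x * u * x⁻¹ * u⁻¹ = x * a * x⁻¹ * a⁻¹ := by
      simp only [mul_assoc] at hu ⊢
      rw [hu]
    change x * u * x⁻¹ * u⁻¹ ∈ _
    rw [this]
    exact Subgroup.commutator_mem_commutator hx ha
  rw [← Subgroup.commutator_inf_eq_focalSubgroup, ← Subgroup.map_subtype_commutator] at hfocal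
  have hperfect : commutator G = ⊤ :=
    (inferInstance : (commutator G).Normal).eq_bot_or_eq_top.resolve_left fun h =>
      not_comm hns fun a b => by
        have : ⁅a, b⁆ ∈ commutator G :=
          Subgroup.commutator_mem_commutator (Subgroup.mem_top a) (Subgroup.mem_top b)
        rwa [h, Subgroup.mem_bot, commutatorElement_eq_one_iff_mul_comm] at this
  have := P.2.isNilpotent
  have : Nontrivial P := (Subgroup.nontrivial_iff_ne_bot _).2 hPb
  refine (Group.IsSolvable.commutator_lt_top_of_nontrivial P).not_ge fun a _ => ?_
  obtain ⟨b, hb, hba⟩ := hfocal ⟨hperfect ▸ Subgroup.mem_top (a : G), a.2⟩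
  rwa [← Subtype.ext hba]

end Fusion
end ChainLength

namespace ChainLength

open scoped Pointwise
open MulAction

section Coprime

variable {G : Type*} [Group G] [Finite G] {q s k : ℕ} [hq : Fact q.Prime] [hs : Fact s.Prime]
  {T : Subgroup G} {x : G}

theorem card_sup_zpowers (hT : IsPGroup q T) (hsq : s ≠ q) (hx : orderOf x = s ^ k)
    (hn : x ∈ Subgroup.normalizer (T : Set G)) :
    Nat.card (T ⊔ Subgroup.zpowers x : Subgroup G) = Nat.card T * s ^ k := by
  obtain ⟨m, hm⟩ := IsPGroup.iff_card.1 hT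
  have hX : Nat.card (Subgroup.zpowers x) = s ^ k := by rw [Nat.card_zpowers, hx]
  refine le_antisymm ?_ (Nat.le_of_dvd Nat.card_pos ?_)
  · have hle : Subgroup.zpowers x ≤ Subgroup.normalizer (T : Set G) := by simpa using hn
    have h := Set.natCard_mul_le (s := (T : Set G)) (t := (Subgroup.zpowers x : Set G))
    rw [← Subgroup.coe_mul_of_right_le_normalizer_left _ _ hle] at h
    rw [← hX]
    exact h
  · refine Nat.Coprime.mul_dvd_of_dvd_of_dvd ?_ (Subgroup.card_dvd_of_le le_sup_left)
      (hX ▸ Subgroup.card_dvd_of_le le_sup_right)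
    rw [hm]
    exact Nat.coprime_pow_primes _ _ hq.out hs.out hsq.symm

theorem eq_zpowers_of_isPGroup (hT : IsPGroup q T) (hsq : s ≠ q) (hx : orderOf x = s ^ k)
    (hn : x ∈ Subgroup.normalizer (T : Set G)) {A : Subgroup G} (hA : IsPGroup s A)
    (hxA : x ∈ A) (h : A ≤ T ⊔ Subgroup.zpowers x) : A = Subgroup.zpowers x := by
  obtain ⟨m, hm⟩ := IsPGroup.iff_card.1 hT
  obtain ⟨n, hn'⟩ := IsPGroup.iff_card.1 hA
  refine (Subgroup.eq_of_le_of_card_ge (by simpa using hxA) ?_).symm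
  have hd := Subgroup.card_dvd_of_le h
  rw [card_sup_zpowers hT hsq hx hn, hm, hn'] at hd
  rw [Nat.card_zpowers, hx, hn']
  exact Nat.le_of_dvd (pow_pos hs.out.pos _) (Nat.Coprime.dvd_of_dvd_mul_left
    (Nat.coprime_pow_primes _ _ hs.out hq.out hsq) hd)

omit [Finite G] in
theorem mem_centralizer_of_le_normalizer (hT : IsPGroup q T) (hsq : s ≠ q) (hx : orderOf x = s ^ k)
    (hn : x ∈ Subgroup.normalizer (T : Set G))
    (h : T ≤ Subgroup.normalizer (Subgroup.zpowers x : Set G)) :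
    x ∈ Subgroup.centralizer (T : Set G) := by
  intro t ht
  have hX : IsPGroup s (Subgroup.zpowers x) := .of_card (n := k) (by rw [Nat.card_zpowers, hx])
  have hd := hT.disjoint_of_ne q s hsq.symm _ _ hX
  have h1 : t * x * t⁻¹ * x⁻¹ ∈ T := by
    have := mul_mem ht ((Subgroup.mem_normalizer_iff.1 hn _).1 (inv_mem ht))
    simpa [mul_assoc] using this
  have h2 : t * x * t⁻¹ * x⁻¹ ∈ Subgroup.zpowers x :=
    mul_mem ((Subgroup.mem_normalizer_iff.1 (h ht) _).1 (Subgroup.mem_zpowers x))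
      (inv_mem (Subgroup.mem_zpowers x))
  have := Subgroup.disjoint_def.1 hd h1 h2
  rw [mul_inv_eq_one, mul_inv_eq_iff_eq_mul] at this
  exact this

end Coprime

section MinimalGood

attribute [local instance] conjAction

variable {G : Type*} [Group G] [Finite G] {q : ℕ} {T : Subgroup G}

/-- `T` is a nontrivial good `q`-subgroup which minimizes `rho` among all nontrivial good subgroups
of prime power order, and `q` is the least prime for which this is possible. -/
structure IsMinimalGood (q : ℕ) (T : Subgroup G) : Prop where
  isPGroup : IsPGroup q T
  ne_bot : T ≠ ⊥
  good : Good T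
  rho_le : ∀ {s : ℕ} {A : Subgroup G}, s.Prime → IsPGroup s A → A ≠ ⊥ → Good A → rho T ≤ rho A
  le_of_rho_eq : ∀ {s : ℕ} {A : Subgroup G}, s.Prime → IsPGroup s A → A ≠ ⊥ → Good A →
    rho A = rho T → q ≤ s

theorem IsMinimalGood.of_good [hq : Fact q.Prime] (hT : IsMinimalGood q T) {A : Subgroup G}
    (hA : IsPGroup q A) (hb : A ≠ ⊥) (hg : Good A) : IsMinimalGood q A := by
  have h := hg.rho_eq_of_isPGroup_of_isPGroup hT.good hA hT.isPGroup
  exact ⟨hA, hb, hg, h ▸ hT.rho_le, h ▸ hT.le_of_rho_eq⟩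

theorem exists_isMinimalGood (h : ∃ s : ℕ, s.Prime ∧ ∃ A : Subgroup G, IsPGroup s A ∧ A ≠ ⊥ ∧
    Good A) : ∃ q : ℕ, q.Prime ∧ ∃ T : Subgroup G, IsMinimalGood q T := by
  classical
  let S : Set (Subgroup G) := {A | A ≠ ⊥ ∧ Good A ∧ ∃ s : ℕ, s.Prime ∧ IsPGroup s A}
  obtain ⟨A, ⟨hAb, hAg, s, hs, hAs⟩, hA⟩ := S.exists_min_image rho S.toFinite (by
    obtain ⟨s, hs, A, hA, hb, hg⟩ := h
    exact ⟨A, hb, hg, s, hs, hA⟩)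
  have hex : ∃ q : ℕ, q.Prime ∧ ∃ T : Subgroup G, IsPGroup q T ∧ T ≠ ⊥ ∧ Good T ∧ rho T = rho A :=
    ⟨s, hs, A, hAs, hAb, hAg, rfl⟩
  obtain ⟨hq, T, hTq, hTb, hTg, hTA⟩ := Nat.find_spec hex
  refine ⟨_, hq, T, hTq, hTb, hTg, fun hs hB hb hg => ?_, fun hs hB hb hg h => ?_⟩
  · rw [hTA]
    exact hA _ ⟨hb, hg, _, hs, hB⟩
  · exact Nat.find_min' hex ⟨hs, _, hB, hb, hg, h.trans hTA⟩

variable [IsSimpleGroup G] (hns : ¬ Group.IsSolvable G)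
  (hmin : ∀ M : Subgroup G, M ≠ ⊤ → Group.IsSolvable M)
include hns hmin

theorem IsMinimalGood.rho_normalizer [hq : Fact q.Prime] (hT : IsMinimalGood q T) :
    rho (Subgroup.normalizer (T : Set G)) = rho T :=
  (hT.good.rho_eq_of_le_normalizer Subgroup.le_normalizer le_rfl
    (hmin _ (normalizer_ne_top_of_isPGroup hns hT.isPGroup hT.ne_bot))).symm

theorem IsMinimalGood.le_of_le_normalizer [hq : Fact q.Prime] (hT : IsMinimalGood q T) {s : ℕ}
    (hs : s.Prime) {A : Subgroup G} (hA : IsPGroup s A) (hb : A ≠ ⊥) (hg : Good A)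
    (hle : A ≤ Subgroup.normalizer (T : Set G)) : q ≤ s := by
  refine hT.le_of_rho_eq hs hA hb hg (le_antisymm ?_ (hT.rho_le hs hA hb hg))
  rw [← hT.rho_normalizer hns hmin]
  exact hg.rho_mono hle

theorem IsMinimalGood.prime_relIndex [hq : Fact q.Prime] (hT : IsMinimalGood q T) {s : ℕ}
    (hs : s.Prime) {H A B : Subgroup G} (hH : IsPGroup s H) (hb : H ≠ ⊥) (hg : Good H)
    (hHA : H ≤ A) (hAB : A ⋖ B) (hB : B ≤ Subgroup.normalizer (T : Set G)) :
    (A.relIndex B).Prime :=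
  hg.prime_relIndex ((hT.rho_normalizer hns hmin).trans_le (hT.rho_le hs hH hb hg)) hHA hAB hB

/-- A good subgroup of prime power order normalizing an automorphism `x` of `T` of order a power
of a larger prime can only exist when `x` centralizes `T`. -/
theorem IsMinimalGood.mem_centralizer [hq : Fact q.Prime] (hT : IsMinimalGood q T) {s k p : ℕ}
    [hs : Fact s.Prime] (hqs : q < s) {x : G} (hx : orderOf x = s ^ k)
    (hn : x ∈ Subgroup.normalizer (T : Set G)) (hp : p.Prime) {H : Subgroup G} (hH : IsPGroup p H)
    (hb : H ≠ ⊥) (hg : Good H) (hHT : H ≤ T ⊔ Subgroup.zpowers x)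
    (hHx : H ≤ Subgroup.normalizer (Subgroup.zpowers x : Set G)) :
    x ∈ Subgroup.centralizer (T : Set G) := by
  by_contra hcon
  set X := Subgroup.zpowers x
  set Y := T ⊔ X
  have hxX : x ∈ X := Subgroup.mem_zpowers x
  have hYN : Y ≤ Subgroup.normalizer (T : Set G) :=
    sup_le Subgroup.le_normalizer (by simpa [X] using hn)
  set A := Subgroup.normalizer (X : Set G) ⊓ Y
  have hXA : X ≤ A := le_inf Subgroup.le_normalizer le_sup_right
  have hAY : A < Y := inf_le_right.lt_of_not_ge fun h => hcon
    (mem_centralizer_of_le_normalizer hT.isPGroup hqs.ne' hx hn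
      (le_sup_left.trans (h.trans inf_le_left)))
  obtain ⟨B, hAB, hBY⟩ := exists_covBy_le_of_lt hAY
  have hprime := hT.prime_relIndex hns hmin hp hH hb hg (le_inf hHx hHT) hAB (hBY.trans hYN)
  have hindex : A.relIndex B = q := by
    have hd : A.relIndex B ∣ Nat.card T := by
      have h1 := card_mul_relIndex (le_sup_right : X ≤ Y)
      rw [card_sup_zpowers hT.isPGroup hqs.ne' hx hn, Nat.card_zpowers, hx, mul_comm] at h1
      rw [← Nat.eq_of_mul_eq_mul_right (pow_pos hs.out.pos k) h1]
      exact (Dvd.intro _ (Subgroup.relIndex_mul_relIndex A B Y hAB.le hBY)).trans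
        (Subgroup.relIndex_dvd_of_le_left Y hXA)
    obtain ⟨m, hm⟩ := IsPGroup.iff_card.1 hT.isPGroup
    rw [hm] at hd
    exact (Nat.prime_dvd_prime_iff_eq hprime hq.out).1 (hprime.dvd_of_dvd_pow hd)
  have hxB : x ∈ B := hAB.le (hXA hxX)
  have hfix := ncard_fixedBy_modEq (X := B ⧸ A.subgroupOf B) (x := (⟨x, hxB⟩ : B)) (p := s)
    (k := k) (by rw [Subgroup.orderOf_mk, hx])
  have hcard : Nat.card (B ⧸ A.subgroupOf B) = q := hindex
  rw [hcard, Nat.ModEq, Nat.mod_eq_of_lt hqs, Nat.mod_eq_of_lt] at hfix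
  swap
  · exact ((Set.ncard_le_card _).trans_eq hcard).trans_lt hqs
  have huniv : fixedBy (B ⧸ A.subgroupOf B) (⟨x, hxB⟩ : B) = Set.univ :=
    Set.eq_of_subset_of_ncard_le (Set.subset_univ _)
      (by rw [Set.ncard_univ, hcard, hfix])
  refine hAB.lt.not_ge fun b hb => ⟨?_, hBY hb⟩
  have hfb : (⟨x, hxB⟩ : B) • ((⟨b, hb⟩ : B) : B ⧸ A.subgroupOf B) = (⟨b, hb⟩ : B) :=
    huniv.ge (Set.mem_univ _)
  rw [MulAction.Quotient.smul_coe, eq_comm, QuotientGroup.eq, Subgroup.mem_subgroupOf] at hfb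
  have hbx : b⁻¹ * x * b ∈ A := by simpa [mul_assoc] using hfb
  have hXs : IsPGroup s X := .of_card (n := k) (by rw [Nat.card_zpowers, hx])
  have hcX : Nat.card (b⁻¹ • X : Subgroup G) = Nat.card X := card_conj_smul b⁻¹ X
  have hX' : b⁻¹ • X ≤ A := by
    rw [conj_smul_zpowers, Subgroup.zpowers_le, inv_inv]
    exact hbx
  have heq := eq_zpowers_of_isPGroup hT.isPGroup hqs.ne' hx hn
    ((hXs.of_equiv (Subgroup.equivSMul _ X)).to_sup_of_normal_right' hXs (hX'.trans inf_le_left))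
    (Subgroup.mem_sup_right hxX) (sup_le (hX'.trans inf_le_right) le_sup_right)
  exact (Subgroup.inv_mem_iff _).1 (conj_smul_eq_iff.1
    (Subgroup.eq_of_le_of_card_ge (le_sup_left.trans heq.le) hcX.ge))

/-- If some nontrivial subgroup of prime power order is good but no bad one has composite order,
then some bad subgroup of prime order acts nontrivially on a minimal good subgroup. -/
theorem exists_isMinimalGood_of_bad
    (hbad : ∀ {s : ℕ} {A : Subgroup G}, s.Prime → IsPGroup s A → A ≠ ⊥ → ¬ Good A → Nat.card A = s)
    (hgood : ∃ s : ℕ, s.Prime ∧ ∃ A : Subgroup G, IsPGroup s A ∧ A ≠ ⊥ ∧ Good A) :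
    ∃ q : ℕ, q.Prime ∧ ∃ T : Subgroup G, IsMinimalGood q T ∧ ∃ r : ℕ, r.Prime ∧ r ≠ q ∧
      ∃ x ∈ Subgroup.normalizer (T : Set G), orderOf x = r ∧
        x ∉ Subgroup.centralizer (T : Set G) ∧ ¬ Good (Subgroup.zpowers x) := by
  obtain ⟨q, hqp, T, hT⟩ := exists_isMinimalGood hgood
  have hq := Fact.mk hqp
  have hdvd : q ∣ Nat.card G := by
    obtain ⟨n, hn⟩ := IsPGroup.iff_card.1 hT.isPGroup
    refine (dvd_pow_self q (n := n) ?_).trans (hn ▸ T.card_subgroup_dvd_card)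
    rintro rfl
    exact hT.ne_bot (Subgroup.card_eq_one.1 hn)
  obtain ⟨D, hDq, hDb, hD, s, k, hs, hsq, x, hxD, hx, hxc⟩ := exists_not_mem_centralizer hns hdvd
  have hsf := Fact.mk hs
  have hDg : Good D := by
    by_contra hDg
    have hcard := hbad hqp hDq hDb hDg
    obtain ⟨P, rfl⟩ := hD.resolve_left (not_not.2 hcard)
    obtain ⟨R, hR⟩ := hT.isPGroup.exists_le_sylow
    obtain ⟨g, rfl⟩ := MulAction.exists_smul_eq G R P
    exact hDg (good_conj_smul.2 (hT.good.mono hR))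
  have hDm := hT.of_good hDq hDb hDg
  have hXs : IsPGroup s (Subgroup.zpowers x) := .of_card (n := k) (by rw [Nat.card_zpowers, hx])
  have hXb : Subgroup.zpowers x ≠ ⊥ := by
    rw [Ne, Subgroup.zpowers_eq_bot]
    rintro rfl
    exact hxc (one_mem _)
  have hXg : ¬ Good (Subgroup.zpowers x) := fun hg => by
    have hle := hDm.le_of_le_normalizer hns hmin hs hXs hXb hg (by simpa using hxD)
    exact hxc (hDm.mem_centralizer hns hmin (hle.lt_of_ne hsq.symm) hx hxD hs hXs hXb hg
      le_sup_right Subgroup.le_normalizer)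
  refine ⟨q, hqp, D, hDm, s, hs, hsq, x, hxD, ?_, hxc, hXg⟩
  rw [← Nat.card_zpowers]
  exact hbad hs hXs hXb hXg

/-- In a nonabelian simple group all of whose proper subgroups are solvable, `⊥` is bad. -/
theorem not_good_bot_of_isSimpleGroup : ¬ Good (⊥ : Subgroup G) := by
  intro h
  have hall : ∀ A : Subgroup G, Good A := fun A => h.mono bot_le
  obtain ⟨q, -, T, -, r, -, -, x, -, -, -, hx⟩ := exists_isMinimalGood_of_bad hns hmin
    (fun _ _ _ h => absurd (hall _) h) (by
      have := IsSimpleGroup.toNontrivial (G := G)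
      obtain ⟨p, hp, hdvd⟩ := Nat.exists_prime_and_dvd (Finite.one_lt_card (α := G)).ne'
      have := Fact.mk hp
      obtain ⟨P⟩ := (inferInstance : Nonempty (Sylow p G))
      exact ⟨p, hp, P, P.2, sylow_ne_bot P hdvd, hall _⟩)
  exact hx (hall _)

end MinimalGood

/-- In a nonsolvable finite group, `⊥` is bad. -/
theorem not_good_bot {G : Type*} [Group G] [Finite G] (hns : ¬ Group.IsSolvable G) :
    ¬ Good (⊥ : Subgroup G) := by
  induction h : Nat.card G using Nat.strong_induction_on generalizing G with
  | _ n ih =>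
  subst h
  intro hg
  have hmin : ∀ M : Subgroup G, M ≠ ⊤ → Group.IsSolvable M := by
    intro M hM
    by_contra hMs
    refine ih _ (lt_of_le_of_ne (Nat.card_le_card_of_injective _ M.subtype_injective) fun hc =>
      hM (Subgroup.eq_top_of_card_eq M hc)) hMs rfl ?_
    refine Good.of_map_injective M.subtype_injective ?_
    rwa [Subgroup.map_bot]
  have : Nontrivial G := by
    by_contra hnt
    rw [not_nontrivial_iff_subsingleton] at hnt
    exact hns inferInstance
  by_cases hsimple : IsSimpleGroup G
  · exact not_good_bot_of_isSimpleGroup hns hmin hg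
  have : ∃ N : Subgroup G, N.Normal ∧ N ≠ ⊥ ∧ N ≠ ⊤ := by
    by_contra! hcon
    exact hsimple ⟨fun N hN => or_iff_not_imp_left.2 (hcon N hN)⟩
  obtain ⟨N, hN, hNb, hNt⟩ := this
  have hQ : ¬ Group.IsSolvable (G ⧸ N) := fun hQ => hns (by
    have := hmin N hNt
    exact Group.isSolvable_of_ker_le_range N.subtype (QuotientGroup.mk' N) (by simp))
  refine ih _ ?_ hQ rfl ?_
  · rw [N.card_eq_card_quotient_mul_card_subgroup]
    exact lt_mul_of_one_lt_right Nat.card_pos ((Subgroup.one_lt_card_iff_ne_bot N).2 hNb)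
  · exact Good.of_comap_surjective (QuotientGroup.mk'_surjective N) (hg.mono bot_le)
end ChainLength

namespace ChainLength

open scoped Pointwise
open MulAction

section OrderSixty

attribute [local instance] conjAction

variable {G : Type*} [Group G] [Finite G]

theorem isCoatom_of_forall_card {H : Subgroup G} (h : H ≠ ⊤)
    (hK : ∀ K : Subgroup G, K ≠ ⊤ → H ≤ K → Nat.card K ≤ Nat.card H) : IsCoatom H := by
  refine ⟨h, fun K hHK => ?_⟩
  by_contra hKt
  exact hHK.ne (Subgroup.eq_of_le_of_card_ge hHK.le (hK K hKt hHK.le))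

omit [Finite G] in
theorem covChain_one_of_isCoatom {H : Subgroup G} (h : IsCoatom H) {n : ℕ}
    (hn : CovChain n H ⊤) : n = 1 := by
  cases hn with
  | refl => exact absurd rfl h.1
  | cons hc t =>
    have := h.2 _ hc.lt
    subst this
    cases t with
    | refl => rfl
    | cons hc' t => exact absurd hc'.lt not_top_lt

omit [Finite G] in
theorem good_of_isCoatom {H : Subgroup G} (h : IsCoatom H) : Good H := fun _ _ hr hs =>
  (covChain_one_of_isCoatom h hr).trans (covChain_one_of_isCoatom h hs).symm

omit [Finite G] in
theorem good_of_forall_isCoatom {H : Subgroup G} (h : ∀ K, H < K → K ≠ ⊤ → IsCoatom K)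
    {N : Subgroup G} (hN : H < N) (hNt : N ≠ ⊤) : Good H := by
  have key : ∀ {n : ℕ}, CovChain n H ⊤ → n = 2 := by
    intro n hn
    cases hn with
    | refl => exact absurd hN not_top_lt
    | @cons _ _ K _ hc t =>
      rcases eq_or_ne K ⊤ with rfl | hK
      · exact absurd hNt.lt_top (hc.2 hN)
      · rw [covChain_one_of_isCoatom (h K hc.lt hK) t]
  exact fun _ _ hr hs => (key hr).trans (key hs).symm

variable [IsSimpleGroup G] (hns : ¬ Group.IsSolvable G) (h60 : Nat.card G = 60)
include hns h60

theorem card_le_twelve {H : Subgroup G} (h : H ≠ ⊤) : Nat.card H ≤ 12 := by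
  have h1 := five_le_index hns h
  have h2 := H.card_mul_index
  rw [h60] at h2
  by_contra! h3
  nlinarith

theorem card_normalizer_three (P : Sylow 3 G) :
    Nat.card P = 3 ∧ Nat.card (Subgroup.normalizer (P : Set G)) = 6 := by
  have hP : Nat.card P = 3 := by
    rw [P.card_eq_multiplicity, h60, (by decide +kernel : (60 : ℕ).factorization 3 = 1), pow_one]
  obtain ⟨n, m, -, rfl, hnm, hn, h5, -, hd⟩ := sylow_numbers hns P (by rw [h60]; norm_num)
  have hi := (P : Subgroup G).card_mul_index
  rw [hP, h60] at hi
  refine ⟨hP, ?_⟩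
  rw [(by omega : (P : Subgroup G).index = 20)] at hd
  have key : ∀ n ∈ Nat.divisors 20, n % 3 = 1 → 5 ≤ n → n = 10 := by decide +kernel
  have := key n (Nat.mem_divisors.2 ⟨hd, by norm_num⟩) hn h5
  subst this
  omega

theorem card_normalizer_five (P : Sylow 5 G) :
    Nat.card P = 5 ∧ Nat.card (Subgroup.normalizer (P : Set G)) = 10 := by
  have : Fact (Nat.Prime 5) := ⟨by norm_num⟩
  have hP : Nat.card P = 5 := by
    rw [P.card_eq_multiplicity, h60, (by decide +kernel : (60 : ℕ).factorization 5 = 1), pow_one]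
  obtain ⟨n, m, -, rfl, hnm, hn, h5, -, hd⟩ := sylow_numbers hns P (by rw [h60]; norm_num)
  have hi := (P : Subgroup G).card_mul_index
  rw [hP, h60] at hi
  refine ⟨hP, ?_⟩
  rw [(by omega : (P : Subgroup G).index = 12)] at hd
  have key : ∀ n ∈ Nat.divisors 12, n % 5 = 1 → 5 ≤ n → n = 6 := by decide +kernel
  have := key n (Nat.mem_divisors.2 ⟨hd, by norm_num⟩) hn h5
  subst this
  omega

theorem card_normalizer_two (P : Sylow 2 G) :
    Nat.card P = 4 ∧ Nat.card (Subgroup.normalizer (P : Set G)) = 12 := by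
  have hP : Nat.card P = 2 ^ 2 := by
    rw [P.card_eq_multiplicity, h60, (by decide +kernel : (60 : ℕ).factorization 2 = 2)]
  have h2 : 2 ∣ Nat.card G := by rw [h60]; norm_num
  have := IsPGroup.isMulCommutative_of_card_eq_prime_sq hP
  have hc := card_normalizer_ne_card hns P h2
  obtain ⟨n, m, -, rfl, hnm, hn, h5, -, hd⟩ := sylow_numbers hns P h2
  have hi := (P : Subgroup G).card_mul_index
  rw [hP, h60] at hi
  refine ⟨hP, ?_⟩
  rw [(by omega : (P : Subgroup G).index = 15)] at hd
  have key : ∀ n ∈ Nat.divisors 15, n % 2 = 1 → 5 ≤ n → n = 5 ∨ n = 15 := by decide +kernel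
  rw [hP] at hc
  rcases key n (Nat.mem_divisors.2 ⟨hd, by norm_num⟩) hn h5 with rfl | rfl <;> omega

/-- A subgroup of order six is the normalizer of a Sylow subgroup, and is not contained in a
subgroup of order twelve. -/
theorem not_le_of_card_six {H K : Subgroup G} (hH : Nat.card H = 6) (hK : Nat.card K = 12) :
    ¬ H ≤ K := by
  intro hle
  obtain ⟨C, hC⟩ := Sylow.exists_subgroup_card_pow_prime (G := H) 3 (n := 1) (by rw [hH]; norm_num)
  let P := C.map H.subtype
  have hPc : Nat.card P = 3 := by
    rw [Subgroup.card_map_of_injective H.subtype_injective, hC, pow_one]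
  have hPH : P ≤ H := Subgroup.map_subtype_le C
  have hnorm : ∀ {A B : Subgroup G}, A ≤ B → Nat.card B = 2 * Nat.card A →
      B ≤ Subgroup.normalizer (A : Set G) := by
    intro A B hAB hc
    have h1 := card_mul_relIndex hAB
    have h2 : A.relIndex B = 2 := by
      rw [hc, mul_comm] at h1
      exact Nat.eq_of_mul_eq_mul_right Nat.card_pos h1
    have := Subgroup.normal_of_index_eq_two (H := A.subgroupOf B) h2
    exact (Subgroup.normal_subgroupOf_iff_le_normalizer hAB).1 this
  have hHP := hnorm hPH (by omega)
  have hKH := hnorm hle (by omega)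
  have hP3 : IsPGroup 3 P := .of_card (n := 1) hPc
  have hKP : K ≤ Subgroup.normalizer (P : Set G) := by
    intro k hk
    have hkH : k • H = H := conj_smul_eq_iff.2 (hKH hk)
    have hkP : k • P ≤ H := (conj_smul_le_iff.2 hPH).trans hkH.le
    have h3 : IsPGroup 3 (k • P ⊔ P : Subgroup G) :=
      (hP3.of_equiv (Subgroup.equivSMul _ P)).to_sup_of_normal_right' hP3 (hkP.trans hHP)
    obtain ⟨n, hn⟩ := IsPGroup.iff_card.1 h3
    have hd := Subgroup.card_dvd_of_le (sup_le hkP hPH)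
    rw [hn, hH] at hd
    have hn1 : n ≤ 1 := by
      by_contra! hlt
      have := (pow_dvd_pow 3 hlt).trans hd
      norm_num at this
    have hle3 : Nat.card (k • P ⊔ P : Subgroup G) ≤ Nat.card P := by
      rw [hn, hPc]; exact (Nat.pow_le_pow_right (by norm_num) hn1)
    have heq := Subgroup.eq_of_le_of_card_ge (le_sup_right : P ≤ k • P ⊔ P) hle3
    refine conj_smul_eq_iff.1 (Subgroup.eq_of_le_of_card_ge (le_sup_left.trans heq.ge) ?_)
    rw [card_conj_smul]
  have hS : Nat.card P = 3 ^ (Nat.card G).factorization 3 := by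
    rw [hPc, h60, (by decide +kernel : (60 : ℕ).factorization 3 = 1), pow_one]
  have h6 := (card_normalizer_three hns h60 (Sylow.ofCard P hS)).2
  have := Nat.le_of_dvd (h6 ▸ Nat.card_pos) (Subgroup.card_dvd_of_le hKP)
  rw [hK] at this
  change Nat.card (Subgroup.normalizer (P : Set G)) = 6 at h6
  omega

theorem isCoatom_of_six_le_card {H : Subgroup G} (h : H ≠ ⊤) (h6 : 6 ≤ Nat.card H) :
    IsCoatom H := by
  refine isCoatom_of_forall_card h fun K hK hHK => ?_
  have hK12 := card_le_twelve hns h60 hK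
  have hd := Subgroup.card_dvd_of_le hHK
  have hd' := K.card_subgroup_dvd_card
  rw [h60] at hd'
  have key : ∀ k ∈ Nat.divisors 60, k ≤ 12 → ∀ h ∈ Nat.divisors k, 6 ≤ h →
      k ≤ h ∨ h = 6 ∧ k = 12 := by decide +kernel
  refine (key _ (Nat.mem_divisors.2 ⟨hd', by norm_num⟩) hK12 _
    (Nat.mem_divisors.2 ⟨hd, Nat.card_pos.ne'⟩) h6).resolve_right fun ⟨h1, h2⟩ =>
      not_le_of_card_six hns h60 h1 h2 hHK

theorem good_of_sylow {p : ℕ} [Fact p.Prime] (P : Sylow p G) (h3 : 3 ≤ Nat.card P)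
    (hN : 6 ≤ Nat.card (Subgroup.normalizer (P : Set G)))
    (hP : Nat.card P < 6) : Good (P : Subgroup G) := by
  have hdvd : p ∣ Nat.card G := by
    by_contra h
    have := P.card_eq_multiplicity
    rw [Nat.factorization_eq_zero_of_not_dvd h, pow_zero] at this
    omega
  refine good_of_forall_isCoatom (N := Subgroup.normalizer (P : Set G)) (fun K hK hKt => ?_) ?_ ?_
  · refine isCoatom_of_six_le_card hns h60 hKt ?_
    obtain ⟨m, hm⟩ := Subgroup.card_dvd_of_le hK.le
    have hne : m ≠ 1 := by
      rintro rfl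
      exact hK.ne (Subgroup.eq_of_le_of_card_ge hK.le (by rw [hm, mul_one]))
    have : m ≠ 0 := by
      rintro rfl
      exact Nat.card_pos.ne' (hm.trans (mul_zero _))
    rw [hm]
    exact Nat.mul_le_mul h3 (by omega : 2 ≤ m)
  · refine Subgroup.le_normalizer.lt_of_ne fun h => ?_
    change 6 ≤ Nat.card (Subgroup.normalizer ((P : Subgroup G) : Set G)) at hN
    rw [← h] at hN
    exact hP.not_ge hN
  · exact normalizer_ne_top_of_isPGroup hns P.2 (sylow_ne_bot P hdvd)

theorem card_le_two_of_not_good {H : Subgroup G} (hH : ¬ Good H) : Nat.card H ≤ 2 := by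
  by_contra! hlt
  have ht : H ≠ ⊤ := by
    rintro rfl
    refine hH fun r s hr hs => ?_
    cases hr with
    | refl => cases hs with
      | refl => rfl
      | cons hc _ => exact absurd hc.lt not_top_lt
    | cons hc _ => exact absurd hc.lt not_top_lt
  have h6 : Nat.card H < 6 := by
    by_contra! h6
    exact hH (good_of_isCoatom (isCoatom_of_six_le_card hns h60 ht h6))
  have h5 : Fact (Nat.Prime 5) := ⟨by norm_num⟩
  have key : ∀ k ∈ Nat.divisors 60, 2 < k → k < 6 → k = 3 ∨ k = 4 ∨ k = 5 := by decide +kernel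
  rcases key _ (Nat.mem_divisors.2 ⟨h60 ▸ H.card_subgroup_dvd_card, by norm_num⟩) hlt h6
    with h | h | h
  · let P : Sylow 3 G := Sylow.ofCard H (by
      rw [h, h60, (by decide +kernel : (60 : ℕ).factorization 3 = 1), pow_one])
    exact hH (good_of_sylow hns h60 P hlt (card_normalizer_three hns h60 P).2.ge h6)
  · let P : Sylow 2 G := Sylow.ofCard H (by
      rw [h, h60, (by decide +kernel : (60 : ℕ).factorization 2 = 2)]; norm_num)
    exact hH (good_of_sylow hns h60 P hlt (by rw [(card_normalizer_two hns h60 P).2]; norm_num) h6)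
  · let P : Sylow 5 G := Sylow.ofCard H (by
      rw [h, h60, (by decide +kernel : (60 : ℕ).factorization 5 = 1), pow_one])
    exact hH (good_of_sylow hns h60 P hlt (by rw [(card_normalizer_five hns h60 P).2]; norm_num) h6)

theorem not_good_of_orderOf_eq_two {t c : G} (ht : orderOf t = 2) (hc : orderOf c = 3)
    (htc : t * c * t⁻¹ = c⁻¹) : ¬ Good (Subgroup.zpowers t) := by
  intro hg
  have htc' : Nat.card (Subgroup.zpowers t) = 2 := by rw [Nat.card_zpowers, ht]
  have hprime : ∀ {A B : Subgroup G}, A ≤ B → ∀ p, p.Prime → Nat.card B = Nat.card A * p →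
      A ⋖ B := by
    intro A B hAB p hp hc
    refine covBy_of_prime_relIndex hAB ?_
    have := card_mul_relIndex hAB
    rw [hc] at this
    rwa [Nat.eq_of_mul_eq_mul_left Nat.card_pos this]
  have hcoatom : ∀ {A : Subgroup G}, Nat.card A = 6 ∨ Nat.card A = 12 → A ⋖ ⊤ := by
    intro A hA
    refine (isCoatom_of_six_le_card hns h60 ?_ (by omega)).covBy_top
    rintro rfl
    rw [Subgroup.card_top, h60] at hA
    omega
  obtain ⟨P, hP⟩ := (IsPGroup.of_card (p := 2) (n := 1) (by rw [htc', pow_one])).exists_le_sylow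
  obtain ⟨hP4, hP12⟩ := card_normalizer_two hns h60 P
  have h1 : CovChain 3 (Subgroup.zpowers t) ⊤ :=
    .cons (hprime hP 2 Nat.prime_two (hP4.trans (by rw [htc'])))
      (.cons (hprime Subgroup.le_normalizer 3 Nat.prime_three (hP12.trans (by rw [hP4])))
        (.cons (hcoatom (.inr hP12)) (.refl _)))
  let C : Sylow 3 G := Sylow.ofCard (Subgroup.zpowers c) (by
    rw [Nat.card_zpowers, hc, h60, (by decide +kernel : (60 : ℕ).factorization 3 = 1), pow_one])
  have hC6 := (card_normalizer_three hns h60 C).2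
  have htN : Subgroup.zpowers t ≤ Subgroup.normalizer (C : Set G) := by
    rw [Subgroup.zpowers_le]
    refine conj_smul_eq_iff.1 (?_ : t • Subgroup.zpowers c = Subgroup.zpowers c)
    rw [conj_smul_zpowers, htc, Subgroup.zpowers_inv]
  have h2 : CovChain 2 (Subgroup.zpowers t) ⊤ :=
    .cons (hprime htN 3 Nat.prime_three (hC6.trans (by rw [htc'])))
      (.cons (hcoatom (.inl hC6)) (.refl _))
  exact absurd (hg h1 h2) (by norm_num)

end OrderSixty

theorem eq_one_or_eq_of_mem_zpowers {G : Type*} [Group G] {g h : G} (hh : h ^ 2 = 1)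
    (hg : g ∈ Subgroup.zpowers h) : g = 1 ∨ g = h := by
  obtain ⟨k, rfl⟩ := hg
  have hh' : h ^ (2 : ℤ) = 1 := by exact_mod_cast hh
  obtain ⟨m, rfl | rfl⟩ := Int.even_or_odd' k
  · exact .inl (by simp [zpow_mul, hh'])
  · exact .inr (by simp [zpow_add, zpow_mul, hh'])

theorem exists_zpowers_of_card_le_two {G : Type*} [Group G] [Finite G] {H : Subgroup G}
    (h : Nat.card H ≤ 2) : ∃ t : G, t ^ 2 = 1 ∧ Subgroup.zpowers t = H := by
  have hpos : 0 < Nat.card H := Nat.card_pos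
  rcases (by omega : Nat.card H = 1 ∨ Nat.card H = 2) with h | h
  · exact ⟨1, one_pow 2, by rw [Subgroup.card_eq_one.1 h, Subgroup.zpowers_one_eq_bot]⟩
  · have : Fact (Nat.Prime 2) := ⟨Nat.prime_two⟩
    obtain ⟨t, ht⟩ := exists_prime_orderOf_dvd_card' (G := H) 2 h.symm.dvd
    have ht' : orderOf (t : G) = 2 := by rw [Subgroup.orderOf_coe, ht]
    refine ⟨t, ht' ▸ pow_orderOf_eq_one (t : G), Subgroup.eq_of_le_of_card_ge
      ((Subgroup.zpowers_le).2 t.2) ?_⟩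
    rw [Nat.card_zpowers, ht', h]

section AlternatingFive

theorem card_sq_eq_one_alternating_five :
    Nat.card {g : alternatingGroup (Fin 5) // g ^ 2 = 1} = 16 := by
  rw [Nat.card_eq_fintype_card]
  decide +kernel

theorem exists_inverted_alternating_five :
    ∀ t : alternatingGroup (Fin 5), t ^ 2 = 1 → t ≠ 1 →
      ∃ c : alternatingGroup (Fin 5), c ^ 3 = 1 ∧ c ≠ 1 ∧ t * c * t⁻¹ = c⁻¹ := by
  decide +kernel

theorem not_good_iff_alternating_five {H : Subgroup (alternatingGroup (Fin 5))} :
    ¬ Good H ↔ Nat.card H ≤ 2 := by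
  have hns := not_isSolvable_alternating_five (α := Fin 5) (by simp)
  have h60 := card_alternating_five (α := Fin 5) (by simp)
  have := alternatingGroup.isSimpleGroup (α := Fin 5) (by simp)
  refine ⟨card_le_two_of_not_good hns h60, fun h => ?_⟩
  have hpos : 0 < Nat.card H := Nat.card_pos
  rcases (by omega : Nat.card H = 1 ∨ Nat.card H = 2) with h | h
  · rw [Subgroup.card_eq_one.1 h]
    exact not_good_bot hns
  · obtain ⟨t, ht2, rfl⟩ := exists_zpowers_of_card_le_two h.le
    rw [Nat.card_zpowers] at h
    obtain ⟨c, hc, hc1, htc⟩ := exists_inverted_alternating_five t ht2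
      (by rintro rfl; rw [orderOf_one] at h; omega)
    exact not_good_of_orderOf_eq_two hns h60 h (orderOf_eq_prime hc hc1) htc

theorem delta_alternating_five : delta (alternatingGroup (Fin 5)) = 16 := by
  rw [delta_eq, ← card_sq_eq_one_alternating_five]
  have hcard : ∀ g : {g : alternatingGroup (Fin 5) // g ^ 2 = 1},
      ¬ Good (Subgroup.zpowers g.1) := fun g => by
    rw [not_good_iff_alternating_five, Nat.card_zpowers]
    exact Nat.le_of_dvd two_pos (orderOf_dvd_of_pow_eq_one g.2)
  refine (Nat.card_congr (Equiv.ofBijective (fun g => ⟨Subgroup.zpowers g.1, hcard g⟩)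
    ⟨fun g h hgh => ?_, fun H => ?_⟩)).symm
  · have hgh' : Subgroup.zpowers g.1 = Subgroup.zpowers h.1 := congrArg Subtype.val hgh
    refine Subtype.ext ?_
    rcases eq_one_or_eq_of_mem_zpowers h.2 (hgh' ▸ Subgroup.mem_zpowers g.1) with h1 | h1
    · rcases eq_one_or_eq_of_mem_zpowers g.2 (hgh' ▸ Subgroup.mem_zpowers h.1) with h2 | h2
      · rw [h1, h2]
      · exact h2.symm
    · exact h1
  · obtain ⟨t, ht, h⟩ := exists_zpowers_of_card_le_two (not_good_iff_alternating_five.1 H.2)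
    exact ⟨⟨t, ht⟩, Subtype.ext h⟩

end AlternatingFive
end ChainLength

namespace ChainLength

open scoped Pointwise
open MulAction

section ConjugacyClass

attribute [local instance] conjAction

variable {G : Type*} [Group G]

/-- The conjugacy class of the cyclic subgroup generated by `x`. -/
abbrev cls (x : G) : Set (Subgroup G) := orbit G (Subgroup.zpowers x)

theorem stabilizer_eq_normalizer (H : Subgroup G) :
    stabilizer G H = Subgroup.normalizer (H : Set G) := by
  ext g
  rw [mem_stabilizer_iff, conj_smul_eq_iff]

theorem card_orbit_conj (H : Subgroup G) :
    Nat.card (orbit G H) = (Subgroup.normalizer (H : Set G)).index := by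
  rw [Nat.card_coe_set_eq, ← index_stabilizer, stabilizer_eq_normalizer]

theorem mem_fixedBy_cls {x y : G} {D : cls x} :
    D ∈ fixedBy (cls x) y ↔ y ∈ Subgroup.normalizer (D.1 : Set G) := by
  rw [mem_fixedBy, Subtype.ext_iff, ← conj_smul_eq_iff]
  rfl

theorem mem_cls_iff {x : G} {D : Subgroup G} :
    D ∈ cls x ↔ ∃ g, D = Subgroup.zpowers (g * x * g⁻¹) := by
  simp only [cls, mem_orbit_iff, conj_smul_zpowers, eq_comm]

theorem orderOf_conj (g x : G) : orderOf (g * x * g⁻¹) = orderOf x :=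
  orderOf_injective (MulAut.conj g).toMonoidHom (MulAut.conj g).injective x

theorem self_mem_fixedBy_cls (x : G) : (⟨_, mem_orbit_self _⟩ : cls x) ∈ fixedBy (cls x) x :=
  mem_fixedBy_cls.2 (Subgroup.le_normalizer (Subgroup.mem_zpowers x))

theorem ncard_fixedBy_conj {X : Type*} [MulAction G X] (g x : G) :
    (fixedBy X (g * x * g⁻¹)).ncard = (fixedBy X x).ncard := by
  rw [← smul_fixedBy, Set.ncard_smul_set]

variable [Finite G]

theorem one_le_ncard_fixedBy_cls (x : G) : 1 ≤ (fixedBy (cls x) x).ncard :=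
  (Set.ncard_pos (Set.toFinite _)).2 ⟨_, self_mem_fixedBy_cls x⟩

theorem commute_of_mem_normalizer_cls {r k : ℕ} [Fact r.Prime] {x y : G} (hx : orderOf x = r)
    (hy : orderOf y = r ^ k) {D : Subgroup G} (hD : D ∈ cls x)
    (h : y ∈ Subgroup.normalizer (D : Set G)) : ∀ d ∈ D, Commute y d := by
  obtain ⟨g, rfl⟩ := mem_cls_iff.1 hD
  exact commute_of_normalizes hy (by rw [Nat.card_zpowers, orderOf_conj, hx]) h

omit [Finite G] in
theorem mem_normalizer_zpowers_of_commute {x y : G} (h : Commute x y) :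
    x ∈ Subgroup.normalizer (Subgroup.zpowers y : Set G) := by
  refine conj_smul_eq_iff.1 (?_ : x • Subgroup.zpowers y = _)
  rw [conj_smul_zpowers, h.eq, mul_inv_cancel_right]

omit [Finite G] in
theorem fixedBy_cls_congr {x y z : G} (h : Subgroup.zpowers y = Subgroup.zpowers z) :
    fixedBy (cls x) y = fixedBy (cls x) z := by
  ext D
  rw [mem_fixedBy_cls, mem_fixedBy_cls, ← Subgroup.zpowers_le, h, Subgroup.zpowers_le]

/-- If `x` fixes few members of its class, members fixed by `x` have the same fixed points. -/
theorem fixedBy_cls_eq {r : ℕ} [hr : Fact r.Prime] {x g : G} (hx : orderOf x = r)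
    (hf : (fixedBy (cls x) x).ncard ≤ r + 1)
    (h : x ∈ Subgroup.normalizer (Subgroup.zpowers (g * x * g⁻¹) : Set G)) :
    fixedBy (cls x) (g * x * g⁻¹) = fixedBy (cls x) x := by
  by_cases hxy : Subgroup.zpowers (g * x * g⁻¹) = Subgroup.zpowers x
  · exact fixedBy_cls_congr hxy
  have hx1 : orderOf x = r ^ 1 := by rw [hx, pow_one]
  have hD : Subgroup.zpowers (g * x * g⁻¹) ∈ cls x := mem_cls_iff.2 ⟨g, rfl⟩
  have hcom := commute_of_mem_normalizer_cls hx hx1 hD h _ (Subgroup.mem_zpowers _)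
  have hmod := ncard_inter_fixedBy_modEq (X := cls x) (x := g * x * g⁻¹) (k := 1)
    (by rw [orderOf_conj, hx1]) (S := fixedBy (cls x) x)
    fun s hs => smul_mem_fixedBy_of_commute hcom hs
  have hle : (fixedBy (cls x) x ∩ fixedBy (cls x) (g * x * g⁻¹)).ncard ≤
      (fixedBy (cls x) x).ncard := Set.ncard_le_ncard Set.inter_subset_left
  have h2 : 2 ≤ (fixedBy (cls x) x ∩ fixedBy (cls x) (g * x * g⁻¹)).ncard := by
    rw [← Set.ncard_pair (a := (⟨_, hD⟩ : cls x)) (b := ⟨_, mem_orbit_self _⟩)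
      (by simpa using hxy)]
    refine Set.ncard_le_ncard ?_
    rintro _ (rfl | rfl)
    · exact ⟨mem_fixedBy_cls.2 h,
        mem_fixedBy_cls.2 (Subgroup.le_normalizer (Subgroup.mem_zpowers _))⟩
    · exact ⟨self_mem_fixedBy_cls x,
        mem_fixedBy_cls.2 (mem_normalizer_zpowers_of_commute hcom.symm)⟩
  have heq : (fixedBy (cls x) x).ncard ≤
      (fixedBy (cls x) x ∩ fixedBy (cls x) (g * x * g⁻¹)).ncard := by
    have hd := (Nat.modEq_iff_dvd' hle).1 hmod
    have := hr.out.two_le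
    have := Nat.eq_zero_of_dvd_of_lt hd (by omega)
    omega
  have hs := Set.eq_of_subset_of_ncard_le Set.inter_subset_left heq
  exact (Set.eq_of_subset_of_ncard_le (Set.inter_eq_left.1 hs)
    (ncard_fixedBy_conj g x).le).symm

theorem isBlock_fixedBy_cls {r : ℕ} [hr : Fact r.Prime] {x : G} (hx : orderOf x = r)
    (hf : (fixedBy (cls x) x).ncard ≤ r + 1) : IsBlock G (fixedBy (cls x) x) := by
  have key : ∀ D ∈ fixedBy (cls x) x, ∀ h, D.1 = Subgroup.zpowers (h * x * h⁻¹) →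
      fixedBy (cls x) (h * x * h⁻¹) = fixedBy (cls x) x := by
    rintro D hD h hh
    refine fixedBy_cls_eq hx hf ?_
    rw [mem_fixedBy_cls, hh] at hD
    exact hD
  rw [isBlock_iff_smul_eq_of_nonempty]
  rintro g ⟨D, hgD, hD⟩
  obtain ⟨h, hh⟩ := mem_cls_iff.1 D.2
  have h1 := key (g⁻¹ • D) (Set.mem_smul_set_iff_inv_smul_mem.1 hgD) (g⁻¹ * h) (by
    change g⁻¹ • D.1 = _
    rw [hh, conj_smul_zpowers]; congr 1; group)
  calc g • fixedBy (cls x) x = g • fixedBy (cls x) (g⁻¹ * h * x * (g⁻¹ * h)⁻¹) := by rw [h1]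
    _ = fixedBy (cls x) (h * x * h⁻¹) := by rw [smul_fixedBy]; congr 1; group
    _ = _ := key D hD h hh

variable [IsSimpleGroup G] (hns : ¬ Group.IsSolvable G)

omit [Finite G] [IsSimpleGroup G] in
theorem isPGroup_zpowers {r : ℕ} {x : G} (hx : orderOf x = r) :
    IsPGroup r (Subgroup.zpowers x) := .of_card (n := 1) (by rw [Nat.card_zpowers, hx, pow_one])

omit [Finite G] [IsSimpleGroup G] in
theorem zpowers_ne_bot {r : ℕ} [hr : Fact r.Prime] {x : G} (hx : orderOf x = r) :
    Subgroup.zpowers x ≠ ⊥ := by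
  rw [Ne, Subgroup.zpowers_eq_bot]
  rintro rfl
  exact hr.out.one_lt.ne (by rw [← hx, orderOf_one])

include hns

theorem five_le_card_cls {r : ℕ} [hr : Fact r.Prime] {x : G} (hx : orderOf x = r) :
    5 ≤ Nat.card (cls x) := by
  rw [card_orbit_conj]
  exact five_le_index hns (normalizer_ne_top_of_isPGroup hns (isPGroup_zpowers hx)
    (zpowers_ne_bot hx))

theorem nontrivial_cls {r : ℕ} [hr : Fact r.Prime] {x : G} (hx : orderOf x = r) :
    Nontrivial (cls x) := by
  rw [← Finite.one_lt_card_iff_nontrivial]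
  have := five_le_card_cls hns hx
  omega

omit [Finite G] hns in
theorem faithfulSMul_of_nontrivial (X : Type*) [MulAction G X] [Nontrivial X]
    [IsPretransitive G X] : FaithfulSMul G X :=
  ⟨fun h => toPermHom_injective (X := X) (Equiv.ext h)⟩

omit [Finite G] hns in
theorem ncard_fixedBy_lt {X : Type*} [MulAction G X] [Finite X] [Nontrivial X]
    [IsPretransitive G X] {x : G} (hx : x ≠ 1) : (fixedBy X x).ncard < Nat.card X := by
  have := faithfulSMul_of_nontrivial (G := G) X
  refine (Set.ncard_lt_card fun h => hx ?_)
  rw [fixedBy_eq_univ_iff_eq_one] at h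
  exact h

theorem ncard_fixedBy_cls_lt {r : ℕ} [hr : Fact r.Prime] {x : G} (hx : orderOf x = r) :
    (fixedBy (cls x) x).ncard < Nat.card (cls x) := by
  have := nontrivial_cls hns hx
  refine ncard_fixedBy_lt ?_
  rintro rfl
  exact zpowers_ne_bot hx Subgroup.zpowers_one_eq_bot

theorem exists_index_mul_ncard_fixedBy {r : ℕ} [hr : Fact r.Prime] {x : G} (hx : orderOf x = r)
    (hf : (fixedBy (cls x) x).ncard ≤ r + 1) :
    ∃ M : Subgroup G, M ≠ ⊤ ∧ (fixedBy (cls x) x).ncard * M.index = Nat.card (cls x) := by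
  have h := (isBlock_fixedBy_cls hx hf).ncard_block_mul_ncard_orbit_eq
    ⟨_, self_mem_fixedBy_cls x⟩
  rw [← index_stabilizer] at h
  refine ⟨_, fun ht => ?_, h⟩
  rw [ht, Subgroup.index_top, mul_one] at h
  exact (ncard_fixedBy_cls_lt hns hx).ne h

omit [IsSimpleGroup G] hns in
theorem commute_of_card_lt {p k : ℕ} [hp : Fact p.Prime] {y : G} (hy : orderOf y = p ^ k)
    {D : Subgroup G} (hD : Nat.card D < p) (hn : y ∈ Subgroup.normalizer (D : Set G)) :
    ∀ d ∈ D, Commute y d := by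
  have hy' : orderOf (ConjAct.toConjAct y) = p ^ k := by
    rw [← hy]; exact orderOf_injective ConjAct.toConjAct.toMonoidHom ConjAct.toConjAct.injective y
  have h := ncard_inter_fixedBy_modEq (X := G) hy' (S := (D : Set G)) fun d hd => by
    rw [ConjAct.toConjAct_smul]
    exact (Subgroup.mem_normalizer_iff.1 hn d).1 hd
  have h0 : (D : Set G).ncard < p := by rwa [← Nat.card_coe_set_eq (D : Set G)]
  have hle : ((D : Set G) ∩ fixedBy G (ConjAct.toConjAct y)).ncard ≤ (D : Set G).ncard :=
    Set.ncard_le_ncard Set.inter_subset_left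
  have heq := Nat.ModEq.eq_of_lt_of_lt h (hle.trans_lt h0) h0
  intro d hd
  have := (Set.eq_of_subset_of_ncard_le Set.inter_subset_left heq.ge).ge hd
  have h3 := this.2
  rw [mem_fixedBy, ConjAct.toConjAct_smul] at h3
  exact mul_inv_eq_iff_eq_mul.1 h3

/-- Primes `p > r` that are large with respect to the class of `x` do not divide the order of the
normalizer. -/
theorem not_dvd_card_normalizer {r p : ℕ} [hr : Fact r.Prime] [hp : Fact p.Prime] {x : G}
    (hx : orderOf x = r) (hrp : r < p) (hf : (fixedBy (cls x) x).ncard < p)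
    (hlt : Nat.card (cls x) < (fixedBy (cls x) x).ncard + p * r) :
    ¬ p ∣ Nat.card (Subgroup.normalizer (Subgroup.zpowers x : Set G)) := by
  intro hd
  obtain ⟨y, hy⟩ := exists_prime_orderOf_dvd_card' p hd
  have hy' : orderOf (y : G) = p ^ 1 := by rw [Subgroup.orderOf_coe, hy, pow_one]
  have := nontrivial_cls hns hx
  have := faithfulSMul_of_nontrivial (G := G) (cls x)
  refine false_of_commute (X := cls x) hx (hy'.trans (pow_one p)) hrp.ne
    (commute_of_card_lt hy' (by rwa [Nat.card_zpowers, hx]) y.2 x (Subgroup.mem_zpowers x)).symm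
    hf hlt

omit [IsSimpleGroup G] hns in
theorem card_normalizer_dvd {p : ℕ} [hp : Fact p.Prime] {P : Subgroup G} (hP : Nat.card P = p) :
    Nat.card (Subgroup.normalizer (P : Set G)) ∣
      Nat.card (Subgroup.centralizer (P : Set G)) * (p - 1) := by
  have : IsCyclic P := isCyclic_of_prime_card hP
  have hle : Subgroup.centralizer (P : Set G) ≤ Subgroup.normalizer (P : Set G) :=
    Subgroup.centralizer_le_normalizer _
  have h1 := Subgroup.card_subgroup_dvd_card P.normalizerMonoidHom.range
  rw [IsCyclic.card_mulAut, hP, Nat.totient_prime hp.out] at h1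
  have h2 := Subgroup.index_ker P.normalizerMonoidHom
  rw [Subgroup.normalizerMonoidHom_ker] at h2
  rw [← card_mul_relIndex hle]
  refine mul_dvd_mul_left _ ?_
  change (Subgroup.relIndex _ _) = _ at h2
  rw [h2]
  exact h1

omit [IsSimpleGroup G] hns in
/-- If the order of the normalizer of a group `P` of prime order `r` is divisible by a power of two
not dividing `r - 1`, then an involution centralizes `P`. -/
theorem exists_involution_commute {r m : ℕ} [hr : Fact r.Prime] {P : Subgroup G}
    (hP : Nat.card P = r) (hm : 2 ^ m ∣ Nat.card (Subgroup.normalizer (P : Set G)))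
    (hmr : ¬ 2 ^ m ∣ r - 1) : ∃ t : G, orderOf t = 2 ∧ ∀ x ∈ P, Commute x t := by
  have h2 : Fact (Nat.Prime 2) := ⟨Nat.prime_two⟩
  have hd := hm.trans (card_normalizer_dvd hP)
  have : 2 ∣ Nat.card (Subgroup.centralizer (P : Set G)) := by
    by_contra h
    exact hmr (((Nat.prime_two.coprime_iff_not_dvd.2 h).pow_left m).dvd_of_dvd_mul_left hd)
  obtain ⟨t, ht⟩ := exists_prime_orderOf_dvd_card' 2 this
  exact ⟨t, by rw [Subgroup.orderOf_coe, ht], fun x hx => Subgroup.mem_centralizer_iff.1 t.2 x hx⟩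

theorem false_of_commute_involution_cls {r : ℕ} [hr : Fact r.Prime] {x t : G}
    (hx : orderOf x = r) (hr2 : r ≠ 2) (ht : orderOf t = 2) (h : Commute x t)
    (hf : (fixedBy (cls x) x).ncard < 2)
    (hlt : Nat.card (cls x) < (fixedBy (cls x) x).ncard + 4 * r) : False := by
  have := nontrivial_cls hns hx
  exact false_of_commute_involution hns hx ht hr2 h hf hlt

end ConjugacyClass

end ChainLength

namespace ChainLength

open scoped Pointwise
open MulAction

section SingleClass

attribute [local instance] conjAction

variable {G : Type*} [Group G] [Finite G]

omit [Finite G] in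
theorem card_cls_mul (x : G) : Nat.card (cls x) *
    Nat.card (Subgroup.normalizer (Subgroup.zpowers x : Set G)) = Nat.card G := by
  rw [card_orbit_conj, mul_comm, Subgroup.card_mul_index]

variable [IsSimpleGroup G] (hns : ¬ Group.IsSolvable G)
include hns

theorem card_cls_ne_seven (hidx : ∀ K : Subgroup G, K ≠ ⊤ → 7 ≤ K.index) {r : ℕ}
    [hr : Fact r.Prime] {x : G} (hx : orderOf x = r) : Nat.card (cls x) ≠ 7 := by
  intro h7
  have hlt := ncard_fixedBy_cls_lt hns hx
  have h1 := one_le_ncard_fixedBy_cls x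
  have hmod := ncard_fixedBy_modEq (X := cls x) (hx.trans (pow_one r).symm)
  have hblock := exists_index_mul_ncard_fixedBy hns hx
  have htwo : r = 2 → 4 ∣ 7 - (fixedBy (cls x) x).ncard := fun h2 => by
    have := nontrivial_cls hns hx
    have h4 := four_dvd_ncard_compl_fixedBy (X := cls x) hns (hx.trans h2)
    have := Set.ncard_add_ncard_compl (fixedBy (cls x) x)
    rwa [← h7, ← this, Nat.add_sub_cancel_left]
  have hdvd := (Nat.modEq_iff_dvd' hlt.le).1 hmod
  have hcp := fun h5 : Fact (Nat.Prime 5) => not_dvd_card_normalizer (p := 5) hns hx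
  have hinv := fun t => false_of_commute_involution_cls (t := t) hns hx
  have hcard := card_cls_mul x
  have h360 := two_mul_card_dvd_of_index hns ((card_orbit_conj _).symm.trans h7) (by norm_num)
  rw [h7] at *
  generalize (fixedBy (cls x) x).ncard = f at *
  have hf1 : f ≤ r + 1 → f = 1 := fun hf => by
    obtain ⟨M, hM, h⟩ := hblock hf
    have := hidx M hM
    nlinarith
  have hr6 : r ≤ 6 := (Nat.le_of_dvd (by omega) hdvd).trans (by omega)
  have hr2 := hr.out.two_le
  have hr3 : r = 3 ∧ f = 1 := by
    have := hr.out
    interval_cases r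
    · have := htwo rfl
      omega
    · omega
    · exact absurd this (by norm_num)
    · omega
    · exact absurd this (by norm_num)
  obtain ⟨rfl, rfl⟩ := hr3
  have h5 := hcp ⟨by norm_num⟩ (by norm_num) (by norm_num) (by norm_num)
  have h4 : ¬ 4 ∣ Nat.card (Subgroup.normalizer (Subgroup.zpowers x : Set G)) := fun h4 => by
    obtain ⟨t, ht, hc⟩ := exists_involution_commute (m := 2)
      (by rw [Nat.card_zpowers, hx]) h4 (by norm_num)
    exact hinv t (by norm_num) ht (hc x (Subgroup.mem_zpowers x)) (by norm_num) (by norm_num)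
  rw [← hcard] at h360
  have h360' : Nat.card (Subgroup.normalizer (Subgroup.zpowers x : Set G)) ∣ 360 := by
    refine Nat.dvd_of_mul_dvd_mul_left (k := 14) (by norm_num) ?_
    rw [(by decide : Nat.factorial 7 = 14 * 360)] at h360
    convert h360 using 1
    ring
  generalize Nat.card (Subgroup.normalizer (Subgroup.zpowers x : Set G)) = k at *
  have h7p : Fact (Nat.Prime 7) := ⟨by norm_num⟩
  have hdG : 7 ∣ Nat.card G := ⟨k, hcard.symm⟩
  obtain ⟨n, m, -, -, hnm, hn, hn5, hm, -⟩ := sylow_numbers hns (default : Sylow 7 G) hdG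
  obtain ⟨m, rfl⟩ := (Sylow.dvd_card_of_dvd_card _ hdG).trans hm
  have hnk : n ∣ k := ⟨m, by rw [← hcard] at hnm; linarith⟩
  have key : ∀ k ∈ Nat.divisors 360, ¬ 5 ∣ k → ¬ 4 ∣ k → ∀ n ∈ Nat.divisors k, n % 7 = 1 →
      5 ≤ n → False := by decide +kernel
  exact key k (Nat.mem_divisors.2 ⟨h360', by norm_num⟩) h5 h4 n (Nat.mem_divisors.2
    ⟨hnk, by rintro rfl; simp at h5⟩) hn hn5

theorem eq_seven_of_card_cls_eq_eight {r : ℕ} [hr : Fact r.Prime] {x : G} (hx : orderOf x = r)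
    (h8 : Nat.card (cls x) = 8) {K : Subgroup G} (hK : K.index = 7) : r = 7 := by
  have h7p : Fact (Nat.Prime 7) := ⟨by norm_num⟩
  have hdG : 7 ∣ Nat.card G := hK ▸ K.index_dvd_card
  have hr7 : r ≤ 7 := by
    have h1 := (hx ▸ orderOf_dvd_natCard x).trans
      ((Nat.dvd_mul_left _ 2).trans (two_mul_card_dvd_of_index hns hK (by norm_num)))
    exact hr.out.dvd_factorial.1 h1
  by_contra hne
  obtain ⟨y, hy⟩ := exists_prime_orderOf_dvd_card' 7 hdG
  have hmod := ncard_fixedBy_modEq (X := cls x) (hy.trans (pow_one 7).symm)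
  rw [h8] at hmod
  obtain ⟨D, hD⟩ : (fixedBy (cls x) y).Nonempty := by
    rw [Set.nonempty_iff_ne_empty]
    intro h
    rw [h, Set.ncard_empty] at hmod
    exact absurd hmod (by decide)
  obtain ⟨g, hg⟩ := mem_cls_iff.1 D.2
  have hcom : Commute y (g * x * g⁻¹) := by
    refine commute_of_card_lt (hy.trans (pow_one 7).symm) ?_ (mem_fixedBy_cls.1 hD) _
      (hg ▸ Subgroup.mem_zpowers _)
    rw [hg, Nat.card_zpowers, orderOf_conj, hx]
    omega
  have hX : Nat.card (G ⧸ K) = 7 := hK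
  have : Nontrivial (G ⧸ K) := by
    rw [← Finite.one_lt_card_iff_nontrivial, hX]
    norm_num
  have := faithfulSMul_of_nontrivial (G := G) (G ⧸ K)
  have hfix := ncard_fixedBy_modEq (X := G ⧸ K) (hy.trans (pow_one 7).symm)
  have hlt : (fixedBy (G ⧸ K) y).ncard < Nat.card (G ⧸ K) :=
    ncard_fixedBy_lt (by rintro rfl; simp at hy)
  rw [hX] at hfix hlt
  have h0 : (fixedBy (G ⧸ K) y).ncard = 0 :=
    (hfix.trans (by decide : 7 ≡ 0 [MOD 7])).eq_of_lt_of_lt hlt (by norm_num)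
  refine false_of_commute (X := G ⧸ K) hy (y := g * x * g⁻¹) (p := r) (by rw [orderOf_conj, hx])
    (Ne.symm hne) hcom (by rw [h0]; exact hr.out.pos) ?_
  rw [h0, hX]
  have := hr.out.two_le
  omega

omit [IsSimpleGroup G] hns in
theorem ncard_lt_delta (hbot : ¬ Good (⊥ : Subgroup G)) {S : Set (Subgroup G)}
    (hS : ∀ A ∈ S, A ≠ ⊥ ∧ ¬ Good A) : S.ncard < delta G := by
  have h := Set.ncard_insert_of_notMem (fun h => (hS ⊥ h).1 rfl) (Set.toFinite S)
  rw [delta_eq, Nat.lt_iff_add_one_le, ← h]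
  refine Set.ncard_le_ncard (t := {H : Subgroup G | ¬ Good H}) ?_ (Set.toFinite _)
  rintro A (rfl | hA)
  · exact hbot
  · exact (hS A hA).2

omit [IsSimpleGroup G] hns in
theorem not_good_of_mem_orbit {A B : Subgroup G} (hA : A ≠ ⊥) (hb : ¬ Good A)
    (hB : B ∈ orbit G A) : B ≠ ⊥ ∧ ¬ Good B := by
  obtain ⟨g, rfl⟩ := hB
  refine ⟨fun h => hA ?_, fun h => hb (good_conj_smul.1 h)⟩
  rw [← Subgroup.card_eq_one, ← card_conj_smul g A]
  exact Subgroup.card_eq_one.2 h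

omit [Finite G] [IsSimpleGroup G] hns in
theorem good_top : Good (⊤ : Subgroup G) := by
  have : ∀ {n : ℕ}, CovChain n (⊤ : Subgroup G) ⊤ → n = 0 := by
    intro n hn
    cases hn with
    | refl => rfl
    | cons hc _ => exact absurd hc.lt not_top_lt
  exact fun _ _ hr hs => (this hr).trans (this hs).symm

section

variable (hidx : ∀ K : Subgroup G, K ≠ ⊤ → 7 ≤ K.index)
include hidx

omit [Finite G] hns in
theorem seven_le_ncard_orbit {A : Subgroup G} (hA : A ≠ ⊥) (hb : ¬ Good A) :
    7 ≤ (orbit G A).ncard := by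
  rw [← Nat.card_coe_set_eq, card_orbit_conj]
  refine hidx _ fun h => ?_
  have := Subgroup.normalizer_eq_top_iff.1 h
  rcases this.eq_bot_or_eq_top with h | h
  · exact hA h
  · exact hb (h ▸ good_top)

/-- The nontrivial subgroups which are not good form a single conjugacy class. -/
theorem mem_orbit_of_not_good (hδ : delta G ≤ 16) {A B : Subgroup G} (hA : A ≠ ⊥)
    (hbA : ¬ Good A) (hB : B ≠ ⊥) (hbB : ¬ Good B) : B ∈ orbit G A := by
  have hbot := not_good_bot hns
  have hsum : ∀ {A B : Subgroup G}, A ≠ ⊥ → ¬ Good A → B ≠ ⊥ → ¬ Good B → B ∉ orbit G A →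
      (orbit G A).ncard + (orbit G B).ncard ≤ 15 := by
    intro A B hA hbA hB hbB h
    have hd : Disjoint (orbit G A) (orbit G B) := (orbit.eq_or_disjoint A B).resolve_left
      fun he => h (he ▸ mem_orbit_self B)
    rw [← Set.ncard_union_eq hd]
    have := ncard_lt_delta hbot (S := orbit G A ∪ orbit G B) fun C hC =>
      hC.elim (not_good_of_mem_orbit hA hbA) (not_good_of_mem_orbit hB hbB)
    omega
  by_contra h
  have hAB := hsum hA hbA hB hbB h
  have hA7 := seven_le_ncard_orbit hidx hA hbA
  have hB7 := seven_le_ncard_orbit hidx hB hbB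
  have h8 : ∀ {C : Subgroup G}, C ≠ ⊥ → ¬ Good C → (orbit G C).ncard ≤ 8 := by
    intro C hC hbC
    by_cases hCA : C ∈ orbit G A
    · rw [orbit_eq_iff.2 hCA]
      omega
    · have := hsum hA hbA hC hbC hCA
      omega
  obtain ⟨D, hD, hbD, hD7⟩ : ∃ D : Subgroup G, D ≠ ⊥ ∧ ¬ Good D ∧ (orbit G D).ncard = 7 := by
    rcases (by omega : (orbit G A).ncard = 7 ∨ (orbit G B).ncard = 7) with h | h
    · exact ⟨A, hA, hbA, h⟩
    · exact ⟨B, hB, hbB, h⟩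
  rw [← Nat.card_coe_set_eq, card_orbit_conj] at hD7
  have hseven : ∀ {r : ℕ} {x : G}, r.Prime → orderOf x = r → x ∈ D → r = 7 := by
    intro r x hr hx hxD
    have := Fact.mk hr
    have hb : ¬ Good (Subgroup.zpowers x) := fun hg => hbD (hg.mono (Subgroup.zpowers_le.2 hxD))
    have hne := zpowers_ne_bot hx
    have h1 : (cls x).ncard ≤ 8 := h8 hne hb
    have h2 : 7 ≤ (cls x).ncard := seven_le_ncard_orbit hidx hne hb
    have h3 := card_cls_ne_seven hns hidx hx
    rw [Nat.card_coe_set_eq] at h3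
    exact eq_seven_of_card_cls_eq_eight hns hx (by rw [Nat.card_coe_set_eq]; omega) hD7
  have h7p : Fact (Nat.Prime 7) := ⟨by norm_num⟩
  have hpow := Nat.eq_prime_pow_of_unique_prime_dvd (n := Nat.card D) (p := 7) Nat.card_pos.ne'
    fun {d} hd hdD => by
      have := Fact.mk hd
      obtain ⟨x, hx⟩ := exists_prime_orderOf_dvd_card' d hdD
      exact hseven hd ((Subgroup.orderOf_coe x).trans hx) x.2
  have hcard : Nat.card D = 7 := by
    generalize (Nat.card D).primeFactorsList.length = k at hpow
    have h0 : k ≠ 0 := by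
      rintro rfl
      exact hD (Subgroup.card_eq_one.1 hpow)
    have h2 : k < 2 := by
      by_contra! h2
      have h1 := ((pow_dvd_pow 7 h2).trans (hpow ▸ D.card_subgroup_dvd_card)).trans
        ((Nat.dvd_mul_left _ 2).trans (two_mul_card_dvd_of_index hns hD7 (by norm_num)))
      exact absurd h1 (by decide +kernel)
    rw [hpow, (by omega : k = 1), pow_one]
  obtain ⟨x, hx⟩ := exists_prime_orderOf_dvd_card' 7 hcard.symm.dvd
  have hx' : orderOf (x : G) = 7 := (Subgroup.orderOf_coe x).trans hx
  have hDx : Subgroup.zpowers (x : G) = D := Subgroup.eq_of_le_of_card_ge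
    (Subgroup.zpowers_le.2 x.2) (by rw [Nat.card_zpowers, hx', hcard])
  refine card_cls_ne_seven hns hidx hx' ?_
  rw [card_orbit_conj, hDx, hD7]

theorem exists_isMinimalGood_of_delta_le (hmin : ∀ M : Subgroup G, M ≠ ⊤ → Group.IsSolvable M)
    (hδ : delta G ≤ 16) :
    ∃ q : ℕ, q.Prime ∧ ∃ T : Subgroup G, IsMinimalGood q T ∧ ∃ r : ℕ, r.Prime ∧ r ≠ q ∧
      ∃ x ∈ Subgroup.normalizer (T : Set G), orderOf x = r ∧
        x ∉ Subgroup.centralizer (T : Set G) ∧ Nat.card (cls x) ≤ 15 ∧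
        ∀ A : Subgroup G, A ≠ ⊥ → ¬ Good A → A ∈ cls x := by
  have hprime : ∀ {s : ℕ} {A : Subgroup G}, s.Prime → IsPGroup s A → A ≠ ⊥ → ¬ Good A →
      Nat.card A = s := by
    intro s A hs hA hb hg
    have := Fact.mk hs
    have hd : s ∣ Nat.card A := by
      obtain ⟨k, hk⟩ := IsPGroup.iff_card.1 hA
      have : k ≠ 0 := by
        rintro rfl
        exact hb (Subgroup.card_eq_one.1 hk)
      exact hk ▸ dvd_pow_self s this
    obtain ⟨x, hx⟩ := exists_prime_orderOf_dvd_card' s hd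
    have hx' : orderOf (x : G) = s := (Subgroup.orderOf_coe x).trans hx
    obtain ⟨g, hg⟩ := mem_orbit_of_not_good hns hidx hδ (zpowers_ne_bot hx')
      (fun h => hg (h.mono (Subgroup.zpowers_le.2 x.2))) hb hg
    rw [← hg]
    exact (card_conj_smul _ _).trans (by rw [Nat.card_zpowers, hx'])
  have hgood : ∃ s : ℕ, s.Prime ∧ ∃ A : Subgroup G, IsPGroup s A ∧ A ≠ ⊥ ∧ Good A := by
    by_contra! hall
    have h1 : Nat.card G ≠ 1 := fun h => by
      rw [Nat.card_eq_one_iff_unique] at h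
      exact not_comm hns fun a b => h.1.elim _ _
    obtain ⟨p, hp, hpG⟩ := Nat.exists_prime_and_dvd h1
    have := Fact.mk hp
    let P : Sylow p G := default
    have hPb := sylow_ne_bot P hpG
    have hPp := hprime hp P.2 hPb (hall p hp P P.2 hPb)
    refine not_isPGroup hns (p := p) (IsPGroup.of_card (n := (Nat.card G).primeFactorsList.length)
      (Nat.eq_prime_pow_of_unique_prime_dvd Nat.card_pos.ne' fun {d} hd hdG => ?_))
    have := Fact.mk hd
    let R : Sylow d G := default
    have hRb := sylow_ne_bot R hdG
    have hbR := hall d hd R R.2 hRb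
    obtain ⟨g, hg⟩ := mem_orbit_of_not_good hns hidx hδ hPb (hall p hp P P.2 hPb) hRb hbR
    rw [← hprime hd R.2 hRb hbR, ← hg]
    exact (card_conj_smul _ _).trans hPp
  obtain ⟨q, hq, T, hT, r, hr, hrq, x, hxT, hx, hxC, hb⟩ := exists_isMinimalGood_of_bad hns hmin
    hprime hgood
  have := Fact.mk hr
  refine ⟨q, hq, T, hT, r, hr, hrq, x, hxT, hx, hxC, ?_, fun A hA hbA =>
    mem_orbit_of_not_good hns hidx hδ (zpowers_ne_bot hx) hb hA hbA⟩
  have := ncard_lt_delta (not_good_bot hns) fun C hC =>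
    not_good_of_mem_orbit (zpowers_ne_bot hx) hb hC
  rw [Nat.card_coe_set_eq]
  exact Nat.le_of_lt_succ (this.trans_le hδ)

end

end SingleClass

end ChainLength

namespace ChainLength

open scoped Pointwise
open MulAction

section SingleClass

attribute [local instance] conjAction

variable {G : Type*} [Group G] [Finite G]

/-- The nontrivial bad subgroups are among the at most `15` conjugates of the subgroup of order `r`
generated by `x`, which acts nontrivially on the minimal good `q`-subgroup `T`. -/
structure IsSingleClass (q r : ℕ) (T : Subgroup G) (x : G) : Prop where
  minimalGood : IsMinimalGood q T
  ne : r ≠ q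
  mem_normalizer : x ∈ Subgroup.normalizer (T : Set G)
  orderOf_eq : orderOf x = r
  not_mem_centralizer : x ∉ Subgroup.centralizer (T : Set G)
  card_le : Nat.card (cls x) ≤ 15
  mem_cls : ∀ A : Subgroup G, A ≠ ⊥ → ¬ Good A → A ∈ cls x

variable {q r : ℕ} [hq : Fact q.Prime] [hr : Fact r.Prime] {T : Subgroup G} {x : G}

omit [Finite G] hr in
theorem card_of_mem_cls (hx : orderOf x = r) {D : Subgroup G} (hD : D ∈ cls x) :
    Nat.card D = r := by
  obtain ⟨g, rfl⟩ := mem_cls_iff.1 hD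
  rw [Nat.card_zpowers, orderOf_conj, hx]

omit [Finite G] hq hr in
theorem IsSingleClass.good_of_card_ne (h : IsSingleClass q r T x) {A : Subgroup G} (hA : A ≠ ⊥)
    (hc : Nat.card A ≠ r) : Good A := by
  by_contra hg
  exact hc (card_of_mem_cls h.orderOf_eq (h.mem_cls A hA hg))

omit [Finite G] hr in
theorem card_ne_of_isPGroup (hrq : r ≠ q) {W : Subgroup G} (hr1 : r.Prime) (hW : IsPGroup q W)
    [Finite W] : Nat.card W ≠ r := by
  intro hc
  obtain ⟨k, hk⟩ := IsPGroup.iff_card.1 hW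
  rw [hk] at hc
  exact hrq ((Nat.prime_dvd_prime_iff_eq hr1 hq.out).1
    (hr1.dvd_of_dvd_pow (n := k) (by rw [hc])))

theorem IsSingleClass.good_of_isPGroup (h : IsSingleClass q r T x) {W : Subgroup G}
    (hW : IsPGroup q W) (hb : W ≠ ⊥) : Good W :=
  h.good_of_card_ne hb (card_ne_of_isPGroup h.ne hr.out hW)

theorem IsSingleClass.isMinimalGood (h : IsSingleClass q r T x) {W : Subgroup G}
    (hW : IsPGroup q W) (hb : W ≠ ⊥) : IsMinimalGood q W :=
  h.minimalGood.of_good hW hb (h.good_of_isPGroup hW hb)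

/-- Subgroups of order `p` are conjugate in `N` if all nontrivial `p`-subgroups of `N` have
order `p`. -/
theorem exists_conj_smul_eq {p : ℕ} [hp : Fact p.Prime] {N A B : Subgroup G}
    (hN : ∀ E : Subgroup G, IsPGroup p E → E ≠ ⊥ → E ≤ N → Nat.card E = p)
    (hA : Nat.card A = p) (hB : Nat.card B = p) (hAN : A ≤ N) (hBN : B ≤ N) :
    ∃ g ∈ N, g • A = B := by
  have hmax : ∀ A : Subgroup G, Nat.card A = p → A ≤ N →
      ∃ S : Sylow p N, (S : Subgroup N) = A.subgroupOf N := by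
    intro A hA hAN
    have hAp : IsPGroup p A := IsPGroup.of_card (n := 1) (by rw [hA, pow_one])
    obtain ⟨S, hS⟩ := IsPGroup.exists_le_sylow
      (hAp.of_equiv (Subgroup.subgroupOfEquivOfLe hAN).symm)
    have hAS : A ≤ (S : Subgroup N).map N.subtype := by
      rw [← Subgroup.map_subgroupOf_eq_of_le hAN]
      exact Subgroup.map_mono hS
    have hAb : A ≠ ⊥ := by
      rintro rfl
      rw [Subgroup.card_bot] at hA
      exact hp.out.one_lt.ne hA
    have hc := hN _ (S.2.map N.subtype) (fun hb => hAb (le_bot_iff.1 (hb ▸ hAS)))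
      (Subgroup.map_subtype_le _)
    refine ⟨S, (Subgroup.eq_of_le_of_card_ge hS ?_).symm⟩
    rw [Subgroup.card_map_of_injective N.subtype_injective] at hc
    rw [Nat.card_congr (Subgroup.subgroupOfEquivOfLe hAN).toEquiv, hA]
    exact hc.le
  obtain ⟨R, hR⟩ := hmax A hA hAN
  obtain ⟨S, hS⟩ := hmax B hB hBN
  obtain ⟨g, hg⟩ := exists_smul_eq N R S
  refine ⟨g, g.2, ?_⟩
  have h1 : (MulAut.conj g • (R : Subgroup N)) = S := by rw [← hg]; rfl
  rw [hR, hS] at h1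
  have hle : (g : G) • A ≤ B := by
    rw [conj_smul_eq_map, Subgroup.map_le_iff_le_comap]
    intro a ha
    have h2 : MulAut.conj g • (⟨a, hAN ha⟩ : N) ∈ B.subgroupOf N := by
      rw [← h1]
      exact Subgroup.smul_mem_pointwise_smul _ _ _ (Subgroup.mem_subgroupOf.2 ha)
    exact Subgroup.mem_subgroupOf.1 h2
  refine Subgroup.eq_of_le_of_card_ge hle ?_
  rw [card_conj_smul, hA, hB]

variable [IsSimpleGroup G] (hns : ¬ Group.IsSolvable G)
include hns

/-- The orbit of `⟨x⟩` under `W` in the class of `⟨x⟩`. -/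
theorem exists_card_orbit {W : Subgroup G} (hrq : r ≠ q) (hx : orderOf x = r) (hW : IsPGroup q W)
    (hxW : x ∈ Subgroup.normalizer (W : Set G)) (hxC : x ∉ Subgroup.centralizer (W : Set G)) :
    ∃ k, (orbit W (⟨_, mem_orbit_self _⟩ : cls x)).ncard = q ^ k ∧ k ≠ 0 ∧ q ^ k ≡ 1 [MOD r] ∧
      q ^ k < Nat.card (cls x) := by
  set D₀ : cls x := ⟨_, mem_orbit_self _⟩
  have hx1 : orderOf x = r ^ 1 := by rw [hx, pow_one]
  obtain ⟨k, hk⟩ := hW.card_orbit D₀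
  rw [Nat.card_coe_set_eq] at hk
  have hle : ∀ D ∈ orbit W D₀, D.1 ≤ W ⊔ Subgroup.zpowers x := by
    rintro _ ⟨w, rfl⟩
    change (w : G) • Subgroup.zpowers x ≤ _
    rw [conj_smul_zpowers, Subgroup.zpowers_le]
    have hw : (w : G) ∈ W ⊔ Subgroup.zpowers x := Subgroup.mem_sup_left w.2
    exact mul_mem (mul_mem hw (Subgroup.mem_sup_right (Subgroup.mem_zpowers x))) (inv_mem hw)
  have hinv : ∀ D ∈ orbit W D₀, x • D ∈ orbit W D₀ := by
    rintro _ ⟨w, rfl⟩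
    refine ⟨⟨x * w * x⁻¹, (Subgroup.mem_normalizer_iff.1 hxW _).1 w.2⟩, ?_⟩
    have h0 : x • D₀ = D₀ := self_mem_fixedBy_cls x
    change (x * w * x⁻¹) • D₀ = x • (w : G) • D₀
    rw [mul_smul, inv_smul_eq_iff.2 h0.symm, mul_smul]
  have hmod := ncard_inter_fixedBy_modEq hx1 hinv
  have hfix : orbit W D₀ ∩ fixedBy (cls x) x = {D₀} := by
    refine Set.eq_singleton_iff_unique_mem.2 ⟨⟨mem_orbit_self _, self_mem_fixedBy_cls x⟩, ?_⟩
    rintro D ⟨hDW, hD⟩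
    have hxN : Subgroup.zpowers x ≤ Subgroup.normalizer (D.1 : Set G) :=
      Subgroup.zpowers_le.2 (mem_fixedBy_cls.1 hD)
    have hDr := card_of_mem_cls hx D.2
    have hDp : IsPGroup r D.1 := IsPGroup.of_card (n := 1) (by rw [hDr, pow_one])
    have heq := eq_zpowers_of_isPGroup hW hrq hx1 hxW
      (hDp.to_sup_of_normal_left' (isPGroup_zpowers hx) hxN)
      (Subgroup.mem_sup_right (Subgroup.mem_zpowers x)) (sup_le (hle D hDW) le_sup_right)
    refine Subtype.ext (Subgroup.eq_of_le_of_card_ge (le_sup_left.trans heq.le) ?_)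
    rw [hDr, Nat.card_zpowers, hx]
  rw [hfix, Set.ncard_singleton, hk] at hmod
  refine ⟨k, hk, ?_, hmod.symm, ?_⟩
  · rintro rfl
    rw [pow_zero, Set.ncard_eq_one] at hk
    obtain ⟨D, hD⟩ := hk
    refine hxC (mem_centralizer_of_le_normalizer hW hrq hx1 hxW fun w hw => ?_)
    have h1 : (⟨w, hw⟩ : W) • D₀ ∈ ({D} : Set (cls x)) := hD ▸ mem_orbit _ _
    have h2 : D₀ ∈ ({D} : Set (cls x)) := hD ▸ mem_orbit_self _
    exact mem_fixedBy_cls.1 (h1.trans h2.symm : w • D₀ = D₀)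
  · rw [← hk]
    refine Set.ncard_lt_card fun huniv => ?_
    have hWb : W ≠ ⊥ := by
      rintro rfl
      exact hxC fun w hw => by rw [Subgroup.mem_bot.1 hw, one_mul, mul_one]
    refine normalizer_ne_top_of_isPGroup hns hW hWb (top_le_iff.1 ?_)
    have hcl : Subgroup.normalClosure {x} = ⊤ := by
      refine (Subgroup.normalClosure_normal.eq_bot_or_eq_top).resolve_left fun hb => ?_
      refine zpowers_ne_bot hx (Subgroup.zpowers_eq_bot.2 (Subgroup.mem_bot.1 (hb ▸ ?_)))
      exact Subgroup.subset_normalClosure rfl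
    rw [← hcl, Subgroup.normalClosure, Subgroup.closure_le]
    intro y hy
    obtain ⟨a, rfl, hc⟩ := Group.mem_conjugatesOfSet_iff.1 hy
    obtain ⟨g, rfl⟩ := isConj_iff.1 hc
    have hg := hle ⟨_, mem_cls_iff.2 ⟨g, rfl⟩⟩ (huniv ▸ Set.mem_univ _)
    exact sup_le Subgroup.le_normalizer (Subgroup.zpowers_le.2 hxW) (hg (Subgroup.mem_zpowers _))

omit hq in
theorem IsSingleClass.ncard_fixedBy (hidx : ∀ K : Subgroup G, K ≠ ⊤ → 7 ≤ K.index)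
    (h : IsSingleClass q r T x) :
    1 ≤ (fixedBy (cls x) x).ncard ∧ (fixedBy (cls x) x).ncard < Nat.card (cls x) ∧
    7 < Nat.card (cls x) ∧ r ∣ Nat.card (cls x) - (fixedBy (cls x) x).ncard ∧
    (r = 2 → 4 ∣ Nat.card (cls x) - (fixedBy (cls x) x).ncard) ∧
    ((fixedBy (cls x) x).ncard ≤ r + 1 → (fixedBy (cls x) x).ncard = 1 ∨
      (fixedBy (cls x) x).ncard = 2 ∧ Nat.card (cls x) = 14 ∧ ∃ M : Subgroup G, M.index = 7) := by
  have hx := h.orderOf_eq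
  have hlt := ncard_fixedBy_cls_lt hns hx
  have h1 := one_le_ncard_fixedBy_cls x
  refine ⟨h1, hlt, ?_, (Nat.modEq_iff_dvd' hlt.le).1
    (ncard_fixedBy_modEq (X := cls x) (hx.trans (pow_one r).symm)), fun h2 => ?_, fun hf => ?_⟩
  · refine lt_of_le_of_ne ?_ (card_cls_ne_seven hns hidx hx).symm
    rw [card_orbit_conj]
    exact hidx _ (normalizer_ne_top_of_isPGroup hns (isPGroup_zpowers hx) (zpowers_ne_bot hx))
  · have := nontrivial_cls hns hx
    have h4 := four_dvd_ncard_compl_fixedBy (X := cls x) hns (hx.trans h2)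
    have := Set.ncard_add_ncard_compl (fixedBy (cls x) x)
    rwa [← this, Nat.add_sub_cancel_left]
  · obtain ⟨M, hM, hmul⟩ := exists_index_mul_ncard_fixedBy hns hx hf
    have := hidx M hM
    have := h.card_le
    have hf2 : (fixedBy (cls x) x).ncard ≤ 2 := by nlinarith
    obtain hf1 | hf1 : (fixedBy (cls x) x).ncard = 1 ∨ (fixedBy (cls x) x).ncard = 2 := by omega
    · exact .inl hf1
    · rw [hf1] at hmul
      exact .inr ⟨hf1, by omega, M, by omega⟩

variable (hmin : ∀ M : Subgroup G, M ≠ ⊤ → Group.IsSolvable M)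
include hmin

/-- If `r < q`, then a `q`-subgroup on which `x` acts nontrivially normalizes no conjugate
of `⟨x⟩`. -/
theorem IsSingleClass.not_le_normalizer (h : IsSingleClass q r T x) (hrq : r < q) {W : Subgroup G}
    (hW : IsPGroup q W) (hxW : x ∈ Subgroup.normalizer (W : Set G))
    (hxC : x ∉ Subgroup.centralizer (W : Set G)) {D : Subgroup G} (hD : D ∈ cls x) :
    ¬ W ≤ Subgroup.normalizer (D : Set G) := by
  intro hWD
  have hWb : W ≠ ⊥ := by
    rintro rfl
    exact hxC fun w hw => by rw [Subgroup.mem_bot.1 hw, one_mul, mul_one]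
  have hWm := h.isMinimalGood hW hWb
  have hDr := card_of_mem_cls h.orderOf_eq hD
  have hDC : D ≤ Subgroup.centralizer (W : Set G) := fun d hd w hw => by
    obtain ⟨k, hk⟩ := IsPGroup.iff_orderOf.1 hW ⟨w, hw⟩
    rw [Subgroup.orderOf_mk] at hk
    exact commute_of_card_lt hk (by rwa [hDr]) (hWD hw) d hd
  obtain ⟨g, hg, hgD⟩ := exists_conj_smul_eq (p := r) (N := Subgroup.normalizer (W : Set G))
    (fun E hE hb hle => by
      by_contra hc
      exact hrq.not_ge (hWm.le_of_le_normalizer hns hmin hr.out hE hb (h.good_of_card_ne hb hc) hle))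
    hDr (by rw [Nat.card_zpowers, h.orderOf_eq])
    (hDC.trans (Subgroup.centralizer_le_normalizer _)) (Subgroup.zpowers_le.2 hxW)
  have hxD : g⁻¹ * x * g ∈ D := by
    rw [← mem_conj_smul, hgD]
    exact Subgroup.mem_zpowers x
  refine hxC fun w hw => ?_
  have := hDC hxD (g⁻¹ * w * g) (by
    simpa using (Subgroup.mem_normalizer_iff.1 (inv_mem hg) w).1 hw)
  have h2 : w * (x * g) = x * (w * g) := by simpa [mul_assoc] using this
  rwa [← mul_assoc, ← mul_assoc, mul_left_inj] at h2

end SingleClass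

end ChainLength

namespace ChainLength

open scoped Pointwise
open MulAction

section SingleClass

attribute [local instance] conjAction

variable {G : Type*} [Group G] [Finite G] {q r : ℕ} [hq : Fact q.Prime] [hr : Fact r.Prime]
  {T : Subgroup G} {x : G}

omit hr [Finite G] in
theorem zpowers_eq_of_mem_of_card_eq {W : Subgroup G} (hW : Nat.card W = q) {w : G} (hw : w ∈ W)
    (hw1 : w ≠ 1) : Subgroup.zpowers w = W := by
  have : Finite W := Nat.finite_of_card_ne_zero (hW ▸ hq.out.ne_zero)
  refine Subgroup.eq_of_le_of_card_ge (Subgroup.zpowers_le.2 hw) ?_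
  rw [Nat.card_zpowers, hW]
  have hd : orderOf w ∣ q := by
    rw [← hW, ← Subgroup.orderOf_mk w hw]
    exact orderOf_dvd_natCard _
  exact (((Nat.dvd_prime hq.out).1 hd).resolve_left (by rwa [orderOf_eq_one_iff])).ge

omit hr [Finite G] in
theorem mem_centralizer_of_commute {W : Subgroup G} (hW : Nat.card W = q) {w : G} (hw : w ∈ W)
    (hw1 : w ≠ 1) (h : Commute x w) : x ∈ Subgroup.centralizer (W : Set G) := by
  rw [← zpowers_eq_of_mem_of_card_eq hW hw hw1, Subgroup.mem_centralizer_iff]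
  rintro _ ⟨k, rfl⟩
  exact (h.zpow_right k).eq.symm

omit [Finite G] in
/-- An involution acting nontrivially on a `q`-group with `q` odd inverts a subgroup of order `q`. -/
theorem exists_inverted_subgroup (hq2 : q ≠ 2) (hx : orderOf x = 2) (hT : IsPGroup q T)
    (hxT : x ∈ Subgroup.normalizer (T : Set G)) (hxC : x ∉ Subgroup.centralizer (T : Set G)) :
    ∃ W : Subgroup G, Nat.card W = q ∧ x ∈ Subgroup.normalizer (W : Set G) ∧
      x ∉ Subgroup.centralizer (W : Set G) := by
  suffices ∃ w, orderOf w = q ∧ x * w * x⁻¹ = w⁻¹ by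
    obtain ⟨w, hw, hxw⟩ := this
    refine ⟨Subgroup.zpowers w, by rw [Nat.card_zpowers, hw], conj_smul_eq_iff.1 ?_, fun hc => ?_⟩
    · rw [conj_smul_zpowers, hxw, Subgroup.zpowers_inv]
    · have hwx := hc w (Subgroup.mem_zpowers w)
      rw [← hwx, mul_inv_cancel_right, eq_inv_iff_mul_eq_one, ← pow_two] at hxw
      have := Nat.le_of_dvd two_pos (hw ▸ orderOf_dvd_of_pow_eq_one hxw)
      have := hq.out.two_le
      omega
  replace hx : x * x = 1 := by rw [← pow_two, ← hx, pow_orderOf_eq_one]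
  obtain ⟨v, hv, hne⟩ : ∃ v ∈ T, v * x ≠ x * v := by
    simpa [Subgroup.mem_centralizer_iff] using hxC
  have hxi : x⁻¹ = x := inv_eq_of_mul_eq_one_left hx
  set u := x * v * x⁻¹ * v⁻¹
  have hu : u ∈ T := mul_mem ((Subgroup.mem_normalizer_iff.1 hxT v).1 hv) (inv_mem hv)
  have hu1 : u ≠ 1 := fun h => hne (by
    rw [mul_inv_eq_one, mul_inv_eq_iff_eq_mul] at h
    exact h.symm)
  have hux : x * u * x⁻¹ = u⁻¹ := by
    have : x * u = v * x * v⁻¹ := by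
      simp only [u, hxi, ← mul_assoc, hx, one_mul]
    rw [this]
    simp [u, mul_assoc, hxi]
  obtain ⟨m, hm⟩ := IsPGroup.iff_orderOf.1 hT ⟨u, hu⟩
  rw [Subgroup.orderOf_mk] at hm
  have hm0 : m ≠ 0 := by
    rintro rfl
    exact hu1 (orderOf_eq_one_iff.1 (by rw [hm, pow_zero]))
  refine ⟨u ^ q ^ (m - 1), ?_, ?_⟩
  · rw [orderOf_pow_of_dvd (pow_ne_zero _ hq.out.ne_zero) (hm ▸ pow_dvd_pow q (Nat.sub_le m 1)), hm,
      Nat.pow_div (Nat.sub_le m 1) hq.out.pos, Nat.sub_sub_self (Nat.one_le_iff_ne_zero.2 hm0),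
      pow_one]
  · rw [← conj_pow, hux, inv_pow]

omit [Finite G] in
/-- If `T` is abelian, the commutators `[x, v]` with `v ∈ T` form a subgroup. -/
theorem exists_commutator_subgroup [IsMulCommutative T]
    (hxT : x ∈ Subgroup.normalizer (T : Set G)) :
    ∃ W ≤ T, (∀ w, w ∈ W ↔ ∃ v ∈ T, w = x * v * x⁻¹ * v⁻¹) ∧
      Nat.card W = ((Subgroup.centralizer {x}).subgroupOf T).index := by
  have hcomm : ∀ a ∈ T, ∀ b ∈ T, a * b = b * a := fun a ha b hb => by
    have := mul_comm' (⟨a, ha⟩ : T) ⟨b, hb⟩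
    exact congrArg Subtype.val this
  have hmem : ∀ v ∈ T, x * v * x⁻¹ ∈ T := fun v hv => (Subgroup.mem_normalizer_iff.1 hxT v).1 hv
  let φ : T →* G := MonoidHom.mk' (fun v => x * v * x⁻¹ * (v : G)⁻¹) fun v w => by
    have h1 := hcomm _ (hmem w w.2) _ (inv_mem v.2)
    have h2 := hcomm _ (inv_mem w.2) _ (inv_mem v.2)
    rw [Subgroup.coe_mul, mul_inv_rev, h2]
    calc _ = x * v * x⁻¹ * (x * w * x⁻¹ * (v : G)⁻¹) * (w : G)⁻¹ := by group
      _ = _ := by rw [h1]; group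
  have hφ : ∀ v, φ v = x * v * x⁻¹ * (v : G)⁻¹ := fun _ => rfl
  refine ⟨φ.range, ?_, fun w => ?_, ?_⟩
  · rintro _ ⟨v, rfl⟩
    exact mul_mem (hmem v v.2) (inv_mem v.2)
  · constructor
    · rintro ⟨v, rfl⟩
      exact ⟨v, v.2, rfl⟩
    · rintro ⟨v, hv, rfl⟩
      exact ⟨⟨v, hv⟩, rfl⟩
  · rw [← Subgroup.index_ker]
    congr 1
    ext v
    rw [MonoidHom.mem_ker, hφ, Subgroup.mem_subgroupOf, Subgroup.mem_centralizer_singleton_iff,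
      mul_inv_eq_one, mul_inv_eq_iff_eq_mul, eq_comm]

variable [IsSimpleGroup G] (hns : ¬ Group.IsSolvable G)
  (hmin : ∀ M : Subgroup G, M ≠ ⊤ → Group.IsSolvable M)
include hns hmin

theorem IsSingleClass.dvd_card_cls (h : IsSingleClass q r T x) (hrq : r < q) :
    q ∣ Nat.card (cls x) := by
  have hmod := ncard_inter_fixed_modEq (X := cls x) h.minimalGood.isPGroup (S := Set.univ)
    fun _ _ _ _ => Set.mem_univ _
  rw [Set.univ_inter, Set.ncard_univ] at hmod
  refine (Nat.modEq_zero_iff_dvd).1 (hmod.symm.trans ?_)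
  have : {s : cls x | ∀ g ∈ T, g • s = s} = ∅ := by
    refine Set.eq_empty_iff_forall_notMem.2 fun D hD => ?_
    exact h.not_le_normalizer hns hmin hrq h.minimalGood.isPGroup h.mem_normalizer
      h.not_mem_centralizer D.2 fun t ht => mem_fixedBy_cls.1 (hD t ht)
  rw [this, Set.ncard_empty]

theorem IsSingleClass.ncard_fixedBy_mul_le (h : IsSingleClass q r T x) (hrq : r < q)
    {W : Subgroup G} (hW : Nat.card W = q) (hxW : x ∈ Subgroup.normalizer (W : Set G))
    (hxC : x ∉ Subgroup.centralizer (W : Set G)) :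
    (fixedBy (cls x) x).ncard * q ≤ Nat.card (cls x) := by
  rw [← hW]
  refine ncard_fixedBy_mul_card_le (fun w hw => (Subgroup.mem_normalizer_iff.1 hxW w).1 hw)
    (fun w hw hc => by_contra fun hw1 => hxC (mem_centralizer_of_commute hW hw hw1 hc))
    fun w hw D _ hwD => by_contra fun hw1 => ?_
  refine h.not_le_normalizer hns hmin hrq (.of_card (n := 1) (by rw [hW, pow_one])) hxW hxC D.2 ?_
  rw [← zpowers_eq_of_mem_of_card_eq hW hw hw1, Subgroup.zpowers_le]
  exact mem_fixedBy_cls.1 hwD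

theorem IsSingleClass.not_dvd_card_normalizer_of_isPGroup (h : IsSingleClass q r T x)
    {W : Subgroup G} (hW : IsPGroup q W) (hb : W ≠ ⊥) {s k : ℕ} (hs : s.Prime) (hsq : s < q)
    (hk : k ≠ 0) (hsr : s ^ k ≠ r) : ¬ s ^ k ∣ Nat.card (Subgroup.normalizer (W : Set G)) := by
  intro hd
  have := Fact.mk hs
  obtain ⟨A, hA⟩ := Sylow.exists_subgroup_card_pow_prime s hd
  have hcard : Nat.card (A.map (Subgroup.subtype _)) = s ^ k := by
    rw [Subgroup.card_map_of_injective (Subgroup.subtype_injective _), hA]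
  have hAb : A.map (Subgroup.subtype _) ≠ ⊥ := by
    intro hb
    rw [hb, Subgroup.card_bot, eq_comm, Nat.pow_eq_one] at hcard
    exact hcard.elim hs.one_lt.ne' hk
  exact hsq.not_ge ((h.isMinimalGood hW hb).le_of_le_normalizer hns hmin hs (.of_card hcard) hAb
    (h.good_of_card_ne hAb (by rwa [hcard])) (Subgroup.map_subtype_le _))

omit hmin in
theorem IsSingleClass.false_of_seven_two {T : Subgroup G} {x : G} [Fact (Nat.Prime 7)]
    (h : IsSingleClass 7 2 T x) {M : Subgroup G} (hM : M.index = 7) : False := by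
  obtain ⟨W, hW, hxW, hxC⟩ := exists_inverted_subgroup (by norm_num) h.orderOf_eq
    h.minimalGood.isPGroup h.mem_normalizer h.not_mem_centralizer
  have hcard : Nat.card (G ⧸ M) = 7 := hM
  have : Nontrivial (G ⧸ M) := Finite.one_lt_card_iff_nontrivial.1 (by omega)
  have hle := ncard_fixedBy_mul_card_le (X := G ⧸ M) (x := x) (W := W)
    (fun y hy => (Subgroup.mem_normalizer_iff.1 hxW y).1 hy)
    (fun y hy hc => by_contra fun hy1 => hxC (mem_centralizer_of_commute hW hy hy1 hc))
    (fun y hy s _ hs => by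
      by_contra hy1
      have hy7 : orderOf y = 7 ^ 1 := by
        rw [← Nat.card_zpowers, zpowers_eq_of_mem_of_card_eq hW hy hy1, hW, pow_one]
      have hmod := ncard_fixedBy_modEq (X := G ⧸ M) hy7
      have hlt := ncard_fixedBy_lt (X := G ⧸ M) hy1
      have hpos : 0 < (fixedBy (G ⧸ M) y).ncard := (Set.ncard_pos (Set.toFinite _)).2 ⟨s, hs⟩
      rw [hcard] at hmod hlt
      rw [Nat.ModEq, Nat.mod_self, Nat.mod_eq_of_lt hlt] at hmod
      omega)
  have h4 := four_dvd_ncard_compl_fixedBy (X := G ⧸ M) hns h.orderOf_eq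
  have := Set.ncard_add_ncard_compl (fixedBy (G ⧸ M) x)
  rw [hW, hcard] at hle
  omega

theorem IsSingleClass.false_of_seven_three {T : Subgroup G} {x : G} [h7 : Fact (Nat.Prime 7)]
    [h3 : Fact (Nat.Prime 3)] (hidx : ∀ K : Subgroup G, K ≠ ⊤ → 7 ≤ K.index)
    (h : IsSingleClass 7 3 T x) (hn : Nat.card (cls x) = 14) : False := by
  have hx := h.orderOf_eq
  have hT7 := h.minimalGood.isPGroup
  have hdvd14 := two_mul_card_dvd_of_index hns ((card_orbit_conj _).symm.trans hn) (by norm_num)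
  have hTc : ∃ j, Nat.card T = 7 ^ j ∧ j ≤ 2 := by
    obtain ⟨j, hj⟩ := IsPGroup.iff_card.1 hT7
    refine ⟨j, hj, ?_⟩
    by_contra! hj2
    have : 7 ^ 3 ∣ Nat.factorial 14 := (pow_dvd_pow 7 hj2).trans
      (hj ▸ (T.card_subgroup_dvd_card.trans (Dvd.intro_left 2 rfl)).trans hdvd14)
    exact absurd this (by decide)
  have hTcomm : IsMulCommutative T := by
    obtain ⟨j, hj, hj2⟩ := hTc
    interval_cases j
    · exact absurd (Subgroup.card_eq_one.1 hj) h.minimalGood.ne_bot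
    · exact isMulCommutative_of_card_eq_prime (p := 7) (by simpa using hj)
    · exact IsPGroup.isMulCommutative_of_card_eq_prime_sq hj
  have hT : ∀ v ∈ T, v ∈ Subgroup.normalizer (Subgroup.zpowers x : Set G) → Commute v x := by
    intro v hv hn
    obtain ⟨k, hk⟩ := IsPGroup.iff_orderOf.1 hT7 ⟨v, hv⟩
    rw [Subgroup.orderOf_mk] at hk
    exact commute_of_card_lt hk (by rw [Nat.card_zpowers, hx]; norm_num) hn x
      (Subgroup.mem_zpowers x)
  have hW : ∃ W : Subgroup G, Nat.card W = 7 ∧ x ∈ Subgroup.normalizer (W : Set G) ∧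
      x ∉ Subgroup.centralizer (W : Set G) := by
    obtain ⟨W, hWT, hW, hWc⟩ := exists_commutator_subgroup h.mem_normalizer
    have hW7 : Nat.card W = 7 := by
      obtain ⟨k, hk, hk0, -, hlt⟩ := exists_card_orbit hns (by norm_num) hx hT7 h.mem_normalizer
        h.not_mem_centralizer
      rw [hn] at hlt
      have hk1 : k = 1 := by
        by_contra hk1
        have := Nat.pow_le_pow_right (n := 7) (by norm_num) (show 2 ≤ k by omega)
        omega
      rw [hk1, pow_one, ← index_stabilizer] at hk
      rw [hWc, ← hk]
      congr 1
      ext v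
      rw [Subgroup.mem_subgroupOf, Subgroup.mem_centralizer_singleton_iff, mem_stabilizer_iff]
      change _ ↔ _ ∈ fixedBy (cls x) (v : G)
      rw [mem_fixedBy_cls]
      exact ⟨fun hc => mem_normalizer_zpowers_of_commute hc, fun hn => hT v v.2 hn⟩
    refine ⟨W, hW7, ?_, fun hC => ?_⟩
    · refine Subgroup.mem_normalizer_fintype fun w hw => ?_
      obtain ⟨v, hv, rfl⟩ := (hW w).1 hw
      exact (hW _).2 ⟨_, (Subgroup.mem_normalizer_iff.1 h.mem_normalizer v).1 hv, by group⟩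
    · obtain ⟨w, hw⟩ := exists_prime_orderOf_dvd_card' (G := W) 7 hW7.symm.dvd
      obtain ⟨v, hv, hwv⟩ := (hW w).1 w.2
      have hxw : (w : G) * x = x * w := hC w w.2
      have hx3 : x ^ 3 = 1 := by rw [← hx, pow_orderOf_eq_one]
      have hconj : ∀ k : ℕ, x ^ k * v = (w : G) ^ k * v * x ^ k := by
        intro k
        induction k with
        | zero => simp
        | succ k ih =>
          have hc : (w : G) ^ k * x = x * (w : G) ^ k := Commute.pow_left hxw k
          have hv : x * v = w * v * x := by rw [hwv]; group
          calc x ^ (k + 1) * v = x * (x ^ k * v) := by rw [pow_succ', mul_assoc]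
            _ = x * (w : G) ^ k * v * x ^ k := by rw [ih]; simp only [mul_assoc]
            _ = (w : G) ^ k * (x * v) * x ^ k := by rw [← hc]; simp only [mul_assoc]
            _ = _ := by rw [hv, pow_succ, pow_succ' x]; simp only [mul_assoc]
      have hw3 : (w : G) ^ 3 = 1 := by simpa [hx3] using hconj 3
      have := orderOf_dvd_of_pow_eq_one hw3
      rw [Subgroup.orderOf_coe, hw] at this
      exact absurd this (by norm_num)
  obtain ⟨W, hW7, hxW, hxC⟩ := hW
  have hle := h.ncard_fixedBy_mul_le hns hmin (by norm_num) hW7 hxW hxC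
  obtain ⟨h1, hlt, -, h3, -, hf⟩ := h.ncard_fixedBy hns hidx
  have hndvd := not_dvd_card_normalizer (p := 7) hns hx
  have hcard := card_cls_mul x
  rw [hn] at hle hlt h3 hndvd hcard
  have hf2 : (fixedBy (cls x) x).ncard = 2 := by omega
  rw [hf2] at hndvd
  obtain ⟨-, -, M, hM⟩ := (hf (by omega)).resolve_left (by omega)
  replace hndvd := hndvd (by norm_num) (by norm_num) (by norm_num)
  have hc2520 : 14 * Nat.card (Subgroup.normalizer (Subgroup.zpowers x : Set G)) ∣ 14 * 180 := by
    have := two_mul_card_dvd_of_index hns hM (by norm_num)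
    rw [← hcard] at this
    exact Nat.dvd_of_mul_dvd_mul_left two_pos this
  replace hc2520 := Nat.dvd_of_mul_dvd_mul_left (by norm_num) hc2520
  have h5 : ¬ 5 ∣ Nat.card (Subgroup.normalizer (Subgroup.zpowers x : Set G)) :=
    not_dvd_card_normalizer (hp := ⟨Nat.prime_five⟩) hns hx (by norm_num) (by omega) (by omega)
  have h9 : 9 ∣ Nat.card (Subgroup.normalizer (Subgroup.zpowers x : Set G)) := by
    obtain ⟨D, hD, hne⟩ := Set.exists_ne_of_one_lt_ncard (by omega : 1 < (fixedBy (cls x) x).ncard)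
      ⟨_, mem_orbit_self _⟩
    have hxD := mem_fixedBy_cls.1 hD
    have hcom := commute_of_mem_normalizer_cls hx (hx.trans (pow_one 3).symm) D.2 hxD
    have hDN : D.1 ≤ Subgroup.normalizer (Subgroup.zpowers x : Set G) := fun d hd =>
      mem_normalizer_zpowers_of_commute (hcom d hd).symm
    have hD3 := card_of_mem_cls hx D.2
    have hE := (isPGroup_zpowers hx).to_sup_of_normal_left'
      (IsPGroup.of_card (n := 1) (by rw [hD3, pow_one])) hDN
    obtain ⟨j, hj⟩ := IsPGroup.iff_card.1 hE
    have hj2 : 2 ≤ j := by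
      by_contra! hj2
      have hle := Nat.pow_le_pow_right (n := 3) (by norm_num) (Nat.le_of_lt_succ hj2)
      have h1 := Subgroup.eq_of_le_of_card_ge (le_sup_left : Subgroup.zpowers x ≤ _ ⊔ D.1)
        (by rw [hj, Nat.card_zpowers, hx]; omega)
      refine hne (Subtype.ext (Subgroup.eq_of_le_of_card_ge (le_sup_right.trans h1.ge) ?_))
      rw [hD3, Nat.card_zpowers, hx]
    exact (pow_dvd_pow 3 hj2).trans
      (hj ▸ Subgroup.card_dvd_of_le (sup_le Subgroup.le_normalizer hDN))
  obtain ⟨P, hTP⟩ := hT7.exists_le_sylow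
  have h7G : 7 ∣ Nat.card G := by rw [← hcard]; omega
  have hP : Nat.card P = 7 := by
    obtain ⟨j, hj⟩ := IsPGroup.iff_card.1 P.2
    have hj1 : j ≤ 1 := by
      by_contra! hj1
      have h49 : 7 ^ 2 ∣ 14 * Nat.card (Subgroup.normalizer (Subgroup.zpowers x : Set G)) := by
        rw [hcard]
        exact (pow_dvd_pow 7 hj1).trans (hj ▸ P.card_subgroup_dvd_card)
      omega
    have hj0 : j ≠ 0 := by
      rintro rfl
      exact sylow_ne_bot P h7G (Subgroup.card_eq_one.1 hj)
    rw [show j = 1 by omega, pow_one] at hj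
    exact hj
  have hTP' : T = P := by
    refine Subgroup.eq_of_le_of_card_ge hTP ?_
    rw [hP]
    obtain ⟨j, hj, -⟩ := hTc
    have hj0 : j ≠ 0 := by
      rintro rfl
      exact h.minimalGood.ne_bot (Subgroup.card_eq_one.1 hj)
    rw [hj]
    exact Nat.le_self_pow hj0 7
  have h3m : 3 ∣ Nat.card (Subgroup.normalizer (T : Set G)) := by
    rw [← hx, ← Nat.card_zpowers]
    exact Subgroup.card_dvd_of_le (Subgroup.zpowers_le.2 h.mem_normalizer)
  have h9m := h.not_dvd_card_normalizer_of_isPGroup hns hmin hT7 h.minimalGood.ne_bot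
    Nat.prime_three (by norm_num) two_ne_zero (by norm_num)
  obtain ⟨n, m, -, hm, hnm, hn7, hn5, hPm, -⟩ := sylow_numbers hns P h7G
  rw [hTP'] at h3m h9m
  replace h3m : 3 ∣ m := hm ▸ h3m
  replace h9m : ¬ 9 ∣ m := hm ▸ h9m
  rw [hP] at hPm
  rw [← hcard] at hnm
  generalize Nat.card (Subgroup.normalizer (Subgroup.zpowers x : Set G)) = k at *
  obtain ⟨k', rfl⟩ := h9
  obtain ⟨m', rfl⟩ := Nat.Coprime.mul_dvd_of_dvd_of_dvd (by norm_num) h3m hPm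
  have hk : k' ∣ 20 := Nat.dvd_of_mul_dvd_mul_left (by norm_num : 0 < 9) hc2520
  have hk20 := Nat.le_of_dvd (by norm_num) hk
  have hnm' : n * m' = 6 * k' := by
    refine Nat.eq_of_mul_eq_mul_left (by norm_num : 0 < 21) ?_
    linarith
  have hk4 : k' ≤ 4 := by
    by_contra! hk4
    interval_cases k' <;> omega
  have hnk : n ∣ 6 * k' := Dvd.intro _ hnm'
  have hn24 := Nat.le_of_dvd (by omega) hnk
  have hn8 : n = 8 ∨ n = 15 ∨ n = 22 := by omega
  obtain rfl | rfl | rfl := hn8 <;> omega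

end SingleClass

end ChainLength

namespace ChainLength

open scoped Pointwise
open MulAction

section Sylow

variable {G : Type*} [Group G] [Finite G]

theorem card_sylow_of_card_eq {p i m : ℕ} [hp : Fact p.Prime] (P : Sylow p G)
    (h : Nat.card G = p ^ i * m) (hm : ¬ p ∣ m) : Nat.card P = p ^ i ∧ P.index = m := by
  obtain ⟨j, hj⟩ := IsPGroup.iff_card.1 P.2
  have hmul := P.card_mul_index
  rw [h, hj] at hmul
  have hc : ∀ n m, ¬ p ∣ m → Nat.Coprime (p ^ n) m := fun n m h =>
    ((Nat.Prime.coprime_iff_not_dvd hp.out).2 h).pow_left n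
  have h1 : p ^ j ∣ p ^ i := (hc j m hm).dvd_of_dvd_mul_right (Dvd.intro _ hmul)
  have h2 : p ^ i ∣ p ^ j := (hc i _ P.not_dvd_index).dvd_of_dvd_mul_right (Dvd.intro _ hmul.symm)
  have h3 := Nat.dvd_antisymm h1 h2
  refine ⟨hj.trans h3, ?_⟩
  rw [h3] at hmul
  exact Nat.eq_of_mul_eq_mul_left (pow_pos hp.out.pos i) hmul

theorem card_dvd_ncard_of_free {P X : Type*} [Group P] [Finite P] [MulAction P X] [Finite X]
    {S : Set X} (hS : ∀ g : P, ∀ s ∈ S, g • s ∈ S) (hfree : ∀ g : P, ∀ s ∈ S, g • s = s → g = 1) :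
    Nat.card P ∣ S.ncard := by
  let Y : SubMulAction P X := ⟨S, fun g s hs => hS g s hs⟩
  have hstab : ∀ y : Y, stabilizer P y = ⊥ := fun y => by
    rw [eq_bot_iff]
    intro g hg
    exact hfree g y y.2 (congrArg Subtype.val hg)
  have hcard := Nat.card_congr (selfEquivSigmaOrbitsQuotientStabilizer P Y)
  have := Fintype.ofFinite (Quotient (orbitRel P Y))
  rw [Nat.card_sigma] at hcard
  have hY : Nat.card Y = S.ncard := Nat.card_coe_set_eq S
  rw [← hY, hcard]
  refine Finset.dvd_sum fun ω _ => ?_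
  rw [hstab, ← Subgroup.index_eq_card, Subgroup.index_bot]

/-- A finite group whose Sylow subgroups all intersect trivially. -/
theorem card_dvd_card_sylow_sub_one {p : ℕ} [hp : Fact p.Prime]
    (hTI : ∀ P R : Sylow p G, (P : Subgroup G) ⊓ R ≠ ⊥ → P = R) (P : Sylow p G) :
    Nat.card P ∣ (Subgroup.normalizer (P : Set G)).index - 1 := by
  have h := card_dvd_ncard_of_free (P := P) (S := ({P}ᶜ : Set (Sylow p G))) (fun g R hR hgR => hR ?_)
    fun g R hR hgR => ?_
  · rwa [Set.ncard_compl, Set.ncard_singleton, P.card_eq_index_normalizer] at h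
  · have hgP : g • P = P :=
      Sylow.smul_eq_iff_mem_normalizer.2 (Subgroup.le_normalizer g.2)
    exact smul_left_cancel g ((Set.mem_singleton_iff.1 hgR).trans hgP.symm)
  · have hgN : (g : G) ∈ (P : Subgroup G) ⊓ Subgroup.normalizer (R : Set G) :=
      ⟨g.2, Sylow.smul_eq_iff_mem_normalizer.1 hgR⟩
    have hbot : (P : Subgroup G) ⊓ R = ⊥ := by
      by_contra hne
      exact hR (hTI P R hne).symm
    rw [P.2.inf_normalizer_sylow, hbot, Subgroup.mem_bot] at hgN
    exact Subtype.ext hgN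

theorem exists_isPGroup_le_of_card {N : Subgroup G} {p : ℕ} [hp : Fact p.Prime] {a b : ℕ}
    (hpa : ¬ p ∣ a) (ha : a ≤ 2) (hN : Nat.card N = p ^ b * a) :
    ∃ E : Subgroup G, IsPGroup p E ∧ ∀ A ≤ N, IsPGroup p A → A ≤ E := by
  let S : Sylow p N := default
  obtain ⟨-, hS⟩ := card_sylow_of_card_eq S hN hpa
  have hnormal : (S : Subgroup N).Normal := by
    interval_cases a
    · exact absurd (dvd_zero p) hpa
    · rw [Subgroup.index_eq_one.1 hS]
      infer_instance
    · exact Subgroup.normal_of_index_eq_two hS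
  refine ⟨(S : Subgroup N).map N.subtype, S.2.map _, fun A hA hAp => ?_⟩
  obtain ⟨R, hR⟩ := IsPGroup.exists_le_sylow (hAp.of_equiv (Subgroup.subgroupOfEquivOfLe hA).symm)
  have := Sylow.unique_of_normal S hnormal
  rw [← Subgroup.map_subgroupOf_eq_of_le hA, Subsingleton.elim S R]
  exact Subgroup.map_mono hR

/-- If all `p`-subgroups of the normalizer of a nontrivial `p`-subgroup generate a `p`-group, then
distinct Sylow subgroups intersect trivially. -/
theorem sylow_eq_of_inf_ne_bot {p : ℕ} [hp : Fact p.Prime]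
    (h : ∀ D : Subgroup G, IsPGroup p D → D ≠ ⊥ → ∃ E : Subgroup G, IsPGroup p E ∧
      ∀ A ≤ Subgroup.normalizer (D : Set G), IsPGroup p A → A ≤ E)
    (P R : Sylow p G) (hPR : (P : Subgroup G) ⊓ R ≠ ⊥) : P = R := by
  induction hn : Nat.card G - Nat.card ((P : Subgroup G) ⊓ R : Subgroup G)
    using Nat.strong_induction_on generalizing P R with
  | _ n ih =>
  subst hn
  by_contra hne
  set D := (P : Subgroup G) ⊓ R
  have hDp : IsPGroup p D := P.2.to_le inf_le_left
  obtain ⟨E, hE, hle⟩ := h D hDp hPR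
  obtain ⟨U, hEU⟩ := hE.exists_le_sylow
  have key : ∀ S : Sylow p G, D < S → S = U := by
    intro S hDS
    have hlt : D < (S : Subgroup G) ⊓ U := (lt_inf_normalizer S.2 hDS).trans_le
      (le_inf inf_le_left ((hle _ inf_le_right (S.2.to_le inf_le_left)).trans hEU))
    have hc : Nat.card D < Nat.card ((S : Subgroup G) ⊓ U : Subgroup G) :=
      Set.ncard_lt_ncard hlt
    have hcG : Nat.card ((S : Subgroup G) ⊓ U : Subgroup G) ≤ Nat.card G := Subgroup.card_le_card_group _
    exact ih _ (by omega) S U (fun hb => by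
      rw [hb] at hlt
      exact not_lt_bot hlt) rfl
  have hDP : D < P := inf_le_left.lt_of_ne fun hD => hne
    (Sylow.ext (P.3 R.2 (inf_eq_left.1 hD)).symm)
  have hDR : D < R := inf_le_right.lt_of_ne fun hD => hne
    (Sylow.ext (R.3 P.2 (inf_eq_right.1 hD)))
  exact hne ((key P hDP).trans (key R hDR).symm)

end Sylow

theorem exists_two_pow_three_pow {n : ℕ} (hn : n ≠ 0)
    (h : ∀ p, p.Prime → 5 ≤ p → ¬ p ∣ n) : ∃ i j, n = 2 ^ i * 3 ^ j := by
  obtain ⟨i, m, h2, rfl⟩ := Nat.exists_eq_pow_mul_and_not_dvd hn 2 (by norm_num)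
  obtain ⟨j, l, h3, rfl⟩ := Nat.exists_eq_pow_mul_and_not_dvd (n := m) (by rintro rfl; simp at h2) 3
    (by norm_num)
  refine ⟨i, j, ?_⟩
  suffices l = 1 by rw [this, mul_one]
  by_contra hl
  obtain ⟨p, hp, hpl⟩ := Nat.exists_prime_and_dvd hl
  have := hp.two_le
  refine h p hp ?_ (Dvd.dvd.mul_left (Dvd.dvd.mul_left hpl _) _)
  by_contra! h5
  interval_cases p
  · exact h2 (Dvd.dvd.mul_left hpl _)
  · exact h3 hpl
  · exact absurd hp (by norm_num)

section SingleClass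

attribute [local instance] conjAction

variable {G : Type*} [Group G] [Finite G] {q r : ℕ} [hq : Fact q.Prime] [hr : Fact r.Prime]
  {T : Subgroup G} {x : G} [IsSimpleGroup G] (hns : ¬ Group.IsSolvable G)
  (hmin : ∀ M : Subgroup G, M ≠ ⊤ → Group.IsSolvable M)
  (hidx : ∀ K : Subgroup G, K ≠ ⊤ → 7 ≤ K.index)
include hns hmin hidx

theorem IsSingleClass.eq_three_two (h : IsSingleClass q r T x) (hrq : r < q) :
    q = 3 ∧ r = 2 ∧ (Nat.card (cls x) = 9 ∧ (fixedBy (cls x) x).ncard = 1 ∨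
      Nat.card (cls x) = 12 ∧ (fixedBy (cls x) x).ncard = 4) := by
  have hqn := h.dvd_card_cls hns hmin hrq
  have hn15 := h.card_le
  obtain ⟨h1, -, hn8, -, h4, hf⟩ := h.ncard_fixedBy hns hidx
  obtain ⟨k, -, hk0, hk1, hkn⟩ := exists_card_orbit hns h.ne h.orderOf_eq h.minimalGood.isPGroup
    h.mem_normalizer h.not_mem_centralizer
  have hqk : q ≤ q ^ k := Nat.le_self_pow hk0 q
  have hr2 := hr.out.two_le
  have hqp := hq.out
  have hrp := hr.out
  have hq15 : q < 15 := by omega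
  by_cases hr2 : r = 2
  · subst hr2
    obtain ⟨W, hW, hxW, hxC⟩ := exists_inverted_subgroup hrq.ne' h.orderOf_eq
      h.minimalGood.isPGroup h.mem_normalizer h.not_mem_centralizer
    have hle := h.ncard_fixedBy_mul_le hns hmin hrq hW hxW hxC
    replace h4 := h4 rfl
    by_cases h72 : q = 7 ∧ (fixedBy (cls x) x).ncard = 2
    · obtain ⟨rfl, hf2⟩ := h72
      obtain ⟨-, -, M, hM⟩ := (hf (by omega)).resolve_left (by omega)
      exact (h.false_of_seven_two hns hM).elim
    interval_cases q <;> omega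
  · have hk2 : q = 5 ∨ q = 7 → k = 1 := by
      intro hq57
      by_contra hk2
      have := Nat.pow_le_pow_right hqp.pos (show 2 ≤ k by omega)
      obtain rfl | rfl := hq57 <;> omega
    by_cases h73 : q = 7 ∧ r = 3
    · obtain ⟨rfl, rfl⟩ := h73
      exact (h.false_of_seven_three hns hmin hidx (by omega)).elim
    have hq57 : q = 5 ∨ q = 7 := by
      interval_cases q <;> first | omega | exact absurd hqp (by norm_num)
    rw [hk2 hq57, pow_one, Nat.ModEq] at hk1
    exfalso
    obtain rfl | rfl := hq57 <;> interval_cases r <;> first | omega | exact absurd hrp (by norm_num)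

/-- No class of involutions is as in `IsSingleClass.eq_three_two`. -/
theorem IsSingleClass.false_of_three_two {T : Subgroup G} {x : G} [h3 : Fact (Nat.Prime 3)]
    [h2 : Fact (Nat.Prime 2)] (h : IsSingleClass 3 2 T x)
    (hnf : Nat.card (cls x) = 9 ∧ (fixedBy (cls x) x).ncard = 1 ∨
      Nat.card (cls x) = 12 ∧ (fixedBy (cls x) x).ncard = 4) : False := by
  obtain ⟨i, j, hG⟩ : ∃ i j, Nat.card G = 2 ^ i * 3 ^ j := by
    refine exists_two_pow_three_pow Nat.card_pos.ne' fun p hp hp5 hpG => ?_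
    have := Fact.mk hp
    rw [← card_cls_mul x, hp.dvd_mul] at hpG
    refine hpG.elim (fun hpn => ?_) (not_dvd_card_normalizer hns h.orderOf_eq (by omega) (by omega)
      (by omega))
    have hn : Nat.card (cls x) ∣ 2 ^ 2 * 3 ^ 2 := by
      obtain ⟨h, -⟩ | ⟨h, -⟩ := hnf <;> rw [h] <;> norm_num
    obtain h | h := (hp.dvd_mul.1 (hpn.trans hn)).imp hp.dvd_of_dvd_pow hp.dvd_of_dvd_pow
    · exact absurd (Nat.le_of_dvd (by norm_num) h) (by omega)
    · exact absurd (Nat.le_of_dvd (by norm_num) h) (by omega)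
  have hTI := sylow_eq_of_inf_ne_bot (G := G) (p := 3) fun D hD hDb => by
    have h4 := h.not_dvd_card_normalizer_of_isPGroup hns hmin hD hDb Nat.prime_two (by norm_num)
      two_ne_zero (by norm_num)
    have hd := (Subgroup.normalizer (D : Set G)).card_subgroup_dvd_card
    rw [hG] at hd
    obtain ⟨a, b, ha, hb, hab⟩ := Nat.dvd_mul.1 hd
    obtain ⟨a, -, rfl⟩ := (Nat.dvd_prime_pow Nat.prime_two).1 ha
    obtain ⟨b, -, rfl⟩ := (Nat.dvd_prime_pow Nat.prime_three).1 hb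
    have ha1 : a ≤ 1 := by
      by_contra! ha1
      exact h4 (hab ▸ (pow_dvd_pow 2 ha1).mul_right _)
    refine exists_isPGroup_le_of_card ?_ (pow_le_pow_right₀ one_le_two ha1) (hab ▸ mul_comm _ _)
    interval_cases a <;> norm_num
  have hc3 : ∀ k, Nat.Coprime 2 (3 ^ k) := fun k => Nat.Coprime.pow_right k (by norm_num)
  have hc2 : ∀ k, Nat.Coprime 3 (2 ^ k) := fun k => Nat.Coprime.pow_right k (by norm_num)
  let Q : Sylow 2 G := default
  let P : Sylow 3 G := default
  obtain ⟨-, hQ⟩ := card_sylow_of_card_eq Q hG (Nat.prime_two.coprime_iff_not_dvd.1 (hc3 j))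
  obtain ⟨hP, hPi⟩ := card_sylow_of_card_eq P (hG.trans (mul_comm _ _))
    (Nat.prime_three.coprime_iff_not_dvd.1 (hc2 i))
  have hj := hidx _ (sylow_ne_top hns Q)
  rw [hQ] at hj
  have hj2 : 2 ≤ j := by
    by_contra! hj2
    interval_cases j <;> omega
  have h3G : 3 ∣ Nat.card G := hG ▸ Dvd.dvd.mul_left (dvd_pow_self 3 (by omega)) _
  obtain ⟨n, m, hn, hm, hnm, -, hn5, -, hnP⟩ := sylow_numbers hns P h3G
  have hsub := card_dvd_card_sylow_sub_one hTI P
  rw [hP] at hsub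
  replace hsub : 3 ^ j ∣ n - 1 := hn ▸ hsub
  rw [hPi, Nat.dvd_prime_pow Nat.prime_two] at hnP
  obtain ⟨e, hei, rfl⟩ := hnP
  have hi : i ≤ 9 := by
    by_contra! hi
    have hdvd : 2 ^ 11 ∣ 2 * Nat.card G :=
      hG ▸ mul_dvd_mul_left 2 ((pow_dvd_pow 2 hi).mul_right _)
    obtain ⟨hn, -⟩ | ⟨hn, -⟩ := hnf
    · exact absurd (hdvd.trans (two_mul_card_dvd_of_index hns ((card_orbit_conj _).symm.trans hn)
        (by norm_num))) (by decide)
    · exact absurd (hdvd.trans (two_mul_card_dvd_of_index hns ((card_orbit_conj _).symm.trans hn)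
        (by norm_num))) (by decide)
  have he : e = 6 := by
    have := (pow_dvd_pow 3 hj2).trans hsub
    have := hei.trans hi
    interval_cases e <;> omega
  subst he
  have hj' : j = 2 := by
    by_contra! hj'
    exact absurd ((pow_dvd_pow 3 (show 3 ≤ j by omega)).trans hsub) (by decide)
  subst hj'
  have hi6 : i = 6 := by
    by_contra! hi6
    have hdvd : 2 ^ 8 ∣ 2 * Nat.card G :=
      hG ▸ mul_dvd_mul_left 2 ((pow_dvd_pow 2 (show 7 ≤ i by omega)).mul_right _)
    exact absurd (hdvd.trans (two_mul_card_dvd_of_index hns hQ (by norm_num))) (by decide)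
  subst hi6
  have := IsPGroup.isMulCommutative_of_card_eq_prime_sq hP
  refine card_normalizer_ne_card hns P h3G ?_
  rw [hP]
  omega

end SingleClass

end ChainLength

namespace ChainLength

open scoped Pointwise
open MulAction

section SingleClass

attribute [local instance] conjAction

theorem eq_two_of_modEq {q r k : ℕ} (hq : q.Prime) (hr : r.Prime) (hqr : q < r) (hk : k ≠ 0)
    (h : q ^ k ≡ 1 [MOD r]) (hlt : q ^ k < 15) : q = 2 ∧ q ^ k = r + 1 ∧ (r = 3 ∨ r = 7) := by
  have hd := (Nat.modEq_iff_dvd' (Nat.one_le_pow _ _ hq.pos)).1 h.symm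
  have hk4 : k < 4 := by
    by_contra! hk4
    have := (Nat.pow_le_pow_left hq.two_le 4).trans (pow_le_pow_right₀ hq.one_lt.le hk4)
    omega
  have hle : q ^ 1 ≤ q ^ k := pow_le_pow_right₀ hq.one_lt.le (Nat.one_le_iff_ne_zero.2 hk)
  rw [pow_one] at hle
  have hq2 := hq.two_le
  have hrle := Nat.le_of_dvd (by omega) hd
  interval_cases k
  · exact absurd rfl hk
  · simp only [pow_one] at hrle
    omega
  · have hq4 : q < 4 := by nlinarith
    interval_cases q
    · interval_cases r
      norm_num
    · interval_cases r <;> revert hd hr <;> norm_num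
  · have hq3 : q < 3 := by
      by_contra! hq3
      have := Nat.pow_le_pow_left hq3 3
      omega
    interval_cases q
    interval_cases r <;> revert hd hr <;> norm_num

variable {G : Type*} [Group G] [Finite G] {q r : ℕ} [hq : Fact q.Prime] [hr : Fact r.Prime]
  {T : Subgroup G} {x : G} [IsSimpleGroup G] (hns : ¬ Group.IsSolvable G)
  (hmin : ∀ M : Subgroup G, M ≠ ⊤ → Group.IsSolvable M)
include hns hmin

theorem IsSingleClass.inf_normalizer_eq_bot (h : IsSingleClass q r T x) (hqr : q < r)
    {W : Subgroup G} (hW : IsPGroup q W) (hxW : x ∈ Subgroup.normalizer (W : Set G))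
    (hxC : x ∉ Subgroup.centralizer (W : Set G)) :
    W ⊓ Subgroup.normalizer (Subgroup.zpowers x : Set G) = ⊥ := by
  by_contra hb
  have hWb : W ≠ ⊥ := fun hWb => hb (by rw [hWb, bot_inf_eq])
  have hH := hW.to_le (inf_le_left (b := Subgroup.normalizer (Subgroup.zpowers x : Set G)))
  exact hxC ((h.isMinimalGood hW hWb).mem_centralizer hns hmin hqr
    (k := 1) (by rw [h.orderOf_eq, pow_one]) hxW hq.out hH hb (h.good_of_isPGroup hH hb)
    (inf_le_left.trans le_sup_left) inf_le_right)

theorem IsSingleClass.card_eq (h : IsSingleClass q r T x) (hqr : q < r)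
    {W : Subgroup G} (hW : IsPGroup q W) (hxW : x ∈ Subgroup.normalizer (W : Set G))
    (hxC : x ∉ Subgroup.centralizer (W : Set G)) :
    q = 2 ∧ Nat.card W = r + 1 ∧ r + 1 < Nat.card (cls x) ∧ (r = 3 ∨ r = 7) := by
  obtain ⟨k, hk, hk0, hmod, hlt⟩ := exists_card_orbit hns h.ne h.orderOf_eq hW hxW hxC
  obtain ⟨hq2, hkr, hr37⟩ := eq_two_of_modEq hq.out hr.out hqr hk0 hmod (hlt.trans_le h.card_le)
  refine ⟨hq2, ?_, hkr ▸ hlt, hr37⟩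
  rw [← hkr, ← hk, ← Nat.card_coe_set_eq, Nat.card_congr (orbitEquivQuotientStabilizer W _),
    ← Subgroup.index_eq_card]
  suffices stabilizer W (⟨_, mem_orbit_self _⟩ : cls x) = ⊥ by rw [this, Subgroup.index_bot]
  refine (Subgroup.eq_bot_iff_forall _).2 fun w hw => Subtype.ext (Subgroup.mem_bot.1 ?_)
  rw [← h.inf_normalizer_eq_bot hns hmin hqr hW hxW hxC]
  exact ⟨w.2, mem_fixedBy_cls.1 (mem_stabilizer_iff.1 hw : (w : G) • _ = _)⟩

theorem IsSingleClass.eq_of_le (h : IsSingleClass q r T x) (hqr : q < r) {S : Subgroup G}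
    (hST : S ≤ T) (hS : S ≠ ⊥) (hxS : x ∈ Subgroup.normalizer (S : Set G)) : S = T := by
  have hxC : x ∉ Subgroup.centralizer (S : Set G) := fun hxC => hS <| by
    rw [← le_bot_iff, ← h.inf_normalizer_eq_bot hns hmin hqr h.minimalGood.isPGroup
      h.mem_normalizer h.not_mem_centralizer]
    exact le_inf hST fun s hs => mem_normalizer_zpowers_of_commute (hxC s hs)
  refine Subgroup.eq_of_le_of_card_ge hST ?_
  rw [(h.card_eq hns hmin hqr (h.minimalGood.isPGroup.to_le hST) hxS hxC).2.1,
    (h.card_eq hns hmin hqr h.minimalGood.isPGroup h.mem_normalizer h.not_mem_centralizer).2.1]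

theorem IsSingleClass.inf_normalizer_eq_zpowers (h : IsSingleClass q r T x) (hqr : q < r) :
    Subgroup.normalizer (Subgroup.zpowers x : Set G) ⊓ Subgroup.normalizer (T : Set G) =
      Subgroup.zpowers x := by
  set U := Subgroup.normalizer (Subgroup.zpowers x : Set G) ⊓ Subgroup.normalizer (T : Set G)
  have hTU := h.inf_normalizer_eq_bot hns hmin hqr h.minimalGood.isPGroup h.mem_normalizer
    h.not_mem_centralizer
  have hXU : Subgroup.zpowers x ≤ U :=
    le_inf Subgroup.le_normalizer (Subgroup.zpowers_le.2 h.mem_normalizer)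
  by_contra hne
  obtain ⟨s, hs, H, hHs, hHb, hHr, hHU⟩ : ∃ s : ℕ, s.Prime ∧ ∃ H : Subgroup G,
      IsPGroup s H ∧ H ≠ ⊥ ∧ Nat.card H ≠ r ∧ H ≤ U := by
    have hcard := card_mul_relIndex hXU
    rw [Nat.card_zpowers, h.orderOf_eq] at hcard
    obtain ⟨s, hs, hsd⟩ := Nat.exists_prime_and_dvd (n := (Subgroup.zpowers x).relIndex U)
      fun h1 => hne (hXU.antisymm' (Subgroup.relIndex_eq_one.1 h1))
    have := Fact.mk hs
    obtain ⟨k, hk, hkr, hkd⟩ : ∃ k, k ≠ 0 ∧ s ^ k ≠ r ∧ s ^ k ∣ Nat.card U := by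
      by_cases hsr : s = r
      · refine ⟨2, two_ne_zero, fun h2 => ?_, ?_⟩
        · rw [hsr] at h2
          have := hr.out.two_le
          nlinarith
        · rw [← hcard, pow_two]
          exact mul_dvd_mul (dvd_of_eq hsr) hsd
      · exact ⟨1, one_ne_zero, by rwa [pow_one], by rw [pow_one, ← hcard]; exact hsd.mul_left r⟩
    obtain ⟨H, hH⟩ := Sylow.exists_subgroup_card_pow_prime s hkd
    have hH' : Nat.card (H.map U.subtype) = s ^ k := by
      rw [← hH]
      exact Nat.card_congr (H.equivMapOfInjective _ U.subtype_injective).symm.toEquiv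
    refine ⟨s, hs, H.map U.subtype, IsPGroup.of_card hH', fun hb => ?_, hH' ▸ hkr,
      Subgroup.map_subtype_le H⟩
    rw [hb, Subgroup.card_bot] at hH'
    exact hk ((Nat.pow_eq_one.1 hH'.symm).resolve_left hs.one_lt.ne')
  have hTn : ¬ T ≤ U := fun hle => h.minimalGood.ne_bot <| by
    rw [← le_bot_iff, ← hTU]
    exact le_inf le_rfl (hle.trans inf_le_left)
  have hUT : U ≤ Subgroup.normalizer (T : Set G) := inf_le_right
  obtain ⟨A, hUA, hA⟩ := exists_covBy_le_of_lt (lt_of_le_of_ne (le_sup_left (a := U) (b := T))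
    fun heq => hTn (le_sup_right.trans heq.ge))
  have hprime := h.minimalGood.prime_relIndex hns hmin hs hHs hHb (h.good_of_card_ne hHb hHr) hHU
    hUA (hA.trans (sup_le hUT Subgroup.le_normalizer))
  have hTA : T ≤ A := by
    refine inf_eq_right.1 (h.eq_of_le hns hmin hqr inf_le_right ?_ ?_)
    · intro hb
      obtain ⟨a, haA, haU⟩ := SetLike.exists_of_lt hUA.lt
      have haUT := hA haA
      rw [← SetLike.mem_coe, Subgroup.coe_mul_of_left_le_normalizer_right _ _ hUT] at haUT
      obtain ⟨u, hu, t, ht, rfl⟩ := haUT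
      have htA : t ∈ A ⊓ T := ⟨by simpa using mul_mem (inv_mem (hUA.le hu)) haA, ht⟩
      rw [hb, Subgroup.mem_bot] at htA
      exact haU (by simpa [htA] using hu)
    · exact Subgroup.inf_normalizer_le_normalizer_inf
        ⟨Subgroup.le_normalizer (hUA.le (hXU (Subgroup.mem_zpowers x))), h.mem_normalizer⟩
  have hUTb : U ⊓ T = ⊥ := by
    rw [← le_bot_iff, ← hTU]
    exact le_inf inf_le_right (inf_le_left.trans inf_le_left)
  have hle1 : Nat.card T ≤ U.relIndex A := by
    rw [← Subgroup.relIndex_bot_left, ← hUTb, Subgroup.inf_relIndex_right]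
    exact Subgroup.relIndex_le_of_le_right hTA hprime.ne_zero
  have hle2 : U.relIndex A ≤ Nat.card T := by
    refine Nat.le_of_mul_le_mul_left ?_ (Nat.card_pos (α := U))
    rw [card_mul_relIndex hUA.le]
    refine (Subgroup.card_le_of_le hA).trans ?_
    refine le_of_eq_of_le (Nat.card_congr (Equiv.setCongr
      (Subgroup.coe_mul_of_left_le_normalizer_right _ _ hUT))) Set.natCard_mul_le
  obtain ⟨-, hT, -, hr37⟩ :=
    h.card_eq hns hmin hqr h.minimalGood.isPGroup h.mem_normalizer h.not_mem_centralizer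
  rw [le_antisymm hle2 hle1, hT] at hprime
  obtain rfl | rfl := hr37 <;> revert hprime <;> norm_num

end SingleClass

end ChainLength

namespace ChainLength

open scoped Pointwise
open MulAction

section SingleClass

attribute [local instance] conjAction

theorem commute_or_conj_eq_inv {G : Type*} [Group G] {p : ℕ} [hp : Fact p.Prime] {y v : G}
    (hy : orderOf y = p) (hv : v ^ 2 = 1)
    (hn : v ∈ Subgroup.normalizer (Subgroup.zpowers y : Set G)) :
    Commute y v ∨ v * y * v⁻¹ = y⁻¹ := by
  refine or_iff_not_imp_right.2 fun hne => ?_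
  set a := v * y * v⁻¹ with ha
  have haP : a ∈ Subgroup.zpowers y :=
    (Subgroup.mem_normalizer_iff.1 hn y).1 (Subgroup.mem_zpowers y)
  have hya : y * a = a * y := by
    obtain ⟨i, hi⟩ := haP
    rw [← hi]
    exact (Commute.refl y).zpow_right i
  have hva : v * a * v⁻¹ = y := by
    calc v * a * v⁻¹ = v ^ 2 * y * (v ^ 2)⁻¹ := by simp only [ha, pow_two, mul_assoc, mul_inv_rev]
      _ = y := by simp [hv]
  have hz1 : y * a ≠ 1 := fun hz => hne (inv_eq_of_mul_eq_one_right hz).symm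
  have hvz : Commute v (y * a) := by
    refine mul_inv_eq_iff_eq_mul.1 ?_
    calc v * (y * a) * v⁻¹ = (v * y * v⁻¹) * (v * a * v⁻¹) := by group
      _ = y * a := by rw [← ha, hva, hya]
  have hz : Subgroup.zpowers (y * a) = Subgroup.zpowers y :=
    zpowers_eq_of_mem_of_card_eq (q := p) (by rw [Nat.card_zpowers, hy])
      (mul_mem (Subgroup.mem_zpowers y) haP) hz1
  obtain ⟨j, hj⟩ : y ∈ Subgroup.zpowers (y * a) := hz ▸ Subgroup.mem_zpowers y
  have := (hvz.zpow_right j).symm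
  rwa [show (y * a) ^ j = y from hj] at this

variable {G : Type*} [Group G] [Finite G] {q r : ℕ} [hq : Fact q.Prime] [hr : Fact r.Prime]
  {T : Subgroup G} {x : G} [IsSimpleGroup G] (hns : ¬ Group.IsSolvable G)
  (hmin : ∀ M : Subgroup G, M ≠ ⊤ → Group.IsSolvable M)
include hns hmin

theorem IsSingleClass.eq_zpowers_of_le (h : IsSingleClass q r T x) (hqr : q < r) {D : Subgroup G}
    (hD : D ∈ cls x) (hxD : x ∈ Subgroup.normalizer (D : Set G))
    (hDT : D ≤ Subgroup.normalizer (T : Set G)) : D = Subgroup.zpowers x := by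
  have hle : D ≤ Subgroup.zpowers x := by
    rw [← h.inf_normalizer_eq_zpowers hns hmin hqr]
    exact le_inf (fun d hd => mem_normalizer_zpowers_of_commute (commute_of_mem_normalizer_cls
      h.orderOf_eq (k := 1) (by rw [h.orderOf_eq, pow_one]) hD hxD d hd).symm) hDT
  refine Subgroup.eq_of_le_of_card_ge hle ?_
  rw [card_of_mem_cls h.orderOf_eq hD, Nat.card_zpowers, h.orderOf_eq]

theorem IsSingleClass.card_normalizer (h : IsSingleClass q r T x) (hqr : q < r) :
    Nat.card (Subgroup.normalizer (T : Set G)) = (r + 1) * r := by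
  set K := Subgroup.normalizer (T : Set G)
  set D₀ : cls x := ⟨_, mem_orbit_self _⟩
  have hx := h.orderOf_eq
  obtain ⟨-, hT, hn, hr37⟩ :=
    h.card_eq hns hmin hqr h.minimalGood.isPGroup h.mem_normalizer h.not_mem_centralizer
  have hstab : Nat.card (stabilizer K D₀) = r := by
    have hmap : (stabilizer K D₀).map K.subtype = Subgroup.zpowers x := by
      refine Eq.trans ?_ (h.inf_normalizer_eq_zpowers hns hmin hqr)
      ext y
      simp only [Subgroup.mem_map, Subgroup.mem_inf]
      refine ⟨?_, fun ⟨hy, hyK⟩ => ⟨⟨y, hyK⟩, ?_, rfl⟩⟩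
      · rintro ⟨k, hk, rfl⟩
        exact ⟨mem_fixedBy_cls.1 (mem_stabilizer_iff.1 hk : (k : G) • D₀ = D₀), k.2⟩
      · exact mem_stabilizer_iff.2 (mem_fixedBy_cls.2 hy : y • D₀ = D₀)
    rw [Nat.card_congr (Subgroup.equivMapOfInjective _ _ K.subtype_injective).toEquiv]
    exact (congrArg (fun A : Subgroup G => Nat.card A) hmap).trans ((Nat.card_zpowers x).trans hx)
  have horb : (orbit K D₀).ncard * r = Nat.card K := by
    rw [← Nat.card_coe_set_eq, ← hstab, ← Nat.card_prod]
    exact Nat.card_congr (orbitProdStabilizerEquivGroup K D₀)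
  have hxK : x ∈ K := h.mem_normalizer
  have hmod := ncard_inter_fixedBy_modEq (k := 1) (by rw [hx, pow_one]) (S := orbit K D₀) (x := x)
    (by
      rintro _ ⟨k, rfl⟩
      exact ⟨⟨x, hxK⟩ * k, mul_smul _ _ _⟩)
  have hfix : orbit K D₀ ∩ fixedBy (cls x) x = {D₀} := by
    refine Set.eq_singleton_iff_unique_mem.2 ⟨⟨mem_orbit_self _, self_mem_fixedBy_cls x⟩, ?_⟩
    rintro D ⟨⟨k, hk⟩, hD⟩
    refine Subtype.ext (h.eq_zpowers_of_le hns hmin hqr D.2 (mem_fixedBy_cls.1 hD) ?_)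
    rw [← hk]
    change (k : G) • Subgroup.zpowers x ≤ K
    rw [conj_smul_zpowers, Subgroup.zpowers_le]
    exact mul_mem (mul_mem k.2 hxK) (inv_mem k.2)
  rw [hfix, Set.ncard_singleton] at hmod
  have hle : (orbit K D₀).ncard ≤ 15 := (Set.ncard_le_card _).trans h.card_le
  have hdvd : r + 1 ∣ (orbit K D₀).ncard := by
    refine Nat.Coprime.dvd_of_dvd_mul_right (n := r) (by simp) ?_
    rw [horb, ← hT]
    exact Subgroup.card_dvd_of_le Subgroup.le_normalizer
  obtain ⟨c, hc⟩ := hdvd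
  rw [← horb]
  rw [hc] at hmod hle ⊢
  congr 1
  have hc15 : c ≤ 4 := by
    obtain rfl | rfl := hr37 <;> omega
  obtain rfl | rfl := hr37 <;> interval_cases c <;> first | rfl | (revert hmod; decide) | omega

theorem IsSingleClass.exists_sylow_eq (h : IsSingleClass q r T x) (hqr : q < r) :
    ∃ S : Sylow q G, (S : Subgroup G) = T := by
  obtain ⟨-, hT, -, hr37⟩ :=
    h.card_eq hns hmin hqr h.minimalGood.isPGroup h.mem_normalizer h.not_mem_centralizer
  obtain ⟨S, hS⟩ := h.minimalGood.isPGroup.exists_le_sylow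
  obtain heq | hlt := hS.eq_or_lt
  · exact ⟨S, heq.symm⟩
  exfalso
  have hTR := lt_inf_normalizer S.2 hlt
  have hR := S.2.to_le (inf_le_left (b := Subgroup.normalizer (T : Set G)))
  obtain ⟨k, hk⟩ := IsPGroup.iff_card.1 hR
  have hd := Subgroup.card_dvd_of_le (inf_le_right (a := (S : Subgroup G))
    (b := Subgroup.normalizer (T : Set G)))
  rw [h.card_normalizer hns hmin hqr, hk] at hd
  have hc : Nat.Coprime (q ^ k) r :=
    Nat.Coprime.pow_left k ((Nat.coprime_primes hq.out hr.out).2 hqr.ne)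
  have hle := Nat.le_of_dvd (Nat.succ_pos r) (hc.dvd_of_dvd_mul_right hd)
  exact hTR.ne (Subgroup.eq_of_le_of_card_ge hTR.le (by rwa [hk, hT]))

theorem IsSingleClass.mul_ncard_fixedBy_le (h : IsSingleClass q r T x) (hqr : q < r) :
    (fixedBy (cls x) x).ncard * (r + 1) ≤ Nat.card (cls x) := by
  have hT := h.card_eq hns hmin hqr h.minimalGood.isPGroup h.mem_normalizer h.not_mem_centralizer
  have hTU := h.inf_normalizer_eq_bot hns hmin hqr h.minimalGood.isPGroup h.mem_normalizer
    h.not_mem_centralizer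
  have hC : ∀ w ∈ T, Commute x w → w = 1 := fun w hw hxw => by
    rw [← Subgroup.mem_bot, ← hTU]
    exact ⟨hw, mem_normalizer_zpowers_of_commute hxw.symm⟩
  have hxT : ∀ w ∈ T, x * w * x⁻¹ ∈ T := fun w hw =>
    (Subgroup.mem_normalizer_iff.1 h.mem_normalizer w).1 hw
  rw [← hT.2.1]
  refine ncard_fixedBy_mul_card_le hxT hC fun v hv D hD hvD => ?_
  by_contra hv1
  have hxD := mem_fixedBy_cls.1 hD
  replace hvD : v ∈ Subgroup.normalizer (D.1 : Set G) := mem_fixedBy_cls.1 hvD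
  have hcomm := commute_of_mem_normalizer_cls h.orderOf_eq (k := 1)
    (by rw [h.orderOf_eq, pow_one]) D.2 hxD
  have hxC : x ∈ Subgroup.centralizer (D.1 : Set G) := fun d hd => (hcomm d hd).symm
  have hTC : T ⊓ Subgroup.centralizer (D.1 : Set G) = T := by
    refine h.eq_of_le hns hmin hqr inf_le_left (fun hb => hv1 (hC v hv ?_)) ?_
    · have hmem : x * v * x⁻¹ * v⁻¹ ∈ T ⊓ Subgroup.centralizer (D.1 : Set G) := by
        refine ⟨T.mul_mem (hxT v hv) (T.inv_mem hv), ?_⟩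
        rw [mul_assoc, mul_assoc, ← mul_assoc v]
        refine Subgroup.mul_mem _ hxC fun d hd => ?_
        have hd' := (Subgroup.mem_normalizer_iff''.1 hvD d).1 hd
        have := (hcomm _ hd').inv_left
        have h2 : v⁻¹ * (d * (v * x⁻¹)) = v⁻¹ * (v * (x⁻¹ * (v⁻¹ * d * v))) := by
          rw [this.eq]
          simp [mul_assoc]
        have h3 := mul_left_cancel h2
        rw [← mul_assoc, h3]
        simp [mul_assoc]
      rw [hb, Subgroup.mem_bot, mul_inv_eq_one, mul_inv_eq_iff_eq_mul] at hmem
      exact hmem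
    · exact Subgroup.inf_normalizer_le_normalizer_inf
        ⟨h.mem_normalizer, Subgroup.le_normalizer hxC⟩
  have hDT : D.1 ≤ Subgroup.centralizer (T : Set G) := fun d hd w hw =>
    ((inf_eq_left.1 hTC hw : _) d hd).symm
  refine h.not_mem_centralizer (hDT ?_)
  rw [h.eq_zpowers_of_le hns hmin hqr D.2 hxD (hDT.trans (Subgroup.centralizer_le_normalizer _))]
  exact Subgroup.mem_zpowers x

theorem IsSingleClass.false_of_seven {T : Subgroup G} {x : G} [h2 : Fact (Nat.Prime 2)]
    [h7 : Fact (Nat.Prime 7)] (hidx : ∀ K : Subgroup G, K ≠ ⊤ → 7 ≤ K.index)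
    (h : IsSingleClass 2 7 T x) : False := by
  obtain ⟨hf1, -, hn7, hdvd, -, -⟩ := h.ncard_fixedBy hns hidx
  have hf := h.mul_ncard_fixedBy_le hns hmin (by norm_num)
  have hn := h.card_le
  obtain ⟨-, hT, hlt, -⟩ := h.card_eq hns hmin (by norm_num) h.minimalGood.isPGroup
    h.mem_normalizer h.not_mem_centralizer
  have hn15 : Nat.card (cls x) = 15 := by omega
  have h8 : 2 ^ 3 ∣ Nat.card (Subgroup.normalizer (Subgroup.zpowers x : Set G)) := by
    refine Nat.Coprime.dvd_of_dvd_mul_left (m := 15) (by norm_num) ?_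
    rw [← hn15, card_cls_mul x, show 2 ^ 3 = Nat.card T from hT.symm]
    exact T.card_subgroup_dvd_card
  obtain ⟨t, ht, hxt⟩ := exists_involution_commute
    (by rw [Nat.card_zpowers, h.orderOf_eq] : Nat.card (Subgroup.zpowers x) = 7) h8 (by norm_num)
  exact false_of_commute_involution_cls hns h.orderOf_eq (by norm_num) ht
    (hxt x (Subgroup.mem_zpowers x)) (by omega) (by omega)

theorem IsSingleClass.sq_eq_one {T : Subgroup G} {x : G} [h2 : Fact (Nat.Prime 2)]
    [h3 : Fact (Nat.Prime 3)] (h : IsSingleClass 2 3 T x) {v : G} (hv : v ∈ T) : v ^ 2 = 1 := by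
  obtain ⟨-, hT, -, -⟩ := h.card_eq hns hmin (by norm_num) h.minimalGood.isPGroup
    h.mem_normalizer h.not_mem_centralizer
  have hcard := Nat.card_zpowers v
  have hd : orderOf v ∣ 2 ^ 2 := by
    rw [← hcard, show 2 ^ 2 = Nat.card T from hT.symm]
    exact Subgroup.card_dvd_of_le (Subgroup.zpowers_le.2 hv)
  obtain ⟨k, hk, hk'⟩ := (Nat.dvd_prime_pow Nat.prime_two).1 hd
  rw [← orderOf_dvd_iff_pow_eq_one, hk']
  by_contra hkd
  have hk1 : 1 < k := by
    by_contra! hk1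
    exact hkd (pow_dvd_pow 2 hk1)
  obtain rfl : k = 2 := by omega
  have hvT : Subgroup.zpowers v = T :=
    Subgroup.eq_of_le_of_card_ge (Subgroup.zpowers_le.2 hv) (by rw [hcard, hT, hk']; norm_num)
  have hv2 : orderOf (v ^ 2) = 2 := by
    rw [orderOf_pow, hk']
    norm_num
  have hv2T : Subgroup.zpowers (v ^ 2) = T := by
    refine h.eq_of_le hns hmin (by norm_num) (Subgroup.zpowers_le.2 (pow_mem hv 2)) ?_ ?_
    · rw [Ne, Subgroup.zpowers_eq_bot]
      intro h1
      rw [h1, orderOf_one] at hv2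
      omega
    · refine conj_smul_eq_iff.1 (Subgroup.eq_of_le_of_card_ge ?_ (card_conj_smul _ _).ge)
      rw [conj_smul_zpowers, Subgroup.zpowers_le, ← conj_pow]
      have hxv := (Subgroup.mem_normalizer_iff.1 h.mem_normalizer v).1 hv
      rw [← hvT] at hxv
      obtain ⟨i, hi⟩ := hxv
      refine ⟨i, ?_⟩
      change (v ^ 2) ^ i = (x * v * x⁻¹) ^ 2
      rw [← hi]
      change (v ^ 2) ^ i = (v ^ i) ^ 2
      rw [← zpow_natCast, ← zpow_natCast, ← zpow_mul, ← zpow_mul, mul_comm]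
  rw [← hv2T, Nat.card_zpowers, hv2] at hT
  omega

/-- The Sylow `2`-subgroups being elementary abelian of order `4`, the normalizer of a subgroup of
prime order `p` cannot have order divisible by `4` if its generators act without fixed points. -/
theorem IsSingleClass.false_of_four_dvd {p : ℕ} [hp : Fact p.Prime] {T : Subgroup G} {x y : G}
    [h2 : Fact (Nat.Prime 2)] [h3 : Fact (Nat.Prime 3)] (h : IsSingleClass 2 3 T x)
    (hy : orderOf y = p) (hp2 : p ≠ 2)
    (h4 : 2 ^ 2 ∣ Nat.card (Subgroup.normalizer (Subgroup.zpowers y : Set G)))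
    (hf : (fixedBy (cls x) y).ncard < 2)
    (hlt : Nat.card (cls x) < (fixedBy (cls x) y).ncard + 4 * p) : False := by
  have := nontrivial_cls hns h.orderOf_eq
  suffices ∃ v : G, v ^ 2 = 1 ∧ v ≠ 1 ∧ Commute y v by
    obtain ⟨v, hv2, hv1, hyv⟩ := this
    exact false_of_commute_involution hns hy (orderOf_eq_prime hv2 hv1) hp2 hyv hf hlt
  by_contra! hno
  obtain ⟨V, hV⟩ := Sylow.exists_subgroup_card_pow_prime 2 h4
  obtain ⟨S, hS⟩ := h.exists_sylow_eq hns hmin (by norm_num)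
  have hinv : ∀ v ∈ V, (v : G) ^ 2 = 1 ∧ (v ≠ 1 → v * y * (v : G)⁻¹ = y⁻¹) := by
    intro v hv
    have hvp : IsPGroup 2 (Subgroup.zpowers (v : G)) := by
      rw [← Subgroup.coe_subtype, ← MonoidHom.map_zpowers]
      exact ((IsPGroup.of_card hV).to_le (Subgroup.zpowers_le.2 hv)).map _
    have hv2 : (v : G) ^ 2 = 1 := by
      obtain ⟨S', hS'⟩ := hvp.exists_le_sylow
      obtain ⟨g, rfl⟩ := exists_smul_eq G S S'
      have hvS := hS' (Subgroup.mem_zpowers (v : G))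
      rw [Sylow.coe_subgroup_smul, hS, Subgroup.mem_pointwise_smul_iff_inv_smul_mem] at hvS
      have := h.sq_eq_one hns hmin hvS
      rwa [← smul_pow', inv_smul_eq_iff, smul_one] at this
    refine ⟨hv2, fun hv1 => ?_⟩
    refine (commute_or_conj_eq_inv hy hv2 v.2).resolve_left (hno v hv2 ?_)
    simpa using hv1
  obtain ⟨v, hv, hv1⟩ := V.bot_or_exists_ne_one.resolve_left fun hb => by
    rw [hb, Subgroup.card_bot] at hV
    omega
  have hvV : Subgroup.zpowers v < V := by
    refine lt_of_le_of_ne (Subgroup.zpowers_le.2 hv) fun heq => ?_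
    have hv2 : v ^ 2 = 1 := Subtype.ext (hinv v hv).1
    rw [← heq, Nat.card_zpowers] at hV
    have := Nat.le_of_dvd two_pos (hV ▸ orderOf_dvd_of_pow_eq_one hv2)
    omega
  obtain ⟨w, hw, hwv⟩ := SetLike.exists_of_lt hvV
  have hw1 : w ≠ 1 := fun hw1 => hwv (hw1 ▸ one_mem _)
  have hvw1 : v * w ≠ 1 := fun hvw1 => hwv (by
    rw [← inv_eq_of_mul_eq_one_right hvw1]
    exact inv_mem (Subgroup.mem_zpowers v))
  refine hno _ (hinv _ (mul_mem hv hw)).1 (fun hc => hvw1 (Subtype.ext hc)) ?_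
  have hwy := (hinv w hw).2 hw1
  have hvy := (hinv v hv).2 hv1
  have : (↑(v * w) : G) * y * (↑(v * w) : G)⁻¹ = y := by
    calc (↑(v * w) : G) * y * (↑(v * w) : G)⁻¹ = v * (w * y * (w : G)⁻¹) * (v : G)⁻¹ := by
          simp [mul_assoc]
      _ = (v * y * (v : G)⁻¹)⁻¹ := by rw [hwy]; simp [mul_assoc]
      _ = y := by rw [hvy, inv_inv]
  exact (mul_inv_eq_iff_eq_mul.1 this).symm

end SingleClass

end ChainLength

namespace ChainLength

open scoped Pointwise
open MulAction

section SingleClass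

attribute [local instance] conjAction

variable {G : Type*} [Group G] [Finite G] [IsSimpleGroup G] (hns : ¬ Group.IsSolvable G)
  (hmin : ∀ M : Subgroup G, M ≠ ⊤ → Group.IsSolvable M)
  (hidx : ∀ K : Subgroup G, K ≠ ⊤ → 7 ≤ K.index)
include hns

theorem not_odd_card_normalizer {p a : ℕ} [hp : Fact p.Prime] (P : Sylow p G)
    (hdvd : p ∣ Nat.card G) (hP : Nat.card P = p) (hpa : p - 1 = 2 ^ a) :
    ¬ Odd (Nat.card (Subgroup.normalizer (P : Set G))) := by
  intro hodd
  refine not_normalizer_le_centralizer hns P hdvd ?_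
  have hd := card_normalizer_dvd hP
  rw [hpa] at hd
  have hd' := (Nat.Coprime.pow_right a hodd.coprime_two_right).dvd_of_dvd_mul_right hd
  exact (Subgroup.eq_of_le_of_card_ge (Subgroup.centralizer_le_normalizer _)
    (Nat.le_of_dvd Nat.card_pos hd')).ge

include hmin hidx

theorem IsSingleClass.false_of_three {T : Subgroup G} {x : G} [h2 : Fact (Nat.Prime 2)]
    [h3 : Fact (Nat.Prime 3)] (h : IsSingleClass 2 3 T x) : False := by
  obtain ⟨hf1, -, hn7, hdvd, -, hf14⟩ := h.ncard_fixedBy hns hidx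
  have hf := h.mul_ncard_fixedBy_le hns hmin (by norm_num)
  have hn := h.card_le
  obtain ⟨-, hT, -, -⟩ := h.card_eq hns hmin (by norm_num) h.minimalGood.isPGroup
    h.mem_normalizer h.not_mem_centralizer
  have hG := card_cls_mul x
  set f := (fixedBy (cls x) x).ncard
  set n := Nat.card (cls x) with hn_def
  set N := Subgroup.normalizer (Subgroup.zpowers x : Set G)
  have hp5 : ∀ p, p.Prime → 5 ≤ p → ¬ p ∣ Nat.card N := fun p hp hp5 => by
    have := Fact.mk hp
    exact not_dvd_card_normalizer hns h.orderOf_eq (by omega) (by omega) (by omega)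
  obtain ⟨i, j, hN⟩ := exists_two_pow_three_pow (Nat.card_pos (α := N)).ne' hp5
  obtain ⟨S, hS⟩ := h.exists_sylow_eq hns hmin (by norm_num)
  have hS4 : Nat.card S = 2 ^ 2 := hS ▸ hT
  have h4 : 2 ^ 2 ∣ Nat.card G := hS4 ▸ (S : Subgroup G).card_subgroup_dvd_card
  have h8 : ¬ 2 ^ 3 ∣ Nat.card G := fun h8 => by
    have := S.pow_dvd_card_of_pow_dvd_card h8
    rw [hS4] at this
    omega
  have hfac := two_mul_card_dvd_of_index hns ((card_orbit_conj (Subgroup.zpowers x)).symm.trans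
    hn_def.symm) (by omega)
  have hf0 : ∀ p [Fact p.Prime], 5 ≤ p → ∀ y : G, orderOf y = p →
      (fixedBy (cls x) y).ncard = 0 := by
    intro p hp hp5' y hy
    rw [Set.ncard_eq_zero, Set.eq_empty_iff_forall_notMem]
    rintro ⟨_, g, rfl⟩ hD
    have hyN : g⁻¹ * y * g ∈ N := by
      refine (mem_fixedBy_cls (D := (⟨_, mem_orbit_self _⟩ : cls x))).1 ?_
      rw [mem_fixedBy, mul_smul, mul_smul, inv_smul_eq_iff]
      exact hD
    refine hp5 p hp.out hp5' ?_
    have := orderOf_conj g⁻¹ y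
    rw [inv_inv, hy] at this
    rw [← this, ← Subgroup.orderOf_mk _ hyN]
    exact orderOf_dvd_natCard _
  have key : ∀ p [Fact p.Prime], 5 ≤ p → n < 4 * p → Nat.card G = p ^ 1 * (2 ^ 2 * 3 ^ j) →
      ∃ u v m, u ≠ 0 ∧ u ≤ 2 ∧ v ≤ j ∧ (p = 5 → u ≠ 2) ∧ m ≠ p ∧
        2 ^ u * 3 ^ v * m = Nat.card G ∧ (2 ^ u * 3 ^ v) % p = 1 ∧ 7 ≤ 2 ^ u * 3 ^ v := by
    intro p hp hp5' hnp hGp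
    let P : Sylow p G := default
    have hpG : p ∣ Nat.card G := hGp ▸ (dvd_pow_self p one_ne_zero).mul_right _
    obtain ⟨hP, hPi⟩ := card_sylow_of_card_eq P hGp fun hd => by
      obtain hd | hd := (hp.out.dvd_mul.1 hd).imp hp.out.dvd_of_dvd_pow hp.out.dvd_of_dvd_pow
      · exact absurd (Nat.le_of_dvd (by norm_num) hd) (by omega)
      · exact absurd (Nat.le_of_dvd (by norm_num) hd) (by omega)
    rw [pow_one] at hP
    obtain ⟨a, m, ha, hm, ham, hmod, ha5, -, haP⟩ := sylow_numbers hns P hpG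
    rw [hPi] at haP
    obtain ⟨a₁, a₂, h₁, h₂, rfl⟩ := Nat.dvd_mul.1 haP
    obtain ⟨u, hu, rfl⟩ := (Nat.dvd_prime_pow Nat.prime_two).1 h₁
    obtain ⟨v, hv, rfl⟩ := (Nat.dvd_prime_pow Nat.prime_three).1 h₂
    have := isMulCommutative_of_card_eq_prime hP
    refine ⟨u, v, m, ?_, hu, hv, ?_, ?_, ham, hmod, ?_⟩
    · rintro rfl
      obtain ⟨y, hy, hy1⟩ := (P : Subgroup G).bot_or_exists_ne_one.resolve_left
        (sylow_ne_bot P hpG)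
      have hPy := zpowers_eq_of_mem_of_card_eq hP hy hy1
      have hyp : orderOf y = p := by rw [← Nat.card_zpowers, hPy, hP]
      have hy0 := hf0 p hp5' y hyp
      refine h.false_of_four_dvd hns hmin hyp (by omega) ?_ (by omega) (by omega)
      rw [hPy]
      have h4m : 2 ^ 2 ∣ m := by
        refine Nat.Coprime.dvd_of_dvd_mul_left (m := 2 ^ 0 * 3 ^ v) ?_ (ham ▸ h4)
        rw [pow_zero, one_mul]
        exact Nat.Coprime.pow 2 v (by norm_num)
      rw [hm] at h4m
      exact h4m
    · rintro rfl rfl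
      refine not_odd_card_normalizer (a := 2) hns P hpG hP rfl (hm ▸ ?_)
      by_contra hodd
      obtain ⟨c, hc⟩ := (Nat.not_odd_iff_even.1 hodd).two_dvd
      exact h8 (ham ▸ ⟨3 ^ v * c, by rw [hc]; ring⟩)
    · rintro rfl
      exact card_normalizer_ne_card hns P hpG (hm.symm.trans hP.symm)
    · rw [ha]
      refine hidx _ fun htop => ?_
      rw [htop, Subgroup.index_top] at ha
      omega
  have hcases : n = 10 ∨ n = 13 ∨ n = 14 ∧ ∃ M : Subgroup G, M.index = 7 := by
    obtain hf1 | ⟨-, hn14, hM⟩ := hf14 (by omega)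
    · omega
    · exact .inr (.inr ⟨hn14, hM⟩)
  have h3G : 3 ^ j ∣ 2 * Nat.card G :=
    ((hN ▸ dvd_mul_left (3 ^ j) (2 ^ i)).trans (hG ▸ dvd_mul_left _ n)).mul_left 2
  have hc4 : Nat.Coprime (2 ^ 2) (3 ^ j) := Nat.Coprime.pow 2 j (by norm_num)
  rw [hN] at hG
  obtain hn | hn | ⟨hn, M, hM⟩ := hcases
  · rw [hn] at hG hfac key
    have hi : i = 1 := by
      obtain _ | _ | i := i
      · exact absurd (hc4.dvd_of_dvd_mul_right (m := 10) (by simpa [← hG] using h4)) (by norm_num)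
      · rfl
      · exact absurd (hG ▸ ⟨5 * 2 ^ i * 3 ^ j, by ring⟩) h8
    subst hi
    have hj : j ≤ 4 := by
      by_contra! hj
      exact absurd (((pow_dvd_pow 3 hj).trans h3G).trans hfac) (by decide)
    have := Fact.mk Nat.prime_five
    obtain ⟨u, v, m, hu0, hu2, hvj, hu, -, -, hmod, h7⟩ := key 5 le_rfl (by norm_num)
      (by rw [← hG]; ring)
    obtain rfl : u = 1 := by have := hu rfl; omega
    have hv := hvj.trans hj
    interval_cases v <;> omega
  · rw [hn] at hG hfac key
    have hi : i = 2 := by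
      obtain _ | _ | _ | i := i
      · exact absurd (hc4.dvd_of_dvd_mul_right (m := 13) (by simpa [← hG] using h4)) (by norm_num)
      · exact absurd (hc4.dvd_of_dvd_mul_right (m := 13 * 2) (by
          rw [← hG] at h4
          rw [mul_assoc]
          simpa only [zero_add, pow_one] using h4)) (by norm_num)
      · rfl
      · exact absurd (hG ▸ ⟨13 * 2 ^ i * 3 ^ j, by ring⟩) h8
    subst hi
    have hj : j ≤ 5 := by
      by_contra! hj
      exact absurd (((pow_dvd_pow 3 hj).trans h3G).trans hfac) (by decide)
    have := Fact.mk (show Nat.Prime 13 by norm_num)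
    obtain ⟨u, v, m, hu0, hu2, hvj, -, -, -, hmod, h7⟩ := key 13 (by norm_num) (by norm_num)
      (by rw [← hG]; ring)
    have hv := hvj.trans hj
    interval_cases u <;> interval_cases v <;> omega
  · rw [hn] at hG hfac key
    have hi : i = 1 := by
      obtain _ | _ | i := i
      · exact absurd (hc4.dvd_of_dvd_mul_right (m := 14) (by simpa [← hG] using h4)) (by norm_num)
      · rfl
      · exact absurd (hG ▸ ⟨7 * 2 ^ i * 3 ^ j, by ring⟩) h8
    subst hi
    have hj : j ≤ 2 := by
      by_contra! hj
      exact absurd (((pow_dvd_pow 3 hj).trans h3G).trans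
        (two_mul_card_dvd_of_index hns hM (by norm_num))) (by decide)
    have := Fact.mk (show Nat.Prime 7 by norm_num)
    obtain ⟨u, v, m, hu0, hu2, hvj, -, hm7, ham, hmod, h7⟩ := key 7 (by norm_num) (by norm_num)
      (by rw [← hG]; ring)
    have hv := hvj.trans hj
    rw [← hG] at ham
    interval_cases u <;> interval_cases v <;> try omega
    interval_cases j
    omega

omit hidx in
/-- A minimal simple group `G` with `δ(G) ≤ 16` is isomorphic to `A₅`. -/
theorem nonempty_equiv_of_isSimpleGroup (hδ : delta G ≤ 16) :
    Nonempty (G ≃* alternatingGroup (Fin 5)) := by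
  by_cases h5 : ∃ K : Subgroup G, K.index = 5
  · obtain ⟨K, hK⟩ := h5
    exact nonempty_equiv_of_index_five hns hK
  exfalso
  have hidx : ∀ K : Subgroup G, K ≠ ⊤ → 7 ≤ K.index := fun K hK => by
    have h1 := five_le_index hns hK
    have h2 : K.index ≠ 5 := fun h => h5 ⟨K, h⟩
    have h3 : K.index ≠ 6 := fun h => h5 (exists_index_five_of_index_six hns hmin h)
    omega
  obtain ⟨q, hq, T, hT, r, hr, hrq, x, hxT, hx, hxC, hle, hcls⟩ :=
    exists_isMinimalGood_of_delta_le hns hidx hmin hδ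
  have h : IsSingleClass q r T x := ⟨hT, hrq, hxT, hx, hxC, hle, hcls⟩
  have := Fact.mk hq
  have := Fact.mk hr
  obtain hlt | hlt := lt_or_gt_of_ne hrq
  · obtain ⟨rfl, rfl, hnf⟩ := h.eq_three_two hns hmin hidx hlt
    exact h.false_of_three_two hns hmin hidx hnf
  · obtain ⟨rfl, -, -, rfl | rfl⟩ := h.card_eq hns hmin hlt hT.isPGroup hxT hxC
    · exact h.false_of_three hns hmin hidx
    · exact h.false_of_seven hns hmin hidx

end SingleClass

end ChainLength

namespace ChainLength

open MulAction

section Overgroup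

variable {G : Type*} [Group G] [Finite G]

theorem exists_sylow_le_of_card_eq {p i m : ℕ} [Fact p.Prime] {K : Subgroup G}
    (hK : Nat.card K = p ^ i * m) (hm : ¬ p ∣ m) :
    ∃ S ≤ K, IsPGroup p S ∧ Nat.card S = p ^ i ∧ S.relIndex K = m := by
  let P : Sylow p K := default
  obtain ⟨h1, h2⟩ := card_sylow_of_card_eq P hK hm
  refine ⟨P.1.map K.subtype, Subgroup.map_subtype_le _, P.2.map _, ?_, ?_⟩
  · rwa [Subgroup.card_map_of_injective K.subtype_injective]
  · rw [Subgroup.relIndex, Subgroup.subgroupOf,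
      Subgroup.comap_map_eq_self_of_injective K.subtype_injective]
    exact h2

/-- A group of order `120` with a subgroup of index `5` and without normal Sylow `5`-subgroup
contains a bad subgroup of order greater than `2`. -/
theorem exists_not_good_of_card_eq (hG : Nat.card G = 120) {K : Subgroup G} (hK : K.index = 5)
    (h5 : ∀ P : Sylow 5 G, Subgroup.normalizer (P : Set G) ≠ ⊤) :
    ∃ H : Subgroup G, ¬ Good H ∧ 2 < Nat.card H := by
  by_contra! hgood
  have hgood : ∀ H : Subgroup G, 2 < Nat.card H → Good H := fun H hH => by
    by_contra h
    exact absurd (hgood H h) (by omega)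
  have := Fact.mk Nat.prime_five
  let P : Sylow 5 G := default
  set B := Subgroup.normalizer (P : Set G) with hB
  have hP : Nat.card P = 5 := (card_sylow_of_card_eq (i := 1) (m := 24) P (by rw [hG]; norm_num)
    (by norm_num)).1
  have hmod : B.index % 5 = 1 := index_normalizer_mod P
  have hBi : B.index = 6 := by
    have h1 : B.index ≠ 1 := fun h => h5 P (Subgroup.index_eq_one.1 h)
    have h2 : B.index ∣ 24 := by
      obtain ⟨c, hc⟩ : 5 ∣ Nat.card B := by
        rw [← hP]
        exact Subgroup.card_dvd_of_le Subgroup.le_normalizer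
      have := B.card_mul_index
      rw [hG, hc] at this
      exact ⟨c, by nlinarith⟩
    have h3 := Nat.le_of_dvd (by norm_num) h2
    interval_cases B.index <;> omega
  have hBc : Nat.card B = 20 := by
    have := B.card_mul_index
    rw [hG, hBi] at this
    omega
  have hKc : Nat.card K = 24 := by
    have := K.card_mul_index
    rw [hG, hK] at this
    omega
  obtain ⟨T, hTB, hT2, hT, hTi⟩ := exists_sylow_le_of_card_eq (p := 2) (i := 2) (m := 5)
    (K := B) (by rw [hBc]; norm_num) (by norm_num)
  obtain ⟨S, hSK, hS2, hS, hSi⟩ := exists_sylow_le_of_card_eq (p := 2) (i := 3) (m := 3)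
    (K := K) (by rw [hKc]; norm_num) (by norm_num)
  have gT : Good T := hgood T (by rw [hT]; norm_num)
  have gS : Good S := hgood S (by rw [hS]; norm_num)
  have gK : Good K := gS.mono hSK
  have e1 := gT.rho_eq_of_isPGroup_of_isPGroup gS hT2 hS2
  have e2 := gT.rho_eq_of_prime hTB (by rw [hTi]; norm_num)
  have e3 := gS.rho_eq_of_prime hSK (by rw [hSi]; norm_num)
  have e4 := gK.rho_eq_of_prime le_top (by rw [Subgroup.relIndex_top_right, hK]; norm_num)
  obtain ⟨X, hBX, hX⟩ := exists_le_covBy_of_lt (lt_top_iff_ne_top.2 (h5 P))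
  have hXp := (gT.mono hTB).prime_relIndex (K := ⊤) (by omega) hBX hX le_rfl
  rw [Subgroup.relIndex_top_right] at hXp
  have hmul := Subgroup.relIndex_mul_index hBX
  have hXm : B.relIndex X % 5 = 1 := by
    let Q : Sylow 5 X := P.subtype (Subgroup.le_normalizer.trans hBX)
    have := index_normalizer_mod Q
    have hQ : B.subgroupOf X = Subgroup.normalizer (Q : Set X) :=
      Subgroup.subgroupOf_normalizer_eq (Subgroup.le_normalizer.trans hBX)
    rwa [← hQ] at this
  rw [hBi, show Subgroup.normalizer (P : Set G) = B from rfl] at hmul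
  have h1 := hXp.one_lt
  have h3 : X.index ≤ 6 := Nat.le_of_dvd (by norm_num) ⟨_, by rw [mul_comm]; exact hmul.symm⟩
  generalize X.index = a at *
  interval_cases a <;> first | omega | norm_num at hXp

end Overgroup

section Induction

variable {G : Type*} [Group G] [Finite G]

omit [Finite G] in
theorem simple_le_of_normal {M N : Subgroup G} [IsSimpleGroup M] [hN : N.Normal]
    (h : N ⊓ M ≠ ⊥) : M ≤ N := by
  have h1 : (N.subgroupOf M).Normal := inferInstance
  obtain h2 | h2 := h1.eq_bot_or_eq_top
  · exact absurd (disjoint_iff.1 (Subgroup.subgroupOf_eq_bot.1 h2)) h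
  · exact Subgroup.subgroupOf_eq_top.1 h2

theorem not_good_of_not_isSolvable_quotient {N : Subgroup G} [N.Normal]
    (h : ¬ Group.IsSolvable (G ⧸ N)) : ¬ Good N := fun hN => by
  refine not_good_bot h (Good.of_comap_surjective (QuotientGroup.mk'_surjective N) ?_)
  rwa [MonoidHom.comap_bot, QuotientGroup.ker_mk']

/-- If `δ(M) = δ(G) = 16` for a subgroup `M ≅ A₅` of `G`, then the bad subgroups of `G` have order
at most `2` and lie in `M`. -/
theorem le_and_card_le_of_not_good {M : Subgroup G} (e : M ≃* alternatingGroup (Fin 5))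
    (hδ : delta G ≤ 16) {H : Subgroup G} (hH : ¬ Good H) : H ≤ M ∧ Nat.card H ≤ 2 := by
  let φ : {H : Subgroup M // ¬ Good H} → {H : Subgroup G // ¬ Good H} :=
    fun H => ⟨H.1.map M.subtype, fun h => H.2 (h.of_map_injective M.subtype_injective)⟩
  have hφ : Function.Injective φ := by
    rintro ⟨A, _⟩ ⟨B, _⟩ h
    simpa [φ, Subgroup.map_injective M.subtype_injective |>.eq_iff] using h
  have hM : delta M = 16 := (delta_eq_of_equiv e).trans delta_alternating_five
  have hle := delta_le_of_injective M.subtype_injective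
  have hcard : Nat.card {H : Subgroup M // ¬ Good H} = Nat.card {H : Subgroup G // ¬ Good H} := by
    rw [← delta_eq, ← delta_eq]
    omega
  obtain ⟨A, hA⟩ := (Nat.bijective_iff_injective_and_card φ |>.2 ⟨hφ, hcard⟩).2 ⟨H, hH⟩
  have hA : A.1.map M.subtype = H := congrArg Subtype.val hA
  subst hA
  refine ⟨Subgroup.map_subtype_le _, ?_⟩
  rw [Subgroup.card_map_of_injective M.subtype_injective,
    ← Subgroup.card_map_of_injective (f := e.toMonoidHom) e.injective]
  exact not_good_iff_alternating_five.1 ((good_map_equiv e).not.2 A.2)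

attribute [local instance] conjAction

/-- A proper subgroup isomorphic to `A₅` forces `δ(G) > 16`. -/
theorem eq_top_of_equiv_alternating_five {M : Subgroup G} (e : M ≃* alternatingGroup (Fin 5))
    (hδ : delta G ≤ 16) : M = ⊤ := by
  by_contra hM
  have hbad {H : Subgroup G} (hH : ¬ Good H) := le_and_card_le_of_not_good e hδ hH
  have : IsSimpleGroup (alternatingGroup (Fin 5)) :=
    alternatingGroup.isSimpleGroup (α := Fin 5) (by simp)
  have : IsSimpleGroup M := e.isSimpleGroup
  have hMc : Nat.card M = 60 := by
    rw [Nat.card_congr e.toEquiv]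
    exact card_alternating_five (by simp)
  have hMns : ¬ Group.IsSolvable M := not_isSolvable_of_card (by rw [hMc]; norm_num)
  have := Fact.mk Nat.prime_two
  obtain ⟨x, hx⟩ := exists_prime_orderOf_dvd_card' (G := M) 2 (by rw [hMc]; norm_num)
  have hxbad : ¬ Good ((Subgroup.zpowers x).map M.subtype) := fun h => by
    have h := (good_map_equiv e).2 (h.of_map_injective M.subtype_injective)
    refine not_good_iff_alternating_five.2 ?_ h
    rw [Subgroup.card_map_of_injective (f := e.toMonoidHom) e.injective, Nat.card_zpowers, hx]
  have hcore : M ≤ M.normalCore := by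
    refine simple_le_of_normal fun h => ?_
    rw [inf_eq_left.2 M.normalCore_le] at h
    have hxc : (x : G) ∈ M.normalCore := fun g => by
      refine (hbad (good_conj_smul (g := g).not.2 hxbad)).1 ?_
      rw [mem_conj_smul]
      exact ⟨x, Subgroup.mem_zpowers x, by simp [mul_assoc]⟩
    rw [h, Subgroup.mem_bot] at hxc
    rw [show x = 1 from Subtype.ext hxc, orderOf_one] at hx
    omega
  have hMn : M.Normal := le_antisymm M.normalCore_le hcore ▸ inferInstance
  have hmin {N : Subgroup G} (hN : N.Normal) (h : N ≠ ⊥) : M ≤ N := by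
    refine simple_le_of_normal fun hNM => h ?_
    have hNbad : ¬ Good N := not_good_of_not_isSolvable_quotient fun hs => hMns <| by
      have : Function.Injective ((QuotientGroup.mk' N).comp M.subtype) := by
        rw [← MonoidHom.ker_eq_bot_iff, ← MonoidHom.comap_ker, QuotientGroup.ker_mk']
        exact Subgroup.subgroupOf_eq_bot.2 (disjoint_iff.2 hNM)
      exact Group.isSolvable_of_isSolvable_injective this
    rw [← hNM, left_eq_inf]
    exact (hbad hNbad).1
  let P : Sylow 2 M := default
  let K := Subgroup.normalizer ((P.1.map M.subtype : Subgroup G) : Set G)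
  have hK : K.index = 5 := by
    have h1 : K ⊔ M = ⊤ := Sylow.normalizer_sup_eq_top P
    have h2 : K.subgroupOf M = Subgroup.normalizer (P : Set M) := by
      rw [Subgroup.subgroupOf_normalizer_eq (Subgroup.map_subtype_le _), Subgroup.subgroupOf,
        Subgroup.comap_map_eq_self_of_injective M.subtype_injective]
      rfl
    have h3 : K.relIndex M = 5 := by
      rw [Subgroup.relIndex, h2]
      exact index_normalizer_sylow_two hMns hMc P
    have h4 := Subgroup.relIndex_mul_index (inf_le_left : K ⊓ M ≤ K)
    rw [← Subgroup.relIndex_mul_index (inf_le_right : K ⊓ M ≤ M), Subgroup.inf_relIndex_left,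
      Subgroup.inf_relIndex_right, ← Subgroup.relIndex_sup_right, h1,
      Subgroup.relIndex_top_right, h3, mul_comm] at h4
    exact Nat.eq_of_mul_eq_mul_right (Nat.pos_of_ne_zero M.index_ne_zero_of_finite) h4
  have hKM : ¬ M ≤ K := fun h => by
    have h1 : K ⊔ M = ⊤ := Sylow.normalizer_sup_eq_top P
    rw [sup_eq_left.2 h] at h1
    rw [h1, Subgroup.index_top] at hK
    omega
  have hKcore : K.normalCore = ⊥ := by
    by_contra h
    exact hKM ((hmin inferInstance h).trans K.normalCore_le)
  have hG : Nat.card G = 120 := by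
    have h1 : Function.Injective (toPermHom G (G ⧸ K)) := by
      rw [← MonoidHom.ker_eq_bot_iff, ← Subgroup.normalCore_eq_ker, hKcore]
    have h2 := Subgroup.card_dvd_of_injective _ h1
    rw [Nat.card_perm, ← Subgroup.index, hK] at h2
    have h3 := M.card_mul_index
    have h4 : M.index ≠ 1 := fun h => hM (Subgroup.index_eq_one.1 h)
    rw [hMc] at h3
    rw [← h3] at h2 ⊢
    have h5 : M.index ∣ 2 := Nat.dvd_of_mul_dvd_mul_left (by norm_num : 0 < 60) h2
    rw [((Nat.dvd_prime Nat.prime_two).1 h5).resolve_left h4]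
  obtain ⟨H, hH, hH2⟩ := exists_not_good_of_card_eq hG hK fun Q hQ => by
    have := Fact.mk Nat.prime_five
    have hQc : Nat.card Q = 5 := (card_sylow_of_card_eq (i := 1) (m := 24) Q
      (by rw [hG]; norm_num) (by norm_num)).1
    have hMQ : M ≤ Q := hmin (Subgroup.normalizer_eq_top_iff.1 hQ) fun h => by
      have : Nat.card (Q : Subgroup G) = 5 := hQc
      rw [h, Subgroup.card_bot] at this
      omega
    have := Nat.le_of_dvd Nat.card_pos (Subgroup.card_dvd_of_le hMQ)
    have h5 : Nat.card (Q : Subgroup G) = 5 := hQc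
    omega
  exact absurd (hbad hH).2 (by omega)

theorem nonempty_equiv_alternating_five (hG : ¬ Group.IsSolvable G) (hδ : delta G ≤ 16) :
    Nonempty (G ≃* alternatingGroup (Fin 5)) := by
  induction hn : Nat.card G using Nat.strong_induction_on generalizing G with
  | h n ih =>
    subst hn
    have hmin (M : Subgroup G) (hM : M ≠ ⊤) : Group.IsSolvable M := by
      by_contra hs
      obtain ⟨e⟩ := ih _ (lt_of_le_of_ne M.card_le_card_group fun h => hM (M.eq_top_of_card_eq h))
        hs ((delta_le_of_injective M.subtype_injective).trans hδ) rfl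
      exact hM (eq_top_of_equiv_alternating_five e hδ)
    by_cases hsimple : IsSimpleGroup G
    · exact nonempty_equiv_of_isSimpleGroup hG hmin hδ
    exfalso
    have : Nontrivial G := by
      by_contra h
      rw [not_nontrivial_iff_subsingleton] at h
      exact hG inferInstance
    obtain ⟨N, hN, h1, h2⟩ : ∃ N : Subgroup G, N.Normal ∧ N ≠ ⊥ ∧ N ≠ ⊤ := by
      by_contra! h
      exact hsimple ⟨fun N hN => or_iff_not_imp_left.2 (h N hN)⟩
    have hNs := hmin N h2
    have hlt := delta_lt_of_surjective (QuotientGroup.mk'_surjective N) (not_good_bot hG)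
      (by rwa [QuotientGroup.ker_mk', le_bot_iff])
    have hQ : ¬ Group.IsSolvable (G ⧸ N) := fun h => hG <|
      Group.isSolvable_of_ker_le_range N.subtype (QuotientGroup.mk' N) (by simp)
    have hcard : Nat.card (G ⧸ N) < Nat.card G := by
      rw [← N.index_mul_card]
      exact lt_mul_of_one_lt_right (Nat.pos_of_ne_zero N.index_ne_zero_of_finite)
        (N.one_lt_card_iff_ne_bot.2 h1)
    obtain ⟨e⟩ := ih _ hcard hQ (by omega) rfl
    have := (delta_eq_of_equiv e).trans delta_alternating_five
    omega

end Induction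

end ChainLength

theorem stmt_10 {G : Type*} [Group G] [Finite G] (hG : ¬ IsSolvable G) :
    delta G ≤ 16 ↔ Nonempty (G ≃* alternatingGroup (Fin 5)) := by
  refine ⟨ChainLength.nonempty_equiv_alternating_five hG, fun ⟨e⟩ => ?_⟩
  rw [ChainLength.delta_eq_of_equiv e, ChainLength.delta_alternating_five]
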